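/- arXiv:2404.09085 — 2 statements merged into one kernel-verified Lean document; each statement's English description precedes it below -/
import Mathlib

section
/- There is an absolute constant C such that for every function b : O∖{0} → ℂ constant on associate classes, every θ ∈ ℂ∖{0}, every c ∈ O∖{0} and every N > 0, one has |B(θ,c,N)| ≤ C·τ(c)²·|c|·N²·‖b_N‖₂², where τ(c) denotes the number of ideals of O dividing the ideal (c). -/
open scoped Real ComplexConjugate
open Complex

/-- `e[z] = exp(2πi Re z)`. -/
noncomputable def efn (z : ℂ) : ℂ := Complex.exp (2 * Real.pi * Complex.I * z.re)

/-- The Kloosterman sum `S(m, n; c)` over the Gaussian integers: the sum over invertible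
residues `α` modulo `c` (with `δ` the inverse residue) of `e[(αm + δn)/c]`. -/
noncomputable def kloosterman (m n c : GaussianInt) : ℂ :=
  ∑ᶠ u : (GaussianInt ⧸ Ideal.span {c})ˣ,
    efn (((Quotient.out (u : GaussianInt ⧸ Ideal.span {c}) : GaussianInt) * m +
          (Quotient.out ((u⁻¹ : (GaussianInt ⧸ Ideal.span {c})ˣ) :
              GaussianInt ⧸ Ideal.span {c}) : GaussianInt) * n : GaussianInt) / (c : ℂ))

/-- `n` is the distinguished generator of its ideal: nonzero with argument in `[0, π/2)`. -/
def IsGen (n : GaussianInt) : Prop :=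
  n ≠ 0 ∧ 0 ≤ Complex.arg (n : ℂ) ∧ Complex.arg (n : ℂ) < Real.pi / 2

/-- distinguished generator in the annulus `N < |n| ≤ √2·N`. -/
def InAnn (N : ℝ) (n : GaussianInt) : Prop :=
  IsGen n ∧ N < ‖(n : ℂ)‖ ∧ ‖(n : ℂ)‖ ≤ Real.sqrt 2 * N

/-- `‖b_N‖₂² = Σ_{N < |n| ≤ √2 N} |b_n|²`, over distinguished generators. -/
noncomputable def sqNorm (b : GaussianInt → ℂ) (N : ℝ) : ℝ :=
  ∑ᶠ n ∈ {n : GaussianInt | InAnn N n}, ‖b n‖ ^ 2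

/-- The quadratic form
`B(θ,c,N) = Σ_m Σ_n b_m conj(b_n) S(m,n;c) cos(4π Re(√(mn) θ / c))`. -/
noncomputable def Bform (b : GaussianInt → ℂ) (θ : ℂ) (c : GaussianInt) (N : ℝ) : ℂ :=
  ∑ᶠ m ∈ {m : GaussianInt | InAnn N m}, ∑ᶠ n ∈ {n : GaussianInt | InAnn N n},
    b m * conj (b n) * kloosterman m n c *
      Real.cos (4 * Real.pi * ((((m : ℂ) * (n : ℂ)) ^ ((1:ℂ)/2) * θ / (c : ℂ)).re))

/-- `τ(c)`: the number of ideals of `ℤ[i]` dividing the ideal `(c)`. -/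
noncomputable def tauIdeals (c : GaussianInt) : ℕ :=
  Nat.card {I : Ideal GaussianInt // I ∣ Ideal.span {c}}



namespace KW
open Polynomial

section Stepanov
variable {F : Type*} [Field F]

/-- The monomial `x^a z^b`. -/
noncomputable def mon (F : Type*) [Field F] (a b : ℕ) : F[X][X] := C (X ^ a) * X ^ b

/-- the plane curve -/
noncomputable def GG (p : ℕ) (A B t : F) : F[X][X] :=
  X ^ p - (C (X ^ (p-1)) * X + C (C A * X ^ (p+1) - C t * X ^ p + C B * X ^ (p-1)))

/-- reduced with weights `< n` -/
def WW (p n : ℕ) (P : F[X][X]) : Prop :=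
  ∀ b a, (P.coeff b).coeff a ≠ 0 → b < p ∧ p * a + (p+1) * b < n

lemma WW.zero (p n : ℕ) : WW p n (0 : F[X][X]) := by
  intro b a h; simp at h

lemma WW.add {p n : ℕ} {P Q : F[X][X]} (hP : WW p n P) (hQ : WW p n Q) : WW p n (P + Q) := by
  intro b a h
  rw [coeff_add, coeff_add] at h
  by_cases h1 : (P.coeff b).coeff a = 0
  · exact hQ b a (by simpa [h1] using h)
  · exact hP b a h1

lemma WW.smul {p n : ℕ} {P : F[X][X]} (hP : WW p n P) (c : F) : WW p n (C (C c) * P) := by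
  intro b a h
  rw [coeff_C_mul, coeff_C_mul] at h
  exact hP b a (right_ne_zero_of_mul h)

lemma WW.mono {p n m : ℕ} {P : F[X][X]} (hP : WW p n P) (h : n ≤ m) : WW p m P := by
  intro b a h'
  exact ⟨(hP b a h').1, (hP b a h').2.trans_le h⟩

lemma coeff_mon (a b a' b' : ℕ) : ((mon F a b).coeff b').coeff a' = if b' = b ∧ a' = a then 1 else 0 := by
  unfold mon
  rw [coeff_C_mul, coeff_X_pow]
  by_cases h : b' = b <;> simp [h, coeff_X_pow]

lemma WW.mon {p a b n : ℕ} (hb : b < p) (h : p * a + (p+1) * b < n) : WW p n (mon F a b) := by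
  intro b' a' h'
  rw [coeff_mon] at h'
  split_ifs at h' with h2
  · rw [h2.1, h2.2]; exact ⟨hb, h⟩
  · exact absurd rfl h'

lemma WW.sum {ι : Type*} {p n : ℕ} (s : Finset ι) (P : ι → F[X][X]) (h : ∀ i ∈ s, WW p n (P i)) :
    WW p n (∑ i ∈ s, P i) := by
  classical
  induction s using Finset.induction_on with
  | empty => simpa using WW.zero p n
  | insert a s ha ih =>
    rw [Finset.sum_insert ha]
    exact (h a (by simp)).add (ih fun i hi => h i (by simp [hi]))

lemma GG_monic {p : ℕ} (hp : 2 ≤ p) (A B t : F) : (GG p A B t).Monic ∧ (GG p A B t).degree = p := by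
  have h1 : (C (X ^ (p-1)) * X + C (C A * X ^ (p+1) - C t * X ^ p + C B * X ^ (p-1)) : F[X][X]).degree < p := by
    refine (degree_linear_le).trans_lt ?_
    exact_mod_cast hp
  refine ⟨monic_X_pow_sub (n := p) ?_, ?_⟩
  · exact h1
  · unfold GG
    rw [degree_sub_eq_left_of_degree_lt] <;> rw [degree_X_pow]
    exact h1

lemma WW.eq_zero {p n : ℕ} (hp : 2 ≤ p) {A B t : F} {P : F[X][X]} (hP : WW p n P)
    (hd : GG p A B t ∣ P) : P = 0 := by
  by_contra hne
  have h1 := (GG_monic hp A B t)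
  have h2 := degree_le_of_dvd hd hne
  rw [h1.2] at h2
  have h3 : P.coeff P.natDegree ≠ 0 := by simpa using hne
  obtain ⟨a, ha⟩ : ∃ a, (P.coeff P.natDegree).coeff a ≠ 0 := by
    by_contra! hcon
    exact h3 (Polynomial.ext (by simpa using hcon))
  have := (hP _ _ ha).1
  rw [degree_eq_natDegree hne] at h2
  have h2' : p ≤ P.natDegree := by exact_mod_cast h2
  omega

lemma red_step {p : ℕ} (hp : 2 ≤ p) (A B t : F) (a b : ℕ) :
    mon F a (b + p) = GG p A B t * mon F a b + (C (C A) * mon F (a+p+1) b + mon F (a+p-1) (b+1)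
      + C (C (-t)) * mon F (a+p) b + C (C B) * mon F (a+p-1) b) := by
  obtain ⟨k, rfl⟩ : ∃ k, p = k + 1 := ⟨p - 1, by omega⟩
  simp only [mon, GG, show a + (k+1) - 1 = a + k by omega, show k + 1 - 1 = k by omega, map_add, map_sub, map_mul, map_pow, map_neg]
  ring

lemma red {p : ℕ} (hp : 2 ≤ p) {A : F} (hA : A ≠ 0) (B t : F) : ∀ b a, ∃ c : F, c ≠ 0 ∧ ∃ a' b', b' < p ∧
    p * a' + (p+1) * b' = p * a + (p+1) * b ∧ ∃ P, WW p (p * a + (p+1) * b) P ∧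
      GG p A B t ∣ mon F a b - (C (C c) * mon F a' b' + P) := by
  intro b
  induction b using Nat.strong_induction_on with
  | _ b ih =>
  intro a
  rcases lt_or_ge b p with hb | hb
  · exact ⟨1, one_ne_zero, a, b, hb, rfl, 0, WW.zero _ _, by simp⟩
  · obtain ⟨b, rfl⟩ : ∃ k, b = k + p := ⟨b - p, by omega⟩
    have cor : ∀ b' < b + p, ∀ a', p * a' + (p+1) * b' < p * a + (p+1)*(b+p) → ∃ P,
        WW p (p * a + (p+1)*(b+p)) P ∧ GG p A B t ∣ mon F a' b' - P := by
      intro b' hb' a' hw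
      obtain ⟨c, hc, a1, b1, h1, h2, P, hP, hd⟩ := ih b' hb' a'
      exact ⟨_, ((WW.mon h1 (h2 ▸ hw)).smul c).add (hP.mono hw.le), hd⟩
    obtain ⟨c, hc, a1, b1, h1, h2, P, hP, hd⟩ := ih b (by omega) (a+p+1)
    have e1 : p * (a+p+1) + (p+1) * b = p * a + (p+1)*(b+p) := by ring
    obtain ⟨k, hk⟩ : ∃ k, p = k + 1 := ⟨p - 1, by omega⟩
    have e2 : p * (a+p-1) + (p+1) * (b+1) < p * a + (p+1)*(b+p) := by
      subst hk
      rw [show a + (k+1) - 1 = a + k by omega]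
      nlinarith
    obtain ⟨P2, hP2, hd2⟩ := cor (b+1) (by omega) (a+p-1) e2
    obtain ⟨P3, hP3, hd3⟩ := cor b (by omega) (a+p) (by nlinarith)
    obtain ⟨P4, hP4, hd4⟩ := cor b (by omega) (a+p-1) (by nlinarith)
    refine ⟨A * c, mul_ne_zero hA hc, a1, b1, h1, h2.trans e1, C (C A) * P + P2 + C (C (-t)) * P3 + C (C B) * P4, ?_, ?_⟩
    · exact ((((e1 ▸ hP).smul A).add hP2).add (hP3.smul _)).add (hP4.smul _)
    · rw [red_step hp A B t]
      have : GG p A B t * mon F a b + (C (C A) * mon F (a+p+1) b + mon F (a+p-1) (b+1)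
          + C (C (-t)) * mon F (a+p) b + C (C B) * mon F (a+p-1) b) - (C (C (A * c)) * mon F a1 b1 + (C (C A) * P + P2 + C (C (-t)) * P3 + C (C B) * P4))
          = GG p A B t * mon F a b + C (C A) * (mon F (a+p+1) b - (C (C c) * mon F a1 b1 + P)) + (mon F (a+p-1) (b+1) - P2)
          + C (C (-t)) * (mon F (a+p) b - P3) + C (C B) * (mon F (a+p-1) b - P4) := by
        simp only [map_mul]; ring
      rw [this]
      exact ((((dvd_mul_right _ _).add (hd.mul_left _)).add hd2).add (hd3.mul_left _)).add (hd4.mul_left _)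

lemma red' {p : ℕ} (hp : 2 ≤ p) {A : F} (hA : A ≠ 0) (B t : F) (a b n : ℕ) (hn : p * a + (p+1) * b < n) :
    ∃ P, WW p n P ∧ GG p A B t ∣ mon F a b - P := by
  obtain ⟨c, hc, a1, b1, h1, h2, P, hP, hd⟩ := red hp hA B t b a
  exact ⟨_, ((WW.mon h1 (h2 ▸ hn)).smul c).add (hP.mono hn.le), hd⟩

lemma indep {p : ℕ} (hp : 2 ≤ p) {A : F} (hA : A ≠ 0) (B t : F) {ι : Type*} [Fintype ι]
    (u v : ι → ℕ) (hinj : Function.Injective fun i => p * u i + (p+1) * v i) (d : ι → F)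
    (hd : GG p A B t ∣ ∑ i, C (C (d i)) * mon F (u i) (v i)) : ∀ i, d i = 0 := by
  classical
  by_contra! hne
  obtain ⟨i0, hi0, hmax⟩ := (Finset.univ.filter fun i => d i ≠ 0).exists_max_image
    (fun i => p * u i + (p+1) * v i) (by obtain ⟨i, hi⟩ := hne; exact ⟨i, by simp [hi]⟩)
  simp only [Finset.mem_filter, Finset.mem_univ, true_and] at hi0 hmax
  set n := p * u i0 + (p+1) * v i0 with hn
  have hrest : ∀ i ∈ Finset.univ.erase i0, ∃ P, WW p n P ∧ GG p A B t ∣ C (C (d i)) * mon F (u i) (v i) - P := by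
    intro i hi
    by_cases hz : d i = 0
    · exact ⟨0, WW.zero _ _, by simp [hz]⟩
    · have h1 := hmax i hz
      have h2 : p * u i + (p+1) * v i ≠ n := fun h => (Finset.ne_of_mem_erase hi) (hinj h)
      obtain ⟨P, hP, h⟩ := red' hp hA B t (u i) (v i) n (by omega)
      exact ⟨_, hP.smul (d i), by rw [← mul_sub]; exact h.mul_left _⟩
  choose! P hP hPd using hrest
  obtain ⟨c, hc, a1, b1, h1, h2, P0, hP0, hd0⟩ := red hp hA B t (v i0) (u i0)
  have hW : WW p n (C (C (d i0)) * P0 + ∑ i ∈ Finset.univ.erase i0, P i) :=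
    (hP0.smul _).add (WW.sum _ _ hP)
  set R := C (C (d i0)) * P0 + ∑ i ∈ Finset.univ.erase i0, P i with hR
  have hdiv : GG p A B t ∣ C (C (d i0)) * (C (C c) * mon F a1 b1) + R := by
    have e : C (C (d i0)) * (C (C c) * mon F a1 b1) + R = ∑ i, C (C (d i)) * mon F (u i) (v i)
       - C (C (d i0)) * (mon F (u i0) (v i0) - (C (C c) * mon F a1 b1 + P0))
       - ∑ i ∈ Finset.univ.erase i0, (C (C (d i)) * mon F (u i) (v i) - P i) := by
      rw [hR, Finset.sum_sub_distrib, ← Finset.add_sum_erase _ _ (Finset.mem_univ i0)]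
      ring
    rw [e]
    exact (hd.sub (hd0.mul_left _)).sub (Finset.dvd_sum hPd)
  have hz := WW.eq_zero (n := n+1) hp (((((WW.mon h1 (by omega)).smul c)).smul (d i0)).add (hW.mono (by omega))) hdiv
  have hco := congrArg (fun Q : F[X][X] => (Q.coeff b1).coeff a1) hz
  simp only [coeff_add, coeff_C_mul, coeff_mon, and_self, if_true, coeff_zero, mul_one] at hco
  have : (R.coeff b1).coeff a1 = 0 := by
    by_contra h
    have := (hW b1 a1 h).2
    omega
  rw [this, add_zero] at hco
  exact (mul_ne_zero hi0 hc) hco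

end Stepanov
end KW


namespace KW
open Polynomial

section Stepanov2
variable {F : Type*} [Field F]

lemma exists_relation {p : ℕ} (hp : 2 ≤ p) {A : F} (hA : A ≠ 0) (B t : F) {ι : Type*} [Fintype ι]
    (u v : ι → ℕ) (n : ℕ) (hw : ∀ i, p * u i + (p+1) * v i < n) (hcard : n < Fintype.card ι) :
    ∃ g : ι → F, (∃ i, g i ≠ 0) ∧ GG p A B t ∣ ∑ i, C (C (g i)) * mon F (u i) (v i) := by
  choose P hP hPd using fun i => red' hp hA B t (u i) (v i) n (hw i)
  let vec : ι → (Fin n → F) := fun i w => ((P i).coeff ((w:ℕ) % p)).coeff ((w:ℕ)/p - (w:ℕ)%p)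
  have hnl : ¬ LinearIndependent F vec := by
    intro h
    have := h.fintype_card_le_finrank
    simp at this
    omega
  obtain ⟨g, hg, i, hi⟩ := Fintype.not_linearIndependent_iff.1 hnl
  refine ⟨g, ⟨i, hi⟩, ?_⟩
  have hW : WW p n (∑ i, C (C (g i)) * P i) := WW.sum _ _ fun i _ => (hP i).smul _
  have hz : ∑ i, C (C (g i)) * P i = 0 := by
    refine Polynomial.ext fun b => Polynomial.ext fun a => ?_
    by_contra hne
    have hne' : ((∑ i, C (C (g i)) * P i).coeff b).coeff a ≠ 0 := by simpa using hne
    obtain ⟨hb, hlt⟩ := hW b a hne'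
    have hg' := congrFun hg ⟨p * a + (p+1) * b, hlt⟩
    have e1 : (p * a + (p+1) * b) % p = b := by
      rw [show p * a + (p+1) * b = b + p * (a + b) by ring, Nat.add_mul_mod_self_left, Nat.mod_eq_of_lt hb]
    have e2 : (p * a + (p+1) * b) / p = a + b := by
      rw [show p * a + (p+1) * b = b + p * (a + b) by ring, Nat.add_mul_div_left _ _ (by omega), Nat.div_eq_of_lt hb, zero_add]
    simp only [Finset.sum_apply, Pi.smul_apply, vec, e1, e2, Nat.add_sub_cancel, smul_eq_mul, Pi.zero_apply] at hg'
    apply hne'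
    simp only [finsetSum_coeff, coeff_C_mul]
    exact hg'
  have e : ∑ i, C (C (g i)) * mon F (u i) (v i) = ∑ i, C (C (g i)) * (mon F (u i) (v i) - P i) + ∑ i, C (C (g i)) * P i := by
    rw [← Finset.sum_add_distrib]; exact Finset.sum_congr rfl fun i _ => by ring
  rw [e, hz, add_zero]
  exact Finset.dvd_sum fun i _ => (hPd i).mul_left _

lemma evalEval_GG {p : ℕ} (hp : 2 ≤ p) (A B t x y : F) (hx : x ≠ 0)
    (h : y ^ p - y = A * x + B * x⁻¹ - t) : (GG p A B t).evalEval x (x * y) = 0 := by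
  obtain ⟨k, rfl⟩ : ∃ k, p = k + 1 := ⟨p - 1, by omega⟩
  have : y ^ (k+1) = y + A * x + B * x⁻¹ - t := by linear_combination h
  simp only [GG, evalEval, eval_sub, eval_add, eval_mul, eval_pow, eval_X, eval_C, Nat.add_sub_cancel]
  rw [mul_pow, this]
  field_simp
  ring

lemma evalEval_mon (x z : F) (a b : ℕ) : (mon F a b).evalEval x z = x ^ a * z ^ b := by
  simp [mon, evalEval]

/-- The set of the `x` such that `y^p - y = Ax + B/x - t` is solvable. -/
def XS (p : ℕ) (A B t : F) : Set F := {x | x ≠ 0 ∧ ∃ y, y ^ p - y = A * x + B * x⁻¹ - t}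

set_option maxHeartbeats 1000000 in
theorem stepanov [Fintype F] (p a : ℕ) [Fact p.Prime] [CharP F p] (ha : 5 ≤ a)
    (hF : Fintype.card F = (p ^ a) ^ 2) {A : F} (hA : A ≠ 0) (B t : F) :
    (XS p A B t).ncard ≤ p ^ a * p ^ (a-1) + (2 * p + 3) * p ^ a := by
  classical
  have hpp : p.Prime := Fact.out
  have hp := hpp.two_le
  obtain ⟨s, rfl⟩ : ∃ s, a = s + 1 := ⟨a - 1, by omega⟩
  rw [Nat.add_sub_cancel]
  set r' := p ^ s with hr'
  set r := p ^ (s+1) with hr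
  have hrr : r = p * r' := by rw [hr, hr', pow_succ, mul_comm]
  have hbig : p ^ 4 ≤ r' := Nat.pow_le_pow_right (by omega) (by omega)
  have hbig2 : 2 * p * (p * p) ≤ r' := by nlinarith [Nat.pow_le_pow_left hp 2, hbig, Nat.zero_le (p^3)]
  obtain ⟨L, hL⟩ : ∃ L, r' = L + p := ⟨r' - p, by nlinarith [Nat.sub_add_cancel (show p ≤ r' by nlinarith)]⟩
  set M := r' + p + 2 with hM
  -- indices
  let ι := (Fin M × Fin p) × (Fin L × Fin p)
  have hpos : 0 < p := by omega
  have hkey : r * r + p * (M + p) < Fintype.card ι := by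
    simp only [ι, Fintype.card_prod, Fintype.card_fin]
    have h1 : M * p * (L * p) = p * p * M * L := by ring
    rw [h1, hrr, hM]
    have hL' : (L:ℤ) = r' - p := by omega
    zify
    rw [hL']
    have h2 : (2 * p * (p * p) : ℤ) ≤ r' := by exact_mod_cast hbig2
    have h3 : (2:ℤ) ≤ p := by exact_mod_cast hp
    have : (p * r' * (p * r') + p * (r' + p + 2 + p) : ℤ) < p * p * (r' + p + 2) * (r' - p) := by
      have : (0:ℤ) < p * (2 * p * r' - p*p*p - 2 * p * p - r' - 2 * p - 2) := by
        apply mul_pos (by omega)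
        nlinarith
      nlinarith
    exact this
  have wt : ∀ (N : ℕ) (i : Fin N) (j : Fin p), p * (i:ℕ) + (p+1) * (j:ℕ) < p * (N + p) := by
    intro N i j
    have h1 := i.2
    have h2 := j.2
    have : p * ((i:ℕ) + 1) ≤ p * N := Nat.mul_le_mul_left _ h1
    have : (p+1) * ((j:ℕ) + 1) ≤ (p+1) * p := Nat.mul_le_mul_left _ h2
    nlinarith
  have wtinj : ∀ (N : ℕ) (i i' : Fin N) (j j' : Fin p), p * (i:ℕ) + (p+1) * (j:ℕ) = p * (i':ℕ) + (p+1) * (j':ℕ) → i = i' ∧ j = j' := by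
    intro N i i' j j' h
    have h1 : ((j:ℕ) + p * ((i:ℕ)+j)) = (j':ℕ) + p * ((i':ℕ)+j') := by linarith
    have h2 : (j:ℕ) = j' := by
      have := congrArg (· % p) h1
      simpa [Nat.add_mul_mod_self_left, Nat.mod_eq_of_lt j.2, Nat.mod_eq_of_lt j'.2] using this
    rw [h2] at h
    have h3 : (i:ℕ) = i' := Nat.eq_of_mul_eq_mul_left hpos (by omega)
    exact ⟨Fin.ext h3, Fin.ext h2⟩
  have hpL : p * (L + p) = r := by rw [hrr, hL]
  obtain ⟨g, ⟨i0, hi0⟩, hg⟩ := exists_relation hp hA B t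
    (fun i : ι => (i.2.1:ℕ) * r + i.1.1) (fun i : ι => (i.2.2:ℕ) * r + i.1.2) (r * r + p * (M + p)) (by
      intro i
      have h1 := wt M i.1.1 i.1.2
      have h2 := wt L i.2.1 i.2.2
      rw [hpL] at h2
      have : r * (p * (i.2.1:ℕ) + (p+1) * (i.2.2:ℕ)) ≤ r * r := Nat.mul_le_mul_left _ h2.le
      nlinarith) hkey
  -- the auxiliary polynomial
  set H : F[X][X] := ∑ i : ι, C (C (g i ^ r)) * mon F ((i.2.1:ℕ) + i.1.1 * r) ((i.2.2:ℕ) + i.1.2 * r) with hH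
  have hnd : ¬ GG p A B t ∣ H := by
    intro hd
    have := indep hp hA B t _ _ ?_ _ hd i0
    · exact hi0 (pow_eq_zero_iff (by rw [hr]; positivity) |>.1 this)
    · rintro ⟨⟨i, j⟩, ⟨l, k⟩⟩ ⟨⟨i', j'⟩, ⟨l', k'⟩⟩ h
      simp only at h
      have h1 := wt L l k
      have h1' := wt L l' k'
      rw [hpL] at h1 h1'
      have h2 : (p * (l:ℕ) + (p+1) * (k:ℕ)) + r * (p * (i:ℕ) + (p+1) * (j:ℕ)) =
        (p * (l':ℕ) + (p+1) * (k':ℕ)) + r * (p * (i':ℕ) + (p+1) * (j':ℕ)) := by linarith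
      have h3 : (p * (l:ℕ) + (p+1) * (k:ℕ)) = (p * (l':ℕ) + (p+1) * (k':ℕ)) := by
        have := congrArg (· % r) h2
        simpa only [Nat.add_mul_mod_self_left, Nat.mod_eq_of_lt h1, Nat.mod_eq_of_lt h1'] using this
      rw [h3] at h2
      have h4 : p * (i:ℕ) + (p+1) * (j:ℕ) = p * (i':ℕ) + (p+1) * (j':ℕ) :=
        Nat.eq_of_mul_eq_mul_left (show 0 < r by rw [hr]; positivity) (by omega)
      obtain ⟨rfl, rfl⟩ := wtinj _ _ _ _ _ h3
      obtain ⟨rfl, rfl⟩ := wtinj _ _ _ _ _ h4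
      rfl
  have hHW : ∃ P, WW p (r + r * (p * (M + p))) P ∧ GG p A B t ∣ H - P := by
    have : ∀ i : ι, ∃ P, WW p (r + r * (p * (M + p))) P ∧ GG p A B t ∣ mon F ((i.2.1:ℕ) + i.1.1 * r) ((i.2.2:ℕ) + i.1.2 * r) - P := by
      intro i
      apply red' hp hA
      have h1 := wt M i.1.1 i.1.2
      have h2 := wt L i.2.1 i.2.2
      rw [hpL] at h2
      have : r * (p * (i.1.1:ℕ) + (p+1) * (i.1.2:ℕ)) ≤ r * (p * (M + p)) := Nat.mul_le_mul_left _ h1.le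
      nlinarith
    choose P hP hd using this
    refine ⟨∑ i, C (C (g i ^ r)) * P i, WW.sum _ _ fun i _ => (hP i).smul _, ?_⟩
    rw [hH, ← Finset.sum_sub_distrib]
    refine Finset.dvd_sum fun i _ => ?_
    rw [← mul_sub]
    exact (hd i).mul_left _
  obtain ⟨P, hP, hPd⟩ := hHW
  have hP0 : P ≠ 0 := by rintro rfl; exact hnd (by simpa using hPd)
  obtain ⟨b, hb⟩ : ∃ b, P.coeff b ≠ 0 := by
    by_contra! hcon
    exact hP0 (Polynomial.ext (by simpa using hcon))
  -- vanishing
  have hHv : ∀ x z : F, (GG p A B t).evalEval x z = 0 → H.evalEval x z = 0 := by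
    intro x z hG
    have h1 : (∑ i : ι, C (C (g i)) * mon F ((i.2.1:ℕ) * r + i.1.1) ((i.2.2:ℕ) * r + i.1.2)).evalEval x z = 0 := by
      obtain ⟨U, hU⟩ := hg
      rw [hU, evalEval_mul, hG, zero_mul]
    have hQ : ∀ w : F, (w ^ r) ^ r = w := by
      intro w
      rw [← pow_mul, ← sq, ← hF, FiniteField.pow_card]
    have h2 : (H.evalEval x z) ^ r = 0 := by
      rw [← h1, hH, evalEval_finsetSum, evalEval_finsetSum, hr, sum_pow_char_pow]
      refine Finset.sum_congr rfl fun i _ => ?_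
      rw [← hr]
      simp only [evalEval_mul, evalEval_mon, evalEval_C, eval_C, mul_pow, hQ]
      have e1 : ∀ (w : F) (m n : ℕ), (w ^ (m + n * r)) ^ r = w ^ (m * r + n) := by
        intro w m n
        rw [pow_add, mul_pow, pow_mul, ← pow_mul, hQ, pow_add]
      rw [e1, e1]
    exact pow_eq_zero_iff (by rw [hr]; positivity) |>.1 h2
  have hPv : ∀ x ∈ XS p A B t, (P.coeff b).eval x = 0 := by
    rintro x ⟨hx, y, hy⟩
    have hroots : ∀ c : ZMod p, (P.map (evalRingHom x)).eval (x * (y + ZMod.castHom (dvd_refl p) F c)) = 0 := by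
      intro c
      have hG : (GG p A B t).evalEval x (x * (y + ZMod.castHom (dvd_refl p) F c)) = 0 := by
        apply evalEval_GG hp _ _ _ _ _ hx
        rw [add_pow_char, ← map_pow, ZMod.pow_card]
        linear_combination hy
      have h1 := hHv _ _ hG
      obtain ⟨U, hU⟩ := hPd
      have h2 : P = H - GG p A B t * U := by rw [← hU]; ring
      have h3 : P.evalEval x (x * (y + ZMod.castHom (dvd_refl p) F c)) = 0 := by
        rw [h2, evalEval_sub, evalEval_mul, hG, h1]; ring
      rw [eval_map, eval₂_evalRingHom]
      exact h3
    have hdeg : (P.map (evalRingHom x)).natDegree < p := by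
      have : P.natDegree < p := by
        have h3 : P.coeff P.natDegree ≠ 0 := by simpa using hP0
        obtain ⟨a, ha⟩ : ∃ a, (P.coeff P.natDegree).coeff a ≠ 0 := by
          by_contra! hcon
          exact h3 (Polynomial.ext (by simpa using hcon))
        exact (hP _ _ ha).1
      exact (natDegree_map_le).trans_lt this
    have hz : P.map (evalRingHom x) = 0 := by
      refine eq_zero_of_natDegree_lt_card_of_eval_eq_zero (P.map (evalRingHom x))
        (f := fun c : ZMod p => x * (y + ZMod.castHom (dvd_refl p) F c)) ?_ hroots (by simpa using hdeg)
      intro c c' h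
      have := mul_left_cancel₀ hx h
      exact (ZMod.castHom (dvd_refl p) F).injective (add_left_cancel this)
    have := congrArg (fun Q : F[X] => Q.coeff b) hz
    simpa using this
  have hcard : (XS p A B t).ncard ≤ (P.coeff b).natDegree := by
    have : XS p A B t ⊆ ((P.coeff b).roots.toFinset : Set F) := by
      intro x hx
      simp [hb, hPv x hx]
    calc (XS p A B t).ncard ≤ ((P.coeff b).roots.toFinset : Set F).ncard := Set.ncard_le_ncard this (Finset.finite_toSet _)
      _ = (P.coeff b).roots.toFinset.card := Set.ncard_coe_finset _
      _ ≤ _ := (Multiset.toFinset_card_le _).trans (card_roots' _)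
  have hdg := (hP b (P.coeff b).natDegree (by simpa using hb)).2
  have h5 : p * (P.coeff b).natDegree < p * (r' + r * (M + p)) := by
    calc _ ≤ p * (P.coeff b).natDegree + (p+1) * b := by omega
      _ < _ := hdg
      _ = _ := by rw [hrr]; ring
  have h6 := Nat.lt_of_mul_lt_mul_left h5
  have h7 : r' ≤ r := by rw [hrr]; nlinarith
  rw [hM] at h6
  nlinarith
end Stepanov2
end KW


namespace KW

section Char
variable {E : Type*} [Field E] [Fintype E]

open Classical in
theorem charsum_bound (p a : ℕ) [Fact p.Prime] [CharP E p] (ha : 5 ≤ a)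
    (hE : Fintype.card E = (p ^ a) ^ 2) {A : E} (hA : A ≠ 0) (B : E) (ψ : AddChar E ℂ) (hψ : ψ ≠ 1)
    (hfr : ∀ y, ψ (y ^ p) = ψ y) :
    ‖∑ x : Eˣ, ψ (A * x + B * (x⁻¹ : Eˣ))‖ ≤ 1 + p * (2 * p + 3) * (p:ℝ) ^ a := by
  have hpp : p.Prime := Fact.out
  set T : Finset E := Finset.univ.image (fun y : E => y ^ p - y) with hT
  -- cardinality of T
  have hTcard : p * T.card = Fintype.card E := by
    let φ : E →+ E := { toFun := fun y => y ^ p - y, map_zero' := by simp [hpp.ne_zero], map_add' := by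
                          intro x y; simp only [add_pow_char]; ring }
    have h1 : Nat.card φ.range = T.card := by
      have : (φ.range : Set E) = (T : Set E) := by
        ext y; simp [φ, hT]
      have h : Nat.card φ.range = Nat.card (φ.range : Set E) := rfl
      rw [h, this, Nat.card_coe_set_eq, Set.ncard_coe_finset]
    have h2 : Nat.card φ.ker = p := by
      have e : ((φ.ker : Set E)) = Set.range (ZMod.castHom (dvd_refl p) E) := by
        ext y
        simp only [SetLike.mem_coe, AddMonoidHom.mem_ker, Set.mem_range]
        constructor
        · intro h
          have h' : y ^ p = y := sub_eq_zero.1 h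
          have hs : Finset.univ.image (ZMod.castHom (dvd_refl p) E) ⊆ (Polynomial.X ^ p - Polynomial.X : Polynomial E).roots.toFinset := by
            intro z hz
            simp only [Finset.mem_image, Finset.mem_univ, true_and] at hz
            obtain ⟨c, rfl⟩ := hz
            rw [Multiset.mem_toFinset, Polynomial.mem_roots (FiniteField.X_pow_card_sub_X_ne_zero E hpp.one_lt)]
            rw [Polynomial.IsRoot.def, Polynomial.eval_sub, Polynomial.eval_pow, Polynomial.eval_X, ← map_pow, ZMod.pow_card, sub_self]
          have hc : (Polynomial.X ^ p - Polynomial.X : Polynomial E).roots.toFinset.card ≤ (Finset.univ.image (ZMod.castHom (dvd_refl p) E)).card := by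
            rw [Finset.card_image_of_injective _ (ZMod.castHom (dvd_refl p) E).injective, Finset.card_univ, ZMod.card]
            refine (Multiset.toFinset_card_le _).trans ((Polynomial.card_roots' _).trans ?_)
            rw [FiniteField.X_pow_card_sub_X_natDegree_eq E hpp.one_lt]
          have := Finset.eq_of_subset_of_card_le hs hc
          have hy : y ∈ (Polynomial.X ^ p - Polynomial.X : Polynomial E).roots.toFinset := by
            rw [Multiset.mem_toFinset, Polynomial.mem_roots (FiniteField.X_pow_card_sub_X_ne_zero E hpp.one_lt)]
            simp [h']
          rw [← this] at hy
          simpa using hy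
        · rintro ⟨c, rfl⟩
          change (ZMod.castHom (dvd_refl p) E c) ^ p - _ = 0
          rw [← map_pow, ZMod.pow_card, sub_self]
      have : Nat.card φ.ker = Nat.card (φ.ker : Set E) := rfl
      rw [this, e, Nat.card_congr (Equiv.ofInjective _ (ZMod.castHom (dvd_refl p) E).injective).symm, Nat.card_zmod]
    have h3 := AddSubgroup.card_mul_index φ.ker
    rw [AddSubgroup.index_ker, h1, h2, Nat.card_eq_fintype_card] at h3
    exact h3
  have hψT : ∀ w ∈ T, ψ w = 1 := by
    intro w hw
    simp only [hT, Finset.mem_image, Finset.mem_univ, true_and] at hw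
    obtain ⟨y, rfl⟩ := hw
    rw [AddChar.map_sub_eq_div, hfr, div_self]
    exact (AddChar.val_isUnit ψ y).ne_zero
  set f : Eˣ → E := fun x => A * x + B * (x⁻¹ : Eˣ) with hf
  let Nt : E → ℕ := fun t => (Finset.univ.filter fun x : Eˣ => f x - t ∈ T).card
  set Bd : ℕ := p ^ a * p ^ (a-1) + (2 * p + 3) * p ^ a with hBd
  have hNt : ∀ t, Nt t ≤ Bd := by
    intro t
    refine le_trans ?_ (stepanov p a ha hE hA B t)
    simp only [Nt]
    rw [← Finset.card_image_of_injective _ Units.val_injective, ← Set.ncard_coe_finset]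
    refine Set.ncard_le_ncard ?_ (Set.toFinite _)
    intro x hx
    simp only [Finset.coe_image, Finset.coe_filter, Finset.mem_univ, true_and, Set.mem_image, Set.mem_ofPred_eq, hT, Finset.mem_image] at hx
    obtain ⟨x, ⟨y, hy⟩, rfl⟩ := hx
    exact ⟨x.ne_zero, y, by simpa [hf] using hy⟩
  have hinner : ∀ x, (Finset.univ.filter fun t : E => f x - t ∈ T).card = T.card := by
    intro x
    refine Finset.card_bij (fun t _ => f x - t) (by simp) (by simp) ?_
    intro b hb
    exact ⟨f x - b, by simpa using hb, by ring⟩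
  have hsum : ∑ t, Nt t = (Fintype.card E - 1) * T.card := by
    simp only [Nt, Finset.card_filter]
    rw [Finset.sum_comm]
    simp only [← Finset.card_filter, hinner]
    rw [Finset.sum_const, Finset.card_univ, Fintype.card_units, smul_eq_mul]
  have hchar : ∑ t, ψ t * (Nt t : ℂ) = T.card * ∑ x, ψ (f x) := by
    simp only [Nt, Finset.card_filter, Nat.cast_sum, Finset.mul_sum]
    rw [Finset.sum_comm]
    refine Finset.sum_congr rfl fun x _ => ?_
    rw [← hinner x]
    simp only [Nat.cast_ite, Nat.cast_one, Nat.cast_zero, mul_ite, mul_one, mul_zero]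
    rw [← Finset.sum_filter, Finset.cast_card, Finset.sum_mul]
    refine Finset.sum_congr rfl fun t ht => ?_
    have h1 := hψT _ (Finset.mem_filter.1 ht).2
    rw [one_mul]
    have h2 : ψ (f x) = ψ (f x - t) * ψ t := by rw [← AddChar.map_add_eq_mul]; ring_nf
    rw [h2, h1, one_mul]
  have hzero : ∑ t, ψ t = 0 := AddChar.sum_eq_zero_of_ne_one hψ
  have hE0 : ∑ t, ψ t * ((Nt t : ℂ) - Bd) = T.card * ∑ x, ψ (f x) := by
    simp only [mul_sub, Finset.sum_sub_distrib, ← Finset.sum_mul, hzero, zero_mul, sub_zero, hchar]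
  have hle : ‖(T.card : ℂ) * ∑ x, ψ (f x)‖ ≤ ∑ t : E, ((Bd:ℝ) - Nt t) := by
    rw [← hE0]
    refine (norm_sum_le _ _).trans (Finset.sum_le_sum fun t _ => ?_)
    rw [norm_mul, AddChar.norm_apply, one_mul]
    have : ((Nt t : ℂ) - Bd) = (((Nt t:ℝ) - Bd : ℝ) : ℂ) := by push_cast; ring
    rw [this, Complex.norm_real, Real.norm_eq_abs, abs_sub_comm, abs_of_nonneg]
    exact sub_nonneg.2 (by exact_mod_cast hNt t)
  rw [norm_mul, Finset.sum_sub_distrib, ← Nat.cast_sum Finset.univ Nt, hsum, Finset.sum_const, Finset.card_univ, Complex.norm_natCast, nsmul_eq_mul] at hle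
  have hq1 : 1 ≤ Fintype.card E := Fintype.card_pos
  have hTpos : 0 < (T.card:ℝ) := by
    have : 0 < T.card := by
      rcases Nat.eq_zero_or_pos T.card with h | h
      · rw [h] at hTcard; omega
      · exact h
    exact_mod_cast this
  have hEr : (Fintype.card E : ℝ) = p * T.card := by exact_mod_cast hTcard.symm
  rw [Nat.cast_mul, Nat.cast_sub hq1, Nat.cast_one] at hle
  have hle2 : ‖∑ x, ψ (f x)‖ ≤ p * Bd - (Fintype.card E - 1) := by
    refine le_of_mul_le_mul_left (hle.trans (le_of_eq ?_)) hTpos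
    rw [hEr]; ring
  refine hle2.trans (le_of_eq ?_)
  obtain ⟨s, rfl⟩ : ∃ s, a = s + 1 := ⟨a - 1, by omega⟩
  rw [hBd, hE]
  push_cast
  ring
end Char
end KW


namespace KW
open Polynomial

section LFun
variable {F : Type*} [Field F] 

open Classical in
/-- The completely multiplicative function of the L-function. -/
noncomputable def chi (ψ : AddChar F ℂ) (a b : F) (g : F[X]) : ℂ :=
  if g.coeff 0 = 0 then 0 else ψ (-(a * g.nextCoeff) - b * (g.coeff 1 / g.coeff 0))

variable (ψ : AddChar F ℂ) (a b : F)

lemma chi_one : chi ψ a b 1 = 1 := by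
  simp [chi, nextCoeff, coeff_one]

lemma chi_mul {g h : F[X]} (hg : g.Monic) (hh : h.Monic) : chi ψ a b (g * h) = chi ψ a b g * chi ψ a b h := by
  unfold chi
  rw [mul_coeff_zero, mul_coeff_one, hg.nextCoeff_mul hh]
  by_cases h1 : g.coeff 0 = 0
  · simp [h1]
  by_cases h2 : h.coeff 0 = 0
  · simp [h2]
  rw [if_neg (mul_ne_zero h1 h2), if_neg h1, if_neg h2, ← AddChar.map_add_eq_mul]
  congr 1
  field_simp
  ring

lemma chi_pow {g : F[X]} (hg : g.Monic) (j : ℕ) : chi ψ a b (g ^ j) = chi ψ a b g ^ j := by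
  induction j with
  | zero => simp [chi_one]
  | succ j ih => rw [pow_succ, chi_mul ψ a b (hg.pow j) hg, ih, pow_succ]

variable [Fintype F]

lemma finite_monic (n : ℕ) : {g : F[X] | g.Monic ∧ g.natDegree = n}.Finite := by
  refine Set.Finite.of_injOn (f := fun g : F[X] => fun i : Fin n => g.coeff i) (t := Set.univ) (fun _ _ => Set.mem_univ _) ?_ Set.finite_univ
  rintro g ⟨hg, hgn⟩ h ⟨hh, hhn⟩ e
  ext i
  rcases lt_trichotomy i n with hi | rfl | hi
  · exact congrFun e ⟨i, hi⟩
  · rw [← hgn, hg.coeff_natDegree, hgn, ← hhn, hh.coeff_natDegree]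
  · rw [coeff_eq_zero_of_natDegree_lt (by omega), coeff_eq_zero_of_natDegree_lt (by omega)]

/-- monic polynomials of degree `n` -/
noncomputable def MD (F : Type*) [Field F] [Fintype F] (n : ℕ) : Finset F[X] := (finite_monic (F := F) n).toFinset

lemma mem_MD {n : ℕ} {g : F[X]} : g ∈ MD F n ↔ g.Monic ∧ g.natDegree = n := by
  simp [MD]

/-- coefficients of the L-function -/
noncomputable def AA (n : ℕ) : ℂ := ∑ g ∈ MD F n, chi ψ a b g

omit [Fintype F] in
lemma natDegree_X_sq_add {f : F[X]} (h : f.degree < ((2:ℕ) : WithBot ℕ)) : (X ^ 2 + f).natDegree = 2 := by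
  rw [natDegree_add_eq_left_of_degree_lt, natDegree_X_pow]
  rw [degree_X_pow]; exact h

lemma AA_zero : AA ψ a b 0 = 1 := by
  have : MD F 0 = {1} := by
    ext g
    rw [mem_MD, Finset.mem_singleton]
    constructor
    · rintro ⟨h, h'⟩; exact (Monic.natDegree_eq_zero h).1 h'
    · rintro rfl; simp
  rw [AA, this, Finset.sum_singleton, chi_one]

lemma AA_ge_three {a : F} (b : F) (ha : a ≠ 0) (hψ : ψ ≠ 1) {n : ℕ} (hn : 3 ≤ n) : AA ψ a b n = 0 := by
  obtain ⟨x, hx⟩ : ∃ x, ψ x ≠ 1 := by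
    by_contra! h
    exact hψ (by ext x; simp [h])
  have key : AA ψ a b n = ψ x * AA ψ a b n := by
    conv_lhs => rw [AA]
    rw [AA, Finset.mul_sum]
    symm
    have hdeg : ∀ (g : F[X]) (c : F), g ∈ MD F n → (g + C c * X ^ (n-1)) ∈ MD F n ∧ (g + C c * X ^ (n-1)).nextCoeff = g.nextCoeff + c := by
      intro g c hg
      rw [mem_MD] at hg
      have hd : (C c * X ^ (n-1)).degree < g.degree := by
        refine (degree_C_mul_X_pow_le _ _).trans_lt ?_
        rw [degree_eq_natDegree hg.1.ne_zero, hg.2]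
        exact_mod_cast (by omega)
      have h2 := natDegree_add_eq_left_of_degree_lt hd
      refine ⟨mem_MD.2 ⟨hg.1.add_of_left hd, by rw [h2, hg.2]⟩, ?_⟩
      rw [nextCoeff, nextCoeff, h2, hg.2, if_neg (by omega), if_neg (by omega)]
      simp
    refine Finset.sum_bij' (fun g _ => g + C (-x/a) * X ^ (n-1)) (fun g _ => g + C (x/a) * X ^ (n-1)) ?_ ?_ ?_ ?_ ?_
    · intro g hg; exact (hdeg g _ hg).1
    · intro g hg; exact (hdeg g _ hg).1
    · intro g hg; rw [add_assoc, ← add_mul, ← C_add]; simp [neg_div]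
    · intro g hg; rw [add_assoc, ← add_mul, ← C_add]; simp [neg_div]
    · intro g hg
      unfold chi
      rw [(hdeg g _ hg).2]
      have c0 : (g + C (-x/a) * X ^ (n-1)).coeff 0 = g.coeff 0 := by
        rw [coeff_add, coeff_C_mul, coeff_X_pow, if_neg (by omega)]; simp
      have c1 : (g + C (-x/a) * X ^ (n-1)).coeff 1 = g.coeff 1 := by
        rw [coeff_add, coeff_C_mul, coeff_X_pow, if_neg (by omega)]; simp
      rw [c0, c1]
      split_ifs
      · simp
      · rw [← AddChar.map_add_eq_mul]; congr 1; field_simp; ring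
  have : (1 - ψ x) * AA ψ a b n = 0 := by linear_combination key
  rcases mul_eq_zero.1 this with h | h
  · exact absurd (sub_eq_zero.1 h).symm hx
  · exact h

open Classical in
lemma AA_one : AA ψ a b 1 = ∑ x : Fˣ, ψ (a * x + b * (x⁻¹ : Fˣ)) := by
  have h1 : AA ψ a b 1 = ∑ x : F, chi ψ a b (X - C x) := by
    rw [AA]
    symm
    refine Finset.sum_bij (fun x _ => X - C x) ?_ ?_ ?_ ?_
    · intro x _; exact mem_MD.2 ⟨monic_X_sub_C x, natDegree_X_sub_C x⟩
    · intro x _ y _ h; simpa using h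
    · intro g hg
      rw [mem_MD] at hg
      refine ⟨-g.coeff 0, Finset.mem_univ _, ?_⟩
      have := hg.1.eq_X_add_C hg.2
      rw [map_neg, sub_neg_eq_add]; exact this.symm
    · intro x _; rfl
  rw [h1]
  have h2 : ∀ x : F, chi ψ a b (X - C x) = if x = 0 then 0 else ψ (a * x + b * x⁻¹) := by
    intro x
    unfold chi
    have e0 : (X - C x : F[X]).coeff 0 = -x := by simp
    have e1 : (X - C x : F[X]).coeff 1 = 1 := by simp [coeff_C]
    rw [e0, e1, nextCoeff_X_sub_C]
    by_cases hx : x = 0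
    · simp [hx]
    · rw [if_neg (by simpa using hx), if_neg hx]; congr 1; field_simp; ring
  simp only [h2]
  rw [← Finset.sum_erase_add _ _ (Finset.mem_univ (0:F)), if_pos rfl, add_zero]
  symm
  refine Finset.sum_bij (fun x _ => (x : F)) ?_ ?_ ?_ ?_
  · intro x _; simp
  · intro x _ y _ h; exact Units.ext h
  · intro x hx; exact ⟨Units.mk0 x (Finset.ne_of_mem_erase hx), Finset.mem_univ _, rfl⟩
  · intro x _; simp

lemma AA_two {a b : F} (ha : a ≠ 0) (hb : b ≠ 0) (hψ : ψ ≠ 1) : AA ψ a b 2 = Fintype.card F := by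
  classical
  have h1 : AA ψ a b 2 = ∑ v : F, ∑ u : F, chi ψ a b (X^2 + C u * X + C v) := by
    rw [AA, ← Finset.sum_product']
    symm
    have hdeg : ∀ u v : F, (C u * X + C v).degree < ((2:ℕ) : WithBot ℕ) := fun u v => degree_linear_lt
    have co : ∀ u v : F, (X^2 + C u * X + C v : F[X]).coeff 0 = v ∧ (X^2 + C u * X + C v : F[X]).coeff 1 = u := by
      intro u v; simp [coeff_X, coeff_C, coeff_X_pow]
    refine Finset.sum_bij (fun x _ => X^2 + C x.2 * X + C x.1) ?_ ?_ ?_ ?_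
    · intro x _
      rw [add_assoc]
      refine mem_MD.2 ⟨monic_X_pow_add (hdeg _ _), ?_⟩
      exact natDegree_X_sq_add (hdeg _ _)
    · intro x _ y _ h
      have h0 := congrArg (fun P : F[X] => P.coeff 0) h
      have h1 := congrArg (fun P : F[X] => P.coeff 1) h
      simp only [(co _ _).1, (co _ _).2] at h0 h1
      exact Prod.ext h0 h1
    · intro g hg
      rw [mem_MD] at hg
      refine ⟨(g.coeff 0, g.coeff 1), Finset.mem_univ _, ?_⟩
      conv_rhs => rw [hg.1.as_sum, hg.2]
      simp [Finset.sum_range_succ]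
      ring
    · intro x _; rfl
  have h2 : ∀ u v : F, chi ψ a b (X^2 + C u * X + C v) = if v = 0 then 0 else ψ (u * (-(a + b / v))) := by
    intro u v
    have hdeg : (C u * X + C v).degree < ((2:ℕ) : WithBot ℕ) := degree_linear_lt
    have hn : (X^2 + C u * X + C v : F[X]).natDegree = 2 := by rw [add_assoc]; exact natDegree_X_sq_add hdeg
    have e0 : (X^2 + C u * X + C v : F[X]).coeff 0 = v := by simp
    have e1 : (X^2 + C u * X + C v : F[X]).coeff 1 = u := by simp [coeff_X, coeff_C, coeff_X_pow]
    unfold chi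
    rw [nextCoeff, hn, e0, if_neg (show ¬ (2:ℕ) = 0 by norm_num), show 2 - 1 = 1 from rfl, e1]
    split_ifs
    · rfl
    · congr 1; field_simp; ring
  rw [h1]
  simp only [h2]
  have h3 : ∀ v : F, (∑ u : F, if v = 0 then 0 else ψ (u * (-(a + b / v)))) = if v = -b/a then (Fintype.card F : ℂ) else 0 := by
    intro v
    by_cases hv : v = 0
    · have : v ≠ -b/a := by rw [hv]; exact (div_ne_zero (neg_ne_zero.2 hb) ha).symm
      rw [if_neg this]
      simp [hv]
    · simp only [if_neg hv]
      split_ifs with h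
      · have : a + b / v = 0 := by rw [h]; field_simp; ring
        simp [this]
      · have hne : -(a + b / v) ≠ 0 := by
          intro h'
          apply h
          rw [neg_eq_zero] at h'
          field_simp at h' ⊢
          linear_combination h'
        rw [← AddChar.sum_eq_zero_of_ne_one hψ]
        exact Fintype.sum_bijective (fun u => u * (-(a + b / v))) (mulRight_bijective₀ _ hne) _ _ (fun _ => rfl)
  simp only [h3]
  simp
end LFun
end KW


namespace KW
open Polynomial UniqueFactorizationMonoid

section LFun
variable {F : Type*} [Field F] [Fintype F]

open Classical in
/-- monic irreducible polynomials of degree `n` -/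
noncomputable def PD (F : Type*) [Field F] [Fintype F] (n : ℕ) : Finset F[X] := (MD F n).filter Irreducible

lemma mem_PD {n : ℕ} {g : F[X]} : g ∈ PD F n ↔ (g.Monic ∧ g.natDegree = n) ∧ Irreducible g := by
  simp [PD, mem_MD]

open Classical in
lemma degree_eq_sum {n : ℕ} {g : F[X]} (hg : g.Monic) (hn : g.natDegree = n) :
    ∑ d ∈ Finset.Icc 1 n, ∑ w ∈ PD F d, ∑ j ∈ Finset.Icc 1 n, (if w ^ j ∣ g then d else 0) = n := by
  have hg0 := hg.ne_zero
  have hprod : (normalizedFactors g).prod = g := by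
    rw [prod_normalizedFactors_eq hg0, hg.normalize_eq_self]
  have hmon : ∀ w ∈ normalizedFactors g, w.Monic := by
    intro w hw
    have h1 := normalize_normalized_factor w hw
    have := monic_normalize (irreducible_of_normalized_factor w hw).ne_zero
    rwa [h1] at this
  have hdeg : ((normalizedFactors g).map natDegree).sum = n := by
    rw [← natDegree_multiset_prod_of_monic _ hmon, hprod, hn]
  rw [Finset.sum_multiset_map_count] at hdeg
  have hin : ∀ d ∈ Finset.Icc 1 n, ∀ w ∈ PD F d, ∑ j ∈ Finset.Icc 1 n, (if w ^ j ∣ g then d else 0)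
      = (normalizedFactors g).count w * w.natDegree := by
    intro d hd w hw
    rw [mem_PD] at hw
    rw [← Finset.sum_filter, Finset.sum_const, smul_eq_mul, hw.1.2]
    congr 1
    have hdv : ∀ j, w ^ j ∣ g ↔ j ≤ (normalizedFactors g).count w := by
      intro j
      rw [pow_dvd_iff_le_emultiplicity, emultiplicity_eq_count_normalizedFactors hw.2 hg0, hw.1.1.normalize_eq_self]
      norm_cast
    have hle : (normalizedFactors g).count w ≤ n := by
      have h1 := natDegree_le_of_dvd ((hdv _).2 le_rfl) hg0
      rw [natDegree_pow, hw.1.2, hn] at h1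
      have := (Finset.mem_Icc.1 hd).1
      nlinarith
    have : (Finset.Icc 1 n).filter (fun j => w ^ j ∣ g) = Finset.Icc 1 ((normalizedFactors g).count w) := by
      ext j
      simp only [Finset.mem_filter, Finset.mem_Icc, hdv]
      omega
    rw [this, Nat.card_Icc, Nat.add_sub_cancel]
  rw [Finset.sum_congr rfl fun d hd => Finset.sum_congr rfl fun w hw => hin d hd w hw]
  rw [← Finset.sum_biUnion]
  · conv_rhs => rw [← hdeg]
    symm
    refine Finset.sum_subset ?_ ?_
    · intro w hw
      rw [Multiset.mem_toFinset] at hw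
      rw [Finset.mem_biUnion]
      have hirr := irreducible_of_normalized_factor w hw
      refine ⟨w.natDegree, ?_, mem_PD.2 ⟨⟨hmon w hw, rfl⟩, hirr⟩⟩
      rw [Finset.mem_Icc]
      exact ⟨hirr.natDegree_pos, hn ▸ natDegree_le_of_dvd (dvd_of_mem_normalizedFactors hw) hg0⟩
    · intro w _ h
      rw [Multiset.mem_toFinset] at h
      rw [Multiset.count_eq_zero_of_notMem h, zero_smul]
  · intro d _ e _ hde
    rw [Function.onFun, Finset.disjoint_left]
    intro w h1 h2
    exact hde ((mem_PD.1 h1).1.2.symm.trans (mem_PD.1 h2).1.2)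

variable (ψ : AddChar F ℂ) (a b : F)

/-- power sums -/
noncomputable def KK (n : ℕ) : ℂ := ∑ d ∈ n.divisors, ∑ w ∈ PD F d, (d:ℂ) * chi ψ a b w ^ (n / d)

open Classical in
lemma sum_dvd {d n j : ℕ} {w : F[X]} (hw : w ∈ PD F d) :
    ∑ g ∈ MD F n, (if w ^ j ∣ g then chi ψ a b g else 0) =
     if d * j ≤ n then chi ψ a b w ^ j * AA ψ a b (n - d * j) else 0 := by
  rw [mem_PD] at hw
  rw [← Finset.sum_filter]
  have hpm : (w ^ j).Monic := hw.1.1.pow j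
  have hpd : (w ^ j).natDegree = d * j := by rw [natDegree_pow, hw.1.2, mul_comm]
  split_ifs with h
  · rw [AA, Finset.mul_sum]
    symm
    refine Finset.sum_bij (fun g _ => w ^ j * g) ?_ ?_ ?_ ?_
    · intro g hg
      rw [mem_MD] at hg
      rw [Finset.mem_filter, mem_MD]
      refine ⟨⟨hpm.mul hg.1, ?_⟩, dvd_mul_right _ _⟩
      rw [hpm.natDegree_mul hg.1, hpd, hg.2]; omega
    · intro g _ g' _ h
      exact mul_left_cancel₀ hpm.ne_zero h
    · intro g hg
      rw [Finset.mem_filter, mem_MD] at hg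
      obtain ⟨⟨hg1, hg2⟩, u, rfl⟩ := hg
      have hu : u.Monic := hpm.of_mul_monic_left hg1
      refine ⟨u, ?_, rfl⟩
      rw [mem_MD]
      rw [hpm.natDegree_mul hu, hpd] at hg2
      exact ⟨hu, by omega⟩
    · intro g hg
      rw [mem_MD] at hg
      rw [chi_mul ψ a b hpm hg.1, chi_pow ψ a b hw.1.1]
  · refine Finset.sum_eq_zero fun g hg => ?_
    rw [Finset.mem_filter, mem_MD] at hg
    have := natDegree_le_of_dvd hg.2 hg.1.1.ne_zero
    rw [hpd, hg.1.2] at this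
    exact absurd this h

open Classical in
theorem newton (n : ℕ) : (n:ℂ) * AA ψ a b n = ∑ k ∈ Finset.Icc 1 n, KK ψ a b k * AA ψ a b (n - k) := by
  have h1 : (n:ℂ) * AA ψ a b n = ∑ d ∈ Finset.Icc 1 n, ∑ w ∈ PD F d, ∑ j ∈ Finset.Icc 1 n,
      ∑ g ∈ MD F n, (d:ℂ) * (if w ^ j ∣ g then chi ψ a b g else 0) := by
    rw [AA, Finset.mul_sum]
    have : ∀ g ∈ MD F n, (n:ℂ) * chi ψ a b g = ∑ d ∈ Finset.Icc 1 n, ∑ w ∈ PD F d, ∑ j ∈ Finset.Icc 1 n,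
        (d:ℂ) * (if w ^ j ∣ g then chi ψ a b g else 0) := by
      intro g hg
      rw [mem_MD] at hg
      conv_lhs => rw [← degree_eq_sum hg.1 hg.2]
      push_cast
      simp only [Finset.sum_mul]
      refine Finset.sum_congr rfl fun d _ => Finset.sum_congr rfl fun w _ => Finset.sum_congr rfl fun j _ => ?_
      split_ifs <;> simp
    rw [Finset.sum_congr rfl this, Finset.sum_comm]
    refine Finset.sum_congr rfl fun d _ => ?_
    rw [Finset.sum_comm]
    refine Finset.sum_congr rfl fun w _ => ?_
    rw [Finset.sum_comm]
  rw [h1]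
  have h2 : ∀ d ∈ Finset.Icc 1 n, ∑ w ∈ PD F d, ∑ j ∈ Finset.Icc 1 n,
      ∑ g ∈ MD F n, (d:ℂ) * (if w ^ j ∣ g then chi ψ a b g else 0) = ∑ j ∈ Finset.Icc 1 n, if d * j ≤ n then
        (∑ w ∈ PD F d, (d:ℂ) * chi ψ a b w ^ j) * AA ψ a b (n - d * j) else 0 := by
    intro d _
    rw [Finset.sum_comm]
    refine Finset.sum_congr rfl fun j _ => ?_
    simp only [← Finset.mul_sum]
    rw [Finset.sum_congr rfl fun w hw => by rw [sum_dvd ψ a b hw]]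
    split_ifs
    · rw [Finset.mul_sum, Finset.mul_sum, Finset.sum_mul]
      exact Finset.sum_congr rfl fun w _ => by ring
    · simp
  rw [Finset.sum_congr rfl h2]
  have h3 : ∀ k ∈ Finset.Icc 1 n, KK ψ a b k * AA ψ a b (n - k) = ∑ d ∈ k.divisors,
      (∑ w ∈ PD F d, (d:ℂ) * chi ψ a b w ^ (k / d)) * AA ψ a b (n - k) := by
    intro k _
    rw [KK, Finset.sum_mul]
  rw [Finset.sum_congr rfl h3, ← Finset.sum_product', ← Finset.sum_filter, Finset.sum_sigma']
  refine Finset.sum_bij' (fun x _ => (⟨x.1 * x.2, x.1⟩ : Σ _ : ℕ, ℕ)) (fun x _ => (x.2, x.1 / x.2)) ?_ ?_ ?_ ?_ ?_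
  · rintro ⟨d, j⟩ h
    simp only [Finset.mem_filter, Finset.mem_product, Finset.mem_Icc] at h
    simp only [Finset.mem_sigma, Finset.mem_Icc, Nat.mem_divisors]
    have : 0 < d * j := Nat.mul_pos (by omega) (by omega)
    exact ⟨⟨this, h.2⟩, dvd_mul_right _ _, this.ne'⟩
  · rintro ⟨k, d⟩ h
    simp only [Finset.mem_sigma, Finset.mem_Icc, Nat.mem_divisors] at h
    obtain ⟨⟨h1, h2⟩, ⟨j, rfl⟩, h3⟩ := h
    have hd : 0 < d := Nat.pos_of_ne_zero (by rintro rfl; simp at h3)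
    have hj : 0 < j := Nat.pos_of_ne_zero (by rintro rfl; simp at h3)
    simp only [Finset.mem_filter, Finset.mem_product, Finset.mem_Icc, Nat.mul_div_cancel_left j hd]
    refine ⟨⟨⟨hd, by nlinarith⟩, hj, by nlinarith⟩, h2⟩
  · rintro ⟨d, j⟩ h
    simp only [Finset.mem_filter, Finset.mem_product, Finset.mem_Icc] at h
    simp [Nat.mul_div_cancel_left j (show 0 < d by omega)]
  · rintro ⟨k, d⟩ h
    simp only [Finset.mem_sigma, Finset.mem_Icc, Nat.mem_divisors] at h
    simp [Nat.mul_div_cancel' h.2.1]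
  · rintro ⟨d, j⟩ h
    simp only [Finset.mem_filter, Finset.mem_product, Finset.mem_Icc] at h
    simp only [Nat.mul_div_cancel_left j (show 0 < d by omega)]
end LFun
end KW


namespace KW
open Polynomial IntermediateField

section Ext
variable {F E : Type*} [Field F] [Field E] [Fintype F] [Fintype E] [Algebra F E]

lemma minpoly_inv_aux (x : E) (hx : x ≠ 0) : (minpoly F x⁻¹).nextCoeff = (minpoly F x).coeff 1 / (minpoly F x).coeff 0 := by
  have hi : IsIntegral F x := .of_finite F x
  have hi' : IsIntegral F x⁻¹ := .of_finite F x⁻¹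
  have h0 : (minpoly F x).coeff 0 ≠ 0 := minpoly.coeff_zero_ne_zero hi hx
  have hpos := minpoly.natDegree_pos hi
  have hadj : F⟮x⁻¹⟯ = F⟮x⟯ := by
    apply le_antisymm
    · rw [adjoin_simple_le_iff]; exact inv_mem (mem_adjoin_simple_self F x)
    · rw [adjoin_simple_le_iff]
      simpa using inv_mem (mem_adjoin_simple_self F x⁻¹)
  have hdeg : (minpoly F x⁻¹).natDegree = (minpoly F x).natDegree := by
    rw [← adjoin.finrank hi, ← adjoin.finrank hi', hadj]
  have htd : (minpoly F x).natTrailingDegree = 0 := by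
    rw [natTrailingDegree_eq_zero]; exact Or.inr h0
  have hrd : (minpoly F x).reverse.natDegree = (minpoly F x).natDegree := by
    rw [reverse_natDegree, htd, Nat.sub_zero]
  set P := C ((minpoly F x).coeff 0)⁻¹ * (minpoly F x).reverse with hP
  have hPd : P.natDegree = (minpoly F x).natDegree := by
    rw [hP, natDegree_C_mul (inv_ne_zero h0), hrd]
  have hPm : P.Monic := by
    rw [Monic, hP, leadingCoeff_mul, leadingCoeff_C, reverse_leadingCoeff, trailingCoeff, htd, inv_mul_cancel₀ h0]
  have hr : aeval x⁻¹ P = 0 := by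
    rw [hP, map_mul]
    have : eval₂ (algebraMap F E) x⁻¹ (minpoly F x).reverse = 0 := by
      have : Invertible x := invertibleOfNonzero hx
      rw [← invOf_eq_inv, eval₂_reverse_eq_zero_iff]
      exact minpoly.aeval F x
    rw [aeval_def x⁻¹ (reverse _), this, mul_zero]
  have hPeq : P = minpoly F x⁻¹ := 
    eq_of_monic_of_dvd_of_natDegree_le (minpoly.monic hi') hPm (minpoly.dvd F _ hr) (by rw [hPd, hdeg])
  rw [← hPeq, nextCoeff_of_natDegree_pos (by omega), hPd, hP, coeff_C_mul, coeff_reverse, 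
    revAt_le (by omega), show (minpoly F x).natDegree - ((minpoly F x).natDegree - 1) = 1 by omega]
  field_simp

variable (ψ : AddChar F ℂ) (a b : F)

lemma chi_minpoly (x : E) (hx : x ≠ 0) :
    chi ψ a b (minpoly F x) ^ (Module.finrank F E / (minpoly F x).natDegree) =
     ψ (Algebra.trace F E (algebraMap F E a * x + algebraMap F E b * x⁻¹)) := by
  have hi : IsIntegral F x := .of_finite F x
  have h0 : (minpoly F x).coeff 0 ≠ 0 := minpoly.coeff_zero_ne_zero hi hx
  have hpos := minpoly.natDegree_pos hi
  have hadj : F⟮x⁻¹⟯ = F⟮x⟯ := by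
    apply le_antisymm
    · rw [adjoin_simple_le_iff]; exact inv_mem (mem_adjoin_simple_self F x)
    · rw [adjoin_simple_le_iff]
      simpa using inv_mem (mem_adjoin_simple_self F x⁻¹)
  have hfr : Module.finrank F E / (minpoly F x).natDegree = Module.finrank F⟮x⟯ E := by
    rw [← Module.finrank_mul_finrank F F⟮x⟯ E, adjoin.finrank hi, Nat.mul_div_cancel_left _ hpos]
  rw [hfr, chi, if_neg h0, map_add, ← Algebra.smul_def, ← Algebra.smul_def, map_smul, map_smul,
    trace_eq_finrank_mul_minpoly_nextCoeff, trace_eq_finrank_mul_minpoly_nextCoeff, hadj, minpoly_inv_aux x hx, 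
    ← AddChar.map_nsmul_eq_pow]
  congr 1
  simp only [nsmul_eq_mul, smul_eq_mul]
  ring

open Classical in
lemma card_minpoly {d : ℕ} {w : F[X]} (hw : w ∈ PD F d) (hd : d ∣ Module.finrank F E) :
    (Finset.univ.filter fun x : E => minpoly F x = w).card = d := by
  rw [mem_PD] at hw
  obtain ⟨⟨hm, hdeg⟩, hirr⟩ := hw
  have hdv : w ∣ X ^ (Nat.card F) ^ (Module.finrank F E) - X := by
    rw [← hirr.natDegree_dvd_iff_dvd_X_pow_card_pow_sub_X, hdeg]; exact hd
  have hcard : Fintype.card E = (Nat.card F) ^ (Module.finrank F E) := by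
    rw [Module.card_eq_pow_finrank (K := F), Nat.card_eq_fintype_card]
  rw [← hcard] at hdv
  have hsp : (X ^ Fintype.card E - X : E[X]).Splits := by
    rw [splits_iff_card_roots, FiniteField.roots_X_pow_card_sub_X, FiniteField.X_pow_card_sub_X_natDegree_eq _ Fintype.one_lt_card]
    rfl
  have hw : (w.map (algebraMap F E)).Splits := by
    refine hsp.of_dvd ?_ ?_
    · exact FiniteField.X_pow_card_sub_X_ne_zero _ Fintype.one_lt_card
    · have := Polynomial.map_dvd (algebraMap F E) hdv
      simpa using this
  have hsep : w.Separable := PerfectField.separable_of_irreducible hirr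
  have := card_rootSet_eq_natDegree hsep hw
  rw [hdeg] at this
  rw [← this, ← Set.toFinset_card]
  congr 1
  ext x
  simp only [Finset.mem_filter, Finset.mem_univ, true_and, Set.mem_toFinset, mem_rootSet]
  constructor
  · rintro rfl
    exact ⟨hirr.ne_zero, minpoly.aeval F x⟩
  · rintro ⟨_, h⟩
    exact (minpoly.eq_of_irreducible_of_monic hirr h hm).symm

open Classical in
theorem KK_eq : KK ψ a b (Module.finrank F E) =
    ∑ x : Eˣ, ψ (Algebra.trace F E (algebraMap F E a * x + algebraMap F E b * (x⁻¹ : Eˣ))) := by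
  have hn : 0 < Module.finrank F E := Module.finrank_pos
  have h1 : ∑ x : Eˣ, ψ (Algebra.trace F E (algebraMap F E a * x + algebraMap F E b * (x⁻¹ : Eˣ)))
    = ∑ x : E, chi ψ a b (minpoly F x) ^ (Module.finrank F E / (minpoly F x).natDegree) := by
    rw [← Finset.add_sum_erase _ _ (Finset.mem_univ (0:E))]
    have : chi ψ a b (minpoly F (0:E)) ^ (Module.finrank F E / (minpoly F (0:E)).natDegree) = 0 := by
      rw [minpoly.zero, natDegree_X, Nat.div_one]
      simp [chi, hn.ne']
    rw [this, zero_add]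
    refine Finset.sum_bij (fun x _ => (x:E)) ?_ ?_ ?_ ?_
    · intro x _; simp
    · intro x _ y _ h; exact Units.ext h
    · intro x hx; exact ⟨Units.mk0 x (Finset.ne_of_mem_erase hx), Finset.mem_univ _, rfl⟩
    · intro x _
      rw [chi_minpoly ψ a b (x:E) x.ne_zero, Units.val_inv_eq_inv_val]
  have hmaps : ∀ x ∈ (Finset.univ : Finset E), minpoly F x ∈ (Module.finrank F E).divisors.biUnion fun d => PD F d := by
    intro x _
    rw [Finset.mem_biUnion]
    have hi : IsIntegral F x := .of_finite F x
    refine ⟨(minpoly F x).natDegree, ?_, mem_PD.2 ⟨⟨minpoly.monic hi, rfl⟩, minpoly.irreducible hi⟩⟩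
    rw [Nat.mem_divisors]
    exact ⟨minpoly.degree_dvd hi, hn.ne'⟩
  rw [h1, KK, ← Finset.sum_fiberwise_of_maps_to hmaps, Finset.sum_biUnion]
  · refine Finset.sum_congr rfl fun d hd => Finset.sum_congr rfl fun w hw => ?_
    have hw' := (mem_PD.1 hw).1.2
    rw [Finset.sum_congr rfl (g := fun _ => chi ψ a b w ^ (Module.finrank F E / d)), Finset.sum_const,
      card_minpoly hw (Nat.dvd_of_mem_divisors hd), nsmul_eq_mul]
    intro x hx
    rw [(Finset.mem_filter.1 hx).2, hw']
  · intro d _ e _ hde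
    rw [Function.onFun, Finset.disjoint_left]
    intro w h1 h2
    exact hde ((mem_PD.1 h1).1.2.symm.trans (mem_PD.1 h2).1.2)
end Ext
end KW


namespace KW

section W
variable {F : Type*} [Field F] [Fintype F] (ψ : AddChar F ℂ) {a b : F}

lemma KK_recur (ha : a ≠ 0) (hb : b ≠ 0) (hψ : ψ ≠ 1) (α β : ℂ) (h1 : α + β = - AA ψ a b 1)
    (h2 : α * β = Fintype.card F) (n : ℕ) : KK ψ a b (n+1) = -(α^(n+1) + β^(n+1)) := by
  induction n using Nat.strong_induction_on with
  | _ n ih =>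
    have hN := newton ψ a b (n+1)
    rcases n with _ | _ | n
    · simp [AA_zero] at hN
      rw [zero_add, ← hN]; linear_combination h1
    · rw [show (0+1+1) = 2 from rfl] at *
      rw [show Finset.Icc 1 2 = {1, 2} from rfl, Finset.sum_pair (by norm_num), AA_two ψ ha hb hψ, 
        show 2 - 1 = 1 from rfl, show 2 - 2 = 0 from rfl, AA_zero, mul_one] at hN
      have h3 := ih 0 (by norm_num)
      simp only [zero_add, pow_one] at h3
      rw [h3] at hN
      have : AA ψ a b 1 = -(α+β) := by rw [h1, neg_neg]
      rw [this, ← h2] at hN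
      push_cast at hN
      linear_combination -hN
    · rw [AA_ge_three ψ b ha hψ (by omega), mul_zero] at hN
      have hz : ∀ k ∈ Finset.Icc 1 (n+1+1+1), k ∉ ({n+1,n+2,n+3} : Finset ℕ) → KK ψ a b k * AA ψ a b (n+1+1+1-k) = 0 := by
        intro k hk hk'
        simp only [Finset.mem_insert, Finset.mem_singleton, Finset.mem_Icc] at hk hk'
        rw [AA_ge_three ψ b ha hψ (by omega), mul_zero]
      rw [← Finset.sum_subset (s₁ := ({n+1,n+2,n+3} : Finset ℕ)) ?_ hz] at hN
      · rw [Finset.sum_insert (by simp), Finset.sum_pair (by simp)] at hN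
        rw [show n+1+1+1-(n+1) = 2 by omega, show n+1+1+1-(n+2) = 1 by omega, show n+1+1+1-(n+3) = 0 by omega, AA_two ψ ha hb hψ, AA_zero] at hN
        have i1 := ih n (by omega)
        have i2 := ih (n+1) (by omega)
        rw [i1, show n + 2 = n+1+1 from rfl, i2] at hN
        have : AA ψ a b 1 = -(α+β) := by rw [h1, neg_neg]
        rw [this, ← h2] at hN
        rw [show n + 1 + 1 + 1 = n+3 from rfl]
        linear_combination -hN
      · intro k hk
        simp only [Finset.mem_insert, Finset.mem_singleton] at hk
        rw [Finset.mem_Icc]; omega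

lemma exists_roots (s t : ℂ) : ∃ α β : ℂ, α + β = s ∧ α * β = t := by
  obtain ⟨z, hz⟩ := IsAlgClosed.exists_pow_nat_eq (s^2 - 4*t) (n := 2) (by norm_num)
  exact ⟨(s+z)/2, (s-z)/2, by ring, by linear_combination (-1/4 : ℂ) * hz⟩

lemma growth {α β : ℂ} {q M : ℝ} (hq : 0 < q) (h : ‖α‖ * ‖β‖ = q)
    (hb : ∀ j ≥ 5, ‖α^(2*j) + β^(2*j)‖ ≤ M * q^j) : ‖α‖ ^ 2 ≤ q := by
  by_contra! hlt
  have hα : 0 < ‖α‖ := by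
    by_contra! h0
    have := le_antisymm h0 (norm_nonneg α)
    rw [this, zero_mul] at h; linarith
  have hβ : ‖β‖ ^ 2 ≤ q := by
    have h2 : ‖α‖^2 * ‖β‖^2 = q^2 := by rw [← mul_pow, h]
    by_contra! h3
    nlinarith [mul_lt_mul'' hlt h3 hq.le hq.le]
  have hρ : 1 < ‖α‖^2/q := by rw [one_lt_div hq]; exact hlt
  obtain ⟨j, hj⟩ := pow_unbounded_of_one_lt (M + 1) hρ
  have hj' : M + 1 < (‖α‖^2/q)^(j+5) := hj.trans_le (pow_le_pow_right₀ hρ.le (by omega))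
  have h5 := hb (j+5) (by omega)
  have h6 : ‖α^(2*(j+5))‖ ≤ ‖α^(2*(j+5)) + β^(2*(j+5))‖ + ‖β^(2*(j+5))‖ := by
    have := norm_sub_le (α^(2*(j+5)) + β^(2*(j+5))) (β^(2*(j+5)))
    rwa [add_sub_cancel_right] at this
  rw [norm_pow α, norm_pow β, pow_mul ‖α‖, pow_mul ‖β‖] at h6
  have h7 : (‖β‖^2)^(j+5) ≤ q^(j+5) := pow_le_pow_left₀ (by positivity) hβ _
  rw [div_pow, lt_div_iff₀ (by positivity)] at hj'
  linarith
end W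

section W2
variable {F : Type*} [Field F] [Fintype F]

lemma weil_aux (p : ℕ) [Fact p.Prime] [CharP F p] [Algebra (ZMod p) F] (ψ₀ : AddChar (ZMod p) ℂ) (hψ₀ : ψ₀ ≠ 1)
    (ψ : AddChar F ℂ) (hψ : ∀ x, ψ x = ψ₀ (Algebra.trace (ZMod p) F x))
    {a b : F} (ha : a ≠ 0) (hb : b ≠ 0) : ‖AA ψ a b 1‖ ≤ 2 * Real.sqrt (Fintype.card F) := by
  classical
  have hpp : p.Prime := Fact.out
  have hq : (0:ℝ) < Fintype.card F := by exact_mod_cast Fintype.card_pos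
  have hsurj : Function.Surjective (Algebra.trace (ZMod p) F) := Algebra.trace_surjective _ _
  have hψ1 : ψ ≠ 1 := by
    rintro rfl
    apply hψ₀
    ext t
    obtain ⟨x, rfl⟩ := hsurj t
    rw [← hψ]; rfl
  obtain ⟨α, β, h1, h2⟩ := exists_roots (- AA ψ a b 1) (Fintype.card F)
  have hK := KK_recur ψ ha hb hψ1 α β h1 h2
  obtain ⟨r, hr, hcard⟩ : ∃ r : ℕ, 1 ≤ r ∧ Fintype.card F = p ^ r := by
    obtain ⟨n, hn, hc⟩ := FiniteField.card F p
    exact ⟨n, n.pos, hc⟩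
  have hbd : ∀ j ≥ 5, ‖α^(2*j) + β^(2*j)‖ ≤ (1 + p * (2*p+3)) * (Fintype.card F : ℝ)^j := by
    intro j hj
    have : NeZero (2*j) := ⟨by omega⟩
    let E := FiniteField.Extension F p (2*j)
    let _ : Fintype E := Fintype.ofFinite E
    have hfin : Module.finrank F E = 2 * j := FiniteField.finrank_extension F p (2*j)
    have : CharP E p := charP_of_injective_algebraMap (algebraMap F E).injective p
    have hE : Fintype.card E = (p^(r*j))^2 := by
      rw [Module.card_eq_pow_finrank (K := F), hfin, hcard]; ring
    let ψE : AddChar E ℂ := ψ.compAddMonoidHom (Algebra.trace F E).toAddMonoidHom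
    have hψE : ∀ x, ψE x = ψ₀ (Algebra.trace (ZMod p) E x) := by
      intro x
      change ψ (Algebra.trace F E x) = _
      rw [hψ, Algebra.trace_trace]
    have hsE : Function.Surjective (Algebra.trace (ZMod p) E) := Algebra.trace_surjective _ _
    have hψE1 : ψE ≠ 1 := by
      intro h
      apply hψ₀
      ext t
      obtain ⟨x, rfl⟩ := hsE t
      rw [← hψE, h]; rfl
    have hfr : ∀ y, ψE (y^p) = ψE y := by
      intro y
      rw [hψE, hψE]
      congr 1
      have := Algebra.trace_eq_of_algEquiv (FiniteField.frobeniusAlgEquivOfAlgebraic (ZMod p) E) y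
      rw [← this, FiniteField.coe_frobeniusAlgEquivOfAlgebraic, ZMod.card]
    have hA : algebraMap F E a ≠ 0 := by simpa using ha
    have hcb := charsum_bound p (r*j) (by nlinarith) hE hA (algebraMap F E b) ψE hψE1 hfr
    have hKK := KK_eq (E := E) ψ a b
    have : ∀ x : Eˣ, ψ (Algebra.trace F E (algebraMap F E a * x + algebraMap F E b * (x⁻¹ : Eˣ))) = ψE (algebraMap F E a * x + algebraMap F E b * (x⁻¹ : Eˣ)) := fun x => rfl
    simp only [this] at hKK
    rw [← hKK, hfin, show 2 * j = (2*j-1)+1 by omega, hK, show (2*j-1)+1 = 2*j by omega, norm_neg] at hcb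
    refine hcb.trans ?_
    rw [hcard]
    push_cast
    rw [← pow_mul]
    have : (1:ℝ) ≤ (p:ℝ)^(r*j) := one_le_pow₀ (by exact_mod_cast hpp.one_lt.le)
    nlinarith
  have hn : ‖α‖ * ‖β‖ = Fintype.card F := by rw [← norm_mul, h2]; simp
  have g1 := growth hq hn hbd
  have g2 := growth (α := β) (β := α) hq (by rw [mul_comm]; exact hn) (by simpa only [add_comm] using hbd)
  have k1 := Real.le_sqrt_of_sq_le g1
  have k2 := Real.le_sqrt_of_sq_le g2
  rw [← norm_neg, ← h1]
  linarith [norm_add_le α β]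

open Classical in
theorem weil (ψ : AddChar F ℂ) (hψ : ψ ≠ 1) {a b : F} (ha : a ≠ 0) (hb : b ≠ 0) :
    ‖∑ x : Fˣ, ψ (a * x + b * (x⁻¹ : Fˣ))‖ ≤ 2 * Real.sqrt (Fintype.card F) := by
  obtain ⟨p, hp⟩ := CharP.exists F
  have : Fact p.Prime := ⟨CharP.char_is_prime F p⟩
  let _ := ZMod.algebra F p
  have hsurj : Function.Surjective (Algebra.trace (ZMod p) F) := Algebra.trace_surjective _ _
  let ψ₀ : AddChar (ZMod p) ℂ := ZMod.stdAddChar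
  have hψ₀ : ψ₀ ≠ 1 := by
    have := ZMod.isPrimitive_stdAddChar p (one_ne_zero)
    rwa [AddChar.mulShift_one] at this
  let ψ₁ : AddChar F ℂ := ψ₀.compAddMonoidHom (Algebra.trace (ZMod p) F).toAddMonoidHom
  have hψ₁ : ψ₁ ≠ 1 := by
    intro h
    apply hψ₀
    ext t
    obtain ⟨x, rfl⟩ := hsurj t
    exact DFunLike.congr_fun h x
  have hinj := AddChar.to_mulShift_inj_of_isPrimitive (AddChar.IsPrimitive.of_ne_one hψ₁)
  obtain ⟨c, hc⟩ := ((Fintype.bijective_iff_injective_and_card _).2 ⟨hinj, AddChar.card_eq.symm⟩).2 ψ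
  have hc0 : c ≠ 0 := by
    rintro rfl
    exact hψ (by rw [← hc]; exact AddChar.mulShift_zero ψ₁)
  have := weil_aux p ψ₀ hψ₀ ψ₁ (fun _ => rfl) (mul_ne_zero hc0 ha) (mul_ne_zero hc0 hb)
  rw [AA_one] at this
  convert this using 3 with x
  rename_i y _
  rw [← hc, AddChar.mulShift_apply]
  congr 1
  ring
end W2
end KW


namespace KW

/-- residue ring -/
abbrev GQ (c : GaussianInt) := GaussianInt ⧸ Ideal.span {c}

/-- additive coordinates on the Gaussian integers -/
def gequiv : GaussianInt ≃ₗ[ℤ] (Fin 2 → ℤ) where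
  toFun z := ![z.re, z.im]
  invFun v := ⟨v 0, v 1⟩
  left_inv z := by ext <;> simp
  right_inv v := by ext i; fin_cases i <;> simp
  map_add' x y := by ext i; fin_cases i <;> simp
  map_smul' r x := by ext i; fin_cases i <;> simp

/-- integral basis -/
noncomputable def gbasis : Module.Basis (Fin 2) ℤ GaussianInt := .ofEquivFun gequiv

instance : Module.Free ℤ GaussianInt := .of_basis gbasis
instance : Module.Finite ℤ GaussianInt := .of_basis gbasis

lemma gnorm (z : GaussianInt) : Algebra.norm ℤ z = z.re * z.re + z.im * z.im := by
  rw [Algebra.norm_eq_matrix_det gbasis, Matrix.det_fin_two]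
  simp [Algebra.leftMulMatrix_eq_repr_mul, gbasis, gequiv, Module.Basis.coe_ofEquivFun]

lemma card_GQ (c : GaussianInt) : (Nat.card (GQ c) : ℝ) = ‖(c:ℂ)‖^2 := by
  have h : Nat.card (GQ c) = (Algebra.norm ℤ c).natAbs := by
    rw [← Ideal.absNorm_span_singleton, Ideal.absNorm_apply, Submodule.cardQuot_apply]
  rw [h, Complex.sq_norm, gnorm]
  have : ((c.re * c.re + c.im * c.im).natAbs : ℝ) = ((c.re * c.re + c.im * c.im : ℤ) : ℝ) := by
    have h2 : ((c.re * c.re + c.im * c.im).natAbs : ℤ) = c.re * c.re + c.im * c.im :=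
      Int.natAbs_of_nonneg (by nlinarith [mul_self_nonneg c.re, mul_self_nonneg c.im])
    calc ((c.re * c.re + c.im * c.im).natAbs : ℝ) = (((c.re * c.re + c.im * c.im).natAbs : ℤ) : ℝ) := (Int.cast_natCast _).symm
      _ = _ := by rw [h2]
  rw [this, Complex.normSq_apply]
  push_cast
  simp

lemma gfinite {c : GaussianInt} (hc : c ≠ 0) : Finite (GQ c) := by
  apply Nat.finite_of_card_ne_zero
  have := card_GQ c
  have h2 : (0:ℝ) < ‖(c:ℂ)‖^2 := by
    have : (c:ℂ) ≠ 0 := by simpa using hc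
    positivity
  rw [← this] at h2
  exact_mod_cast h2.ne'

section Kl
variable {R : Type*} [CommRing R]

/-- Kloosterman sum over a ring -/
noncomputable def Kl (ψ : AddChar R ℂ) (m n : R) : ℂ := ∑ᶠ u : Rˣ, ψ (u * m + (u⁻¹ : Rˣ) * n)

end Kl

lemma efn_add (z z' : ℂ) : efn (z + z') = efn z * efn z' := by
  rw [efn, efn, efn, ← Complex.exp_add]; congr 1; simp; ring

lemma efn_eq_one {z : ℂ} : efn z = 1 ↔ ∃ k : ℤ, z.re = k := by
  rw [efn, Complex.exp_eq_one_iff]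
  have h : (2 * Real.pi * Complex.I : ℂ) ≠ 0 := Complex.two_pi_I_ne_zero
  refine exists_congr fun k => ?_
  rw [mul_comm, mul_left_inj' h]
  norm_cast

/-- additive character of `O` -/
noncomputable def ech (c : GaussianInt) : AddChar GaussianInt ℂ where
  toFun x := efn ((x:ℂ) / (c:ℂ))
  map_zero_eq_one' := by simp [efn]
  map_add_eq_mul' x y := by rw [← efn_add]; simp [add_div]

lemma ech_mul (c : GaussianInt) (hc : c ≠ 0) (x : GaussianInt) : ech c (c * x) = 1 := by
  have : (c:ℂ) ≠ 0 := by simpa using hc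
  change efn _ = 1
  rw [efn_eq_one]
  refine ⟨x.re, ?_⟩
  rw [map_mul, mul_div_cancel_left₀ _ this]
  simp

lemma ech_congr {c : GaussianInt} (hc : c ≠ 0) {x y : GaussianInt} 
    (h : Ideal.Quotient.mk (Ideal.span {c}) x = Ideal.Quotient.mk (Ideal.span {c}) y) : ech c x = ech c y := by
  rw [Ideal.Quotient.mk_eq_mk_iff_sub_mem, Ideal.mem_span_singleton] at h
  obtain ⟨t, ht⟩ := h
  rw [show x = c * t + y by rw [← ht]; ring, AddChar.map_add_eq_mul, ech_mul c hc, one_mul]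

/-- additive character mod `c` -/
noncomputable def ec {c : GaussianInt} (hc : c ≠ 0) : AddChar (GQ c) ℂ where
  toFun x := ech c (Quotient.out x)
  map_zero_eq_one' := by
    rw [← AddChar.map_zero_eq_one (ech c)]
    apply ech_congr hc
    rw [Ideal.Quotient.mk_out]; simp
  map_add_eq_mul' x y := by
    rw [← AddChar.map_add_eq_mul]
    apply ech_congr hc
    rw [map_add, Ideal.Quotient.mk_out, Ideal.Quotient.mk_out, Ideal.Quotient.mk_out]

lemma ec_mk {c : GaussianInt} (hc : c ≠ 0) (x : GaussianInt) : ec hc (Ideal.Quotient.mk _ x) = ech c x :=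
  ech_congr hc (Ideal.Quotient.mk_out _)

lemma ec_prim {c : GaussianInt} (hc : c ≠ 0) : (ec hc).IsPrimitive := by
  have hc' : (c:ℂ) ≠ 0 := by simpa using hc
  intro a ha h
  obtain ⟨a, rfl⟩ := Ideal.Quotient.mk_surjective a
  apply ha
  have key : ∀ x : GaussianInt, efn (((a * x : GaussianInt) : ℂ) / c) = 1 := by
    intro x
    have := DFunLike.congr_fun h (Ideal.Quotient.mk _ x)
    rw [AddChar.mulShift_apply, ← map_mul, ec_mk] at this
    exact this
  have h1 := key 1
  have h2 := key ⟨0, 1⟩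
  rw [efn_eq_one] at h1 h2
  obtain ⟨k, hk⟩ := h1
  obtain ⟨l, hl⟩ := h2
  rw [Ideal.Quotient.eq_zero_iff_mem, Ideal.mem_span_singleton]
  refine ⟨⟨k, -l⟩, ?_⟩
  rw [← GaussianInt.toComplex_inj, map_mul]
  have hI : ((⟨0, 1⟩ : GaussianInt) : ℂ) = Complex.I := by simp [GaussianInt.toComplex_def]
  rw [map_mul, hI, mul_comm, mul_div_assoc, Complex.I_mul_re] at hl
  have : (a:ℂ) / c = ((⟨k, -l⟩ : GaussianInt) : ℂ) := by
    rw [mul_one] at hk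
    apply Complex.ext
    · rw [hk]; simp
    · simp; rw [← hl]; ring
  rw [← this]; field_simp

lemma kloosterman_eq {c : GaussianInt} (hc : c ≠ 0) (m n : GaussianInt) :
    kloosterman m n c = Kl (ec hc) (Ideal.Quotient.mk _ m) (Ideal.Quotient.mk _ n) := by
  rw [kloosterman, Kl]
  refine finsum_congr fun u => ?_
  change ech c _ = ech c _
  apply ech_congr hc
  rw [Ideal.Quotient.mk_out]
  simp only [map_add, map_mul, Ideal.Quotient.mk_out]

end KW


namespace KW

section Kl
variable {R : Type*} [CommRing R] [Fintype R]

open Classical in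
lemma Kl_eq_sum (ψ : AddChar R ℂ) (m n : R) : Kl ψ m n = ∑ u : Rˣ, ψ (u * m + (u⁻¹ : Rˣ) * n) := by
  rw [Kl, finsum_eq_sum_of_fintype]

lemma Kl_symm (ψ : AddChar R ℂ) (m n : R) : Kl ψ m n = Kl ψ n m := by
  classical
  rw [Kl_eq_sum, Kl_eq_sum]
  refine Fintype.sum_equiv (Equiv.inv Rˣ) _ _ fun u => ?_
  simp [add_comm]

lemma Kl_trivial (ψ : AddChar R ℂ) (m n : R) : ‖Kl ψ m n‖ ≤ Fintype.card R := by
  classical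
  rw [Kl_eq_sum]
  refine (norm_sum_le _ _).trans ?_
  simp only [AddChar.norm_apply, Finset.sum_const, Finset.card_univ, nsmul_eq_mul, mul_one]
  exact_mod_cast Fintype.card_le_of_injective _ Units.val_injective

/-- the unit `1 + x` with given inverse -/
def mkU (x y : R) (h : (1 + x) * (1 + y) = 1) : Rˣ := ⟨1 + x, 1 + y, h, by rw [mul_comm]; exact h⟩

open Classical in
lemma stat1 {ψ : AddChar R ℂ} (hψ : ψ.IsPrimitive) (m n h : R) (hh : h * h = 0) :
    Kl ψ m n = ∑ u : Rˣ with h * (u * m - (u⁻¹ : Rˣ) * n) = 0, ψ (u * m + (u⁻¹ : Rˣ) * n) := by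
  have hcard : (Fintype.card R : ℂ) ≠ 0 := by exact_mod_cast Fintype.card_ne_zero
  have h1 : ∀ t : R, Kl ψ m n = ∑ u : Rˣ, ψ (u * m + (u⁻¹ : Rˣ) * n) * ψ (t * (h * (u * m - (u⁻¹ : Rˣ) * n))) := by
    intro t
    have hu : (1 + h * t) * (1 + -(h * t)) = 1 := by linear_combination (-t^2) * hh
    rw [Kl_eq_sum]
    refine (Fintype.sum_equiv (Equiv.mulRight (mkU _ _ hu)) _ _ fun u => ?_).symm
    rw [← AddChar.map_add_eq_mul]
    congr 1
    simp only [Equiv.coe_mulRight, mul_inv_rev, Units.val_mul]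
    change _ = u * (1 + h * t) * m + (1 + -(h * t)) * (u⁻¹ : Rˣ) * n
    ring
  have h2 : (Fintype.card R : ℂ) * Kl ψ m n = ∑ u : Rˣ, ψ (u * m + (u⁻¹ : Rˣ) * n) * 
      ∑ t : R, ψ (t * (h * (u * m - (u⁻¹ : Rˣ) * n))) := by
    simp only [Finset.mul_sum]
    rw [Finset.sum_comm, ← Finset.sum_congr rfl fun t _ => h1 t]
    simp
  simp only [AddChar.sum_mulShift _ hψ] at h2
  rw [Finset.sum_filter]
  apply mul_left_cancel₀ hcard
  rw [h2, Finset.mul_sum]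
  refine Finset.sum_congr rfl fun u _ => ?_
  split_ifs <;> simp [mul_comm]

open Classical in
lemma stat1_bound {ψ : AddChar R ℂ} (hψ : ψ.IsPrimitive) (m n h : R) (hh : h * h = 0) :
    ‖Kl ψ m n‖ ≤ (Finset.univ.filter fun u : Rˣ => h * (u * m - (u⁻¹ : Rˣ) * n) = 0).card := by
  rw [stat1 hψ m n h hh]
  refine (norm_sum_le _ _).trans ?_
  simp [AddChar.norm_apply]

open Classical in
lemma gauss {ψ : AddChar R ℂ} (hψ : ψ.IsPrimitive) (e r v : R) (hv : IsUnit (2 * v)) :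
    ‖∑ s : R, ψ (e * (s * r + s^2 * v))‖ ^ 2 ≤ Fintype.card R * (Finset.univ.filter fun t : R => e * t = 0).card := by
  have key : (∑ s : R, ψ (e * (s * r + s^2 * v))) * conj (∑ s : R, ψ (e * (s * r + s^2 * v))) =
      ∑ t : R, ψ (e * (t * r + t^2 * v)) * ∑ s : R, ψ (s * (2 * v * (e * t))) := by
    rw [map_sum, Finset.mul_sum]
    simp only [← AddChar.map_neg_eq_conj]
    have : ∀ s : R, (∑ s : R, ψ (e * (s * r + s^2 * v))) * ψ (-(e * (s * r + s^2 * v))) =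
        ∑ t : R, ψ (e * (t * r + t^2 * v)) * ψ (s * (2 * v * (e * t))) := by
      intro s
      rw [Finset.sum_mul]
      refine (Fintype.sum_equiv (Equiv.addRight s) _ _ fun t => ?_).symm
      rw [← AddChar.map_add_eq_mul, ← AddChar.map_add_eq_mul]
      congr 1
      simp only [Equiv.coe_addRight]
      ring
    rw [Finset.sum_congr rfl fun s _ => this s, Finset.sum_comm]
    simp only [Finset.mul_sum]
  have h3 : ‖∑ s : R, ψ (e * (s * r + s^2 * v))‖ ^ 2 = ‖(∑ s : R, ψ (e * (s * r + s^2 * v))) * conj (∑ s : R, ψ (e * (s * r + s^2 * v)))‖ := by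
    rw [norm_mul, RCLike.norm_conj, sq]
  rw [h3, key]
  simp only [AddChar.sum_mulShift _ hψ, hv.mul_right_eq_zero]
  refine (norm_sum_le _ _).trans ?_
  rw [Finset.card_filter, Nat.cast_sum, Finset.mul_sum]
  refine Finset.sum_le_sum fun t _ => ?_
  split_ifs <;> simp [AddChar.norm_apply]

open Classical in
lemma stat2_bound {ψ : AddChar R ℂ} (hψ : ψ.IsPrimitive) (m n h g : R) (hh : h * h = 0) (hg : h * g = 0)
    (hg3 : g * g * g = 0) (hn : IsUnit n) (h2 : IsUnit (2:R)) 
    (hU : ∀ x : R, h * x = 0 → ∃ r, x = g * r) :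
    Fintype.card R * ‖Kl ψ m n‖ ≤ (Finset.univ.filter fun u : Rˣ => h * (u * m - (u⁻¹ : Rˣ) * n) = 0).card * 
      Real.sqrt (Fintype.card R * (Finset.univ.filter fun t : R => g * g * t = 0).card) := by
  set U := Finset.univ.filter fun u : Rˣ => h * (u * m - (u⁻¹ : Rˣ) * n) = 0 with hUdef
  have h1 : ∀ s : R, Kl ψ m n = ∑ u ∈ U, ψ (u * m + (u⁻¹ : Rˣ) * n + g * s * (u * m - (u⁻¹ : Rˣ) * n) + g * g * s^2 * ((u⁻¹ : Rˣ) * n)) := by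
    intro s
    have hu : (1 + g * s) * (1 + (-(g * s) + g * g * s ^ 2)) = 1 := by linear_combination (s^3) * hg3
    rw [stat1 hψ m n h hh]
    refine (Finset.sum_equiv (Equiv.mulRight (mkU _ _ hu)) ?_ ?_).symm
    · intro u
      simp only [hUdef, Finset.mem_filter, Finset.mem_univ, true_and, Equiv.coe_mulRight, mul_inv_rev, Units.val_mul]
      change _ ↔ h * (u * (1 + g * s) * m - (1 + (-(g * s) + g * g * s ^ 2)) * (u⁻¹ : Rˣ) * n) = 0
      have : h * (u * (1 + g * s) * m - (1 + (-(g * s) + g * g * s ^ 2)) * (u⁻¹ : Rˣ) * n) = h * (u * m - (u⁻¹ : Rˣ) * n) := by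
        linear_combination (s * u * m + s * (u⁻¹ : Rˣ) * n - g * s^2 * (u⁻¹ : Rˣ) * n) * hg
      rw [this]
    · intro u _
      congr 1
      simp only [Equiv.coe_mulRight, mul_inv_rev, Units.val_mul]
      change _ = u * (1 + g * s) * m + (1 + (-(g * s) + g * g * s ^ 2)) * (u⁻¹ : Rˣ) * n
      ring
  have hsum : (Fintype.card R : ℂ) * Kl ψ m n = ∑ u ∈ U, ∑ s : R, ψ (u * m + (u⁻¹ : Rˣ) * n + g * s * (u * m - (u⁻¹ : Rˣ) * n) + g * g * s^2 * ((u⁻¹ : Rˣ) * n)) := by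
    rw [Finset.sum_comm, ← Finset.sum_congr rfl fun t _ => h1 t]
    simp
  have : Fintype.card R * ‖Kl ψ m n‖ = ‖(Fintype.card R : ℂ) * Kl ψ m n‖ := by simp
  rw [this, hsum]
  refine (norm_sum_le _ _).trans ?_
  rw [← nsmul_eq_mul]
  refine Finset.sum_le_card_nsmul _ _ _ fun u hu => ?_
  rw [hUdef, Finset.mem_filter] at hu
  obtain ⟨r, hr⟩ := hU _ hu.2
  have e1 : ∀ s : R, ψ (u * m + (u⁻¹ : Rˣ) * n + g * s * (u * m - (u⁻¹ : Rˣ) * n) + g * g * s^2 * ((u⁻¹ : Rˣ) * n))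
    = ψ (u * m + (u⁻¹ : Rˣ) * n) * ψ (g * g * (s * r + s^2 * ((u⁻¹ : Rˣ) * n))) := by
    intro s
    rw [← AddChar.map_add_eq_mul, hr]; congr 1; ring
  simp only [e1]
  rw [← Finset.mul_sum, norm_mul, AddChar.norm_apply, one_mul]
  apply Real.le_sqrt_of_sq_le
  exact gauss hψ _ _ _ (h2.mul ((u⁻¹).isUnit.mul hn))

variable {S : Type*} [CommRing S] [Fintype S]

lemma Kl_map (e : R ≃+* S) (ψ : AddChar S ℂ) (m n : R) : Kl ψ (e m) (e n) = Kl (ψ.compAddMonoidHom e.toAddMonoidHom) m n := by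
  classical
  rw [Kl_eq_sum, Kl_eq_sum]
  refine (Fintype.sum_equiv (Units.mapEquiv e.toMulEquiv).toEquiv _ _ fun u => ?_).symm
  change ψ (e _) = _
  simp [← map_inv]

lemma Kl_prod (ψ : AddChar (R × S) ℂ) (m n : R × S) : Kl ψ m n =
    Kl (ψ.compAddMonoidHom (AddMonoidHom.inl R S)) m.1 n.1 * Kl (ψ.compAddMonoidHom (AddMonoidHom.inr R S)) m.2 n.2 := by
  classical
  rw [Kl, Kl_eq_sum, Kl_eq_sum, Finset.sum_mul_sum, ← Finset.sum_product']
  rw [finsum_eq_sum_of_fintype]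
  refine Fintype.sum_equiv MulEquiv.prodUnits.toEquiv _ _ fun u => ?_
  rw [AddChar.compAddMonoidHom_apply, AddChar.compAddMonoidHom_apply, ← AddChar.map_add_eq_mul]
  congr 1
  ext <;> simp [MulEquiv.prodUnits]

open Classical in
/-- reduction along a surjective local homomorphism -/
lemma sum_units_map (f : R →+* S) (hf : Function.Surjective f) (hl : ∀ x, IsUnit (f x) → IsUnit x) (G : S → S → ℂ) :
    ∑ u : Rˣ, G (f u) (f (u⁻¹ : Rˣ)) = (Finset.univ.filter fun x : R => f x = 0).card * ∑ v : Sˣ, G v (v⁻¹ : Sˣ) := by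
  rw [← Finset.sum_fiberwise_of_maps_to (g := Units.map (f : R →* S)) (t := Finset.univ) (by simp), Finset.mul_sum]
  refine Finset.sum_congr rfl fun v _ => ?_
  have h1 : ∀ u ∈ Finset.univ.filter (fun u : Rˣ => Units.map (f : R →* S) u = v), G (f u) (f (u⁻¹ : Rˣ)) = G v (v⁻¹ : Sˣ) := by
    intro u hu
    rw [Finset.mem_filter] at hu
    rw [← hu.2, ← map_inv]
    rfl
  rw [Finset.sum_congr rfl h1, Finset.sum_const, nsmul_eq_mul]
  congr 2
  obtain ⟨x, hx⟩ := hf v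
  symm
  have hxy : ∀ y : R, f y = 0 → IsUnit (x + y) := fun y hy => hl _ (by rw [map_add, hx, hy, add_zero]; exact v.isUnit)
  refine Finset.card_bij (fun y hy => (hxy y (Finset.mem_filter.1 hy).2).unit) ?_ ?_ ?_
  · intro y hy
    rw [Finset.mem_filter]
    refine ⟨Finset.mem_univ _, Units.ext ?_⟩
    have := (Finset.mem_filter.1 hy).2
    simp [hx, this]
  · intro y hy z hz h
    have := congrArg Units.val h
    simpa using this
  · intro u hu
    rw [Finset.mem_filter] at hu
    have h3 : f u = v := congrArg Units.val hu.2
    exact ⟨u - x, by simp [h3, hx], Units.ext (by simp)⟩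
end Kl
end KW


namespace KW

/-- reduction map -/
abbrev mkq (c : GaussianInt) : GaussianInt →+* GQ c := Ideal.Quotient.mk (Ideal.span {c})

lemma mkq_eq_zero {c x : GaussianInt} : mkq c x = 0 ↔ c ∣ x := by
  rw [Ideal.Quotient.eq_zero_iff_mem, Ideal.mem_span_singleton]

lemma mkq_eq {c x y : GaussianInt} : mkq c x = mkq c y ↔ c ∣ x - y := by
  rw [← sub_eq_zero, ← map_sub, mkq_eq_zero]

lemma isUnit_mkq {c x : GaussianInt} : IsUnit (mkq c x) ↔ IsCoprime x c := by
  constructor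
  · intro h
    obtain ⟨y, hy⟩ := h.exists_right_inv
    obtain ⟨y, rfl⟩ := Ideal.Quotient.mk_surjective y
    rw [← map_mul, ← map_one (mkq c), mkq_eq] at hy
    obtain ⟨t, ht⟩ := hy
    exact ⟨y, -t, by linear_combination ht⟩
  · rintro ⟨a, b, h⟩
    refine IsUnit.of_mul_eq_one (mkq c a) ?_
    rw [← map_mul, ← map_one (mkq c), mkq_eq]
    exact ⟨-b, by linear_combination h⟩

lemma card_coset_le {c d e : GaussianInt} (hc : c ≠ 0) (h : c = d * e) (v : GQ c) (s : Finset (GQ c))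
    (hs : ∀ x ∈ s, ∃ r, x = v + mkq c d * r) : s.card ≤ Nat.card (GQ e) := by
  classical
  have he : e ≠ 0 := by rintro rfl; simp [h] at hc
  have := gfinite he
  let _ := Fintype.ofFinite (GQ e)
  rw [Nat.card_eq_fintype_card, ← Finset.card_univ]
  refine (Finset.card_le_card (t := Finset.univ.image fun y : GQ e => v + mkq c (d * Quotient.out y)) ?_).trans Finset.card_image_le
  intro x hx
  obtain ⟨r, rfl⟩ := hs x hx
  obtain ⟨ρ, rfl⟩ := Ideal.Quotient.mk_surjective r
  rw [Finset.mem_image]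
  refine ⟨mkq e ρ, Finset.mem_univ _, ?_⟩
  congr 1
  rw [← map_mul, mkq_eq, h, ← mul_sub]
  apply mul_dvd_mul_left
  rw [← mkq_eq]
  exact Ideal.Quotient.mk_out _

lemma card_GQ_pow (w : GaussianInt) (k : ℕ) : Nat.card (GQ (w^k)) = Nat.card (GQ w) ^ k := by
  have h1 := card_GQ (w^k)
  have h2 := card_GQ w
  have : (Nat.card (GQ (w^k)) : ℝ) = ((Nat.card (GQ w))^k : ℕ) := by
    rw [h1]; push_cast; rw [h2]; simp [← pow_mul, mul_comm]
  exact_mod_cast this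

lemma prime_coprime {w x : GaussianInt} (hw : Prime w) : IsCoprime x w ↔ ¬ w ∣ x := by
  rw [isCoprime_comm, hw.irreducible.coprime_iff_not_dvd]

lemma pow_split {w a b : GaussianInt} (hw : Prime w) {l e : ℕ} (ha : ¬ w ^ (e+1) ∣ a) (h : w ^ l ∣ a * b) : w ^ (l - e) ∣ b := by
  induction l generalizing e a with
  | zero => simp
  | succ l ih =>
    by_cases hwa : w ∣ a
    · obtain ⟨a', rfl⟩ := hwa
      rcases e with _ | e
      · exact absurd (by simp) ha
      · rw [Nat.add_sub_add_right]
        refine ih (a := a') ?_ ?_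
        · intro h'; apply ha; rw [pow_succ']; exact mul_dvd_mul_left _ h'
        · rw [pow_succ', mul_assoc] at h
          exact (mul_dvd_mul_iff_left hw.ne_zero).1 h
    · have := hw.pow_dvd_of_dvd_mul_left (l+1) hwa h
      exact (pow_dvd_pow w (by omega)).trans this

section PP
variable {w : GaussianInt} (hw : Prime w)
include hw

lemma q_pos : 1 ≤ Nat.card (GQ w) := by
  have := gfinite hw.ne_zero
  exact Nat.card_pos

open Classical in
lemma countU {k l j e : ℕ} [Fintype (GQ (w^k))] (hk : k = l + j) (hl : 1 ≤ l) (he : ¬ w^(e+1) ∣ 2) {m n : GaussianInt}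
    (hmn : ¬ (w ∣ m ∧ w ∣ n)) :
    let U := (Finset.univ.filter fun u : (GQ (w^k))ˣ => mkq (w^k) (w^j) * (u * mkq (w^k) m - (u⁻¹ : (GQ (w^k))ˣ) * mkq (w^k) n) = 0)
    U.card ≤ 2 * Nat.card (GQ w) ^ (j + e) ∧ (U.Nonempty → ¬ w ∣ m ∧ ¬ w ∣ n) := by
  intro U
  have hwk : w^k ≠ 0 := pow_ne_zero _ hw.ne_zero
  have hU : ∀ u ∈ U, ∀ a : GaussianInt, mkq (w^k) a = u → (¬ w ∣ a ∧ w^l ∣ a^2 * m - n) := by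
    intro u hu a ha
    constructor
    · rw [← prime_coprime hw]
      have := u.isUnit
      rw [← ha, isUnit_mkq, IsCoprime.pow_right_iff (by omega)] at this
      exact this
    · have h1 := (Finset.mem_filter.1 hu).2
      have h2 : mkq (w^k) (w^j * (a^2 * m - n)) = 0 := by
        simp only [map_mul, map_sub, map_pow] at h1 ⊢
        rw [ha]
        have h3 : (u : GQ (w^k)) * (u⁻¹ : (GQ (w^k))ˣ) = 1 := Units.mul_inv u
        linear_combination (u : GQ (w^k)) * h1 + (mkq (w^k) w)^j * mkq (w^k) n * h3
      rw [mkq_eq_zero, hk, add_comm l j, pow_add] at h2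
      exact (mul_dvd_mul_iff_left (pow_ne_zero _ hw.ne_zero)).1 h2
  have hwl : w ∣ w^l := dvd_pow_self w (by omega)
  have hne : U.Nonempty → ¬ w ∣ m ∧ ¬ w ∣ n := by
    rintro ⟨u, hu⟩
    obtain ⟨a, ha⟩ := Ideal.Quotient.mk_surjective (u : GQ (w^k))
    obtain ⟨h1, h2⟩ := hU u hu a ha
    have h3 := hwl.trans h2
    have hA : w ∣ m → w ∣ n := fun h => by
      have := dvd_sub (h.mul_left (a^2)) h3
      rwa [sub_sub_cancel] at this
    have hB : w ∣ n → w ∣ m := fun h => by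
      have := dvd_add h3 h
      rw [sub_add_cancel] at this
      exact (hw.dvd_or_dvd this).resolve_left fun h => h1 (hw.dvd_of_dvd_pow h)
    exact ⟨fun h => hmn ⟨h, hA h⟩, fun h => hmn ⟨hB h, h⟩⟩
  refine ⟨?_, hne⟩
  rcases U.eq_empty_or_nonempty with h0 | h0
  · rw [h0]; simp
  obtain ⟨hm, -⟩ := hne h0
  obtain ⟨v, hv⟩ := h0
  obtain ⟨b, hb⟩ := Ideal.Quotient.mk_surjective (v : GQ (w^k))
  obtain ⟨hb1, hb2⟩ := hU v hv b hb
  have hfac : w^k = w^(l-e) * w^(k-(l-e)) := by rw [← pow_add]; congr 1; omega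
  have hq := q_pos hw
  let V (s : GQ (w^k)) : Finset (GQ (w^k)) := Finset.univ.filter fun x => ∃ r, x = s + mkq (w^k) (w^(l-e)) * r
  have hV : ∀ s, (V s).card ≤ Nat.card (GQ w) ^ (j+e) := by
    intro s
    have := card_coset_le hwk hfac s (V s) (fun x hx => (Finset.mem_filter.1 hx).2)
    rw [card_GQ_pow] at this
    exact this.trans (Nat.pow_le_pow_right hq (by omega))
  have hsub : U.image Units.val ⊆ V v ∪ V (-v) := by
    intro x hx
    obtain ⟨u, hu, rfl⟩ := Finset.mem_image.1 hx
    obtain ⟨a, ha⟩ := Ideal.Quotient.mk_surjective (u : GQ (w^k))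
    obtain ⟨h1, h2⟩ := hU u hu a ha
    have h3 : w^l ∣ m * ((a - b) * (a + b)) := by
      have := dvd_sub h2 hb2
      convert this using 1; ring
    have h4 := hw.pow_dvd_of_dvd_mul_left l hm h3
    have h5 : ¬ w^(e+1) ∣ (a - b) ∨ ¬ w^(e+1) ∣ (a + b) := by
      by_contra! h
      apply he
      have := dvd_sub h.2 h.1
      rw [show a + b - (a - b) = b * 2 by ring] at this
      exact hw.pow_dvd_of_dvd_mul_left (e+1) hb1 this
    rw [Finset.mem_union]
    rcases h5 with h5 | h5
    · right
      obtain ⟨r, hr⟩ := pow_split hw h5 h4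
      refine Finset.mem_filter.2 ⟨Finset.mem_univ _, mkq _ r, ?_⟩
      rw [← ha, ← hb, ← map_mul, ← hr, ← map_neg, ← map_add]; congr 1; ring
    · left
      rw [mul_comm] at h4
      obtain ⟨r, hr⟩ := pow_split hw h5 h4
      refine Finset.mem_filter.2 ⟨Finset.mem_univ _, mkq _ r, ?_⟩
      rw [← ha, ← hb, ← map_mul, ← hr, ← map_add]; congr 1; ring
  rw [← Finset.card_image_of_injective U Units.val_injective]
  refine (Finset.card_le_card hsub).trans ((Finset.card_union_le _ _).trans ?_)
  linarith [hV v, hV (-v)]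

lemma not_pow_dvd_two (h : w ∣ 2) : Nat.card (GQ w) = 2 ∧ ¬ w^(2+1) ∣ 2 := by
  have h1 : w ∣ ⟨1, 1⟩ := by
    have : (2 : GaussianInt) = ⟨0, -1⟩ * ⟨1,1⟩^2 := by decide
    rw [this] at h
    rcases hw.dvd_or_dvd h with h | h
    · refine absurd (isUnit_of_dvd_one (h.trans ⟨⟨0, 1⟩, by decide⟩)) hw.not_isUnit
    · exact hw.dvd_of_dvd_pow h
  have hn : Nat.card (GQ w) = w.norm.natAbs := by
    have h1 := card_GQ w
    rw [Complex.sq_norm, ← GaussianInt.intCast_real_norm, ← GaussianInt.abs_natCast_norm] at h1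
    exact_mod_cast h1
  have hd : w.norm.natAbs ∣ 2 := by
    obtain ⟨t, ht⟩ := h1
    have := congrArg Zsqrtd.norm ht
    rw [Zsqrtd.norm_mul] at this
    refine ⟨t.norm.natAbs, ?_⟩
    rw [← Int.natAbs_mul, ← this]; decide
  have hn1 : w.norm.natAbs ≠ 1 := by
    intro h
    exact hw.not_isUnit (Zsqrtd.norm_eq_one_iff.1 h)
  have hn2 : w.norm.natAbs = 2 := ((Nat.dvd_prime Nat.prime_two).1 hd).resolve_left hn1
  refine ⟨by rw [hn, hn2], ?_⟩
  rintro ⟨t, ht⟩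
  have := congrArg (fun z => (Zsqrtd.norm z).natAbs) ht
  simp only [Zsqrtd.norm_mul, Int.natAbs_mul, pow_succ, pow_zero, one_mul, hn2] at this
  have h4 : (Zsqrtd.norm (2 : GaussianInt)).natAbs = 4 := by decide
  omega

end PP
end KW


namespace KW

section Fld
variable {F : Type*} [Field F] [Fintype F]

lemma Kl_field_zero (ψ : AddChar F ℂ) (hψ : ψ ≠ 1) {m : F} (hm : m ≠ 0) : ‖Kl ψ m 0‖ ≤ 1 := by
  classical
  have h := AddChar.sum_mulShift m (AddChar.IsPrimitive.of_ne_one hψ)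
  rw [if_neg hm, ← Finset.add_sum_erase _ _ (Finset.mem_univ (0:F)), zero_mul, AddChar.map_zero_eq_one] at h
  have h2 : Kl ψ m 0 = ∑ x ∈ Finset.univ.erase (0:F), ψ (x * m) := by
    rw [Kl_eq_sum]
    refine Finset.sum_bij (fun x _ => (x:F)) ?_ ?_ ?_ ?_
    · intro x _; simp
    · intro x _ y _ h; exact Units.ext h
    · intro x hx; exact ⟨Units.mk0 x (Finset.ne_of_mem_erase hx), Finset.mem_univ _, rfl⟩
    · intro x _
      rw [mul_zero, add_zero]
  rw [h2, show ∑ x ∈ Finset.univ.erase (0:F), ψ (x * m) = -1 by linear_combination h]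
  simp

lemma Kl_field (ψ : AddChar F ℂ) (hψ : ψ ≠ 1) {m n : F} (h : ¬ (m = 0 ∧ n = 0)) :
    ‖Kl ψ m n‖ ≤ 2 * Real.sqrt (Fintype.card F) := by
  classical
  have hq : (1:ℝ) ≤ Real.sqrt (Fintype.card F) := by
    rw [Real.one_le_sqrt]; exact_mod_cast Fintype.card_pos
  by_cases hm : m = 0
  · have hn : n ≠ 0 := fun hn => h ⟨hm, hn⟩
    rw [hm, Kl_symm]
    linarith [Kl_field_zero ψ hψ hn]
  by_cases hn : n = 0
  · rw [hn]
    linarith [Kl_field_zero ψ hψ hm]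
  have := weil ψ hψ hm hn
  rw [Kl_eq_sum]
  simpa only [mul_comm] using this
end Fld

open Classical in
/-- local constant -/
noncomputable def Mw (w : GaussianInt) : ℝ := if w ∣ 2 then 16 else 2

section PP
variable {w : GaussianInt} (hw : Prime w)
include hw

lemma Mw_ge : 2 ≤ Mw w := by
  unfold Mw; split_ifs <;> norm_num

lemma w_norm_pos : 0 < ‖(w:ℂ)‖ := by
  have : (w:ℂ) ≠ 0 := by simpa using hw.ne_zero
  positivity

lemma pp_one {ψ : AddChar (GQ w) ℂ} (hψ : ψ.IsPrimitive) {m n : GaussianInt} (hmn : ¬ (w ∣ m ∧ w ∣ n)) :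
    ‖Kl ψ (mkq w m) (mkq w n)‖ ≤ 2 * ‖(w:ℂ)‖ := by
  have : (Ideal.span {w}).IsMaximal := PrincipalIdealRing.isMaximal_of_irreducible hw.irreducible
  let _ : Field (GQ w) := Ideal.Quotient.field _
  have := gfinite hw.ne_zero
  let _ := Fintype.ofFinite (GQ w)
  have h1 : ψ ≠ 1 := by
    have := hψ one_ne_zero
    rwa [AddChar.mulShift_one] at this
  have h2 := Kl_field ψ h1 (m := mkq w m) (n := mkq w n) (by rwa [mkq_eq_zero, mkq_eq_zero])
  rw [← Nat.card_eq_fintype_card, card_GQ, Real.sqrt_sq (norm_nonneg _)] at h2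
  exact h2

lemma pp_ge2 {k : ℕ} (hk : 2 ≤ k) {ψ : AddChar (GQ (w^k)) ℂ} (hψ : ψ.IsPrimitive) {m n : GaussianInt} (hmn : ¬ (w ∣ m ∧ w ∣ n)) :
    ‖Kl ψ (mkq (w^k) m) (mkq (w^k) n)‖ ≤ Mw w * ‖(w:ℂ)‖^k := by
  classical
  have hwk : w^k ≠ 0 := pow_ne_zero _ hw.ne_zero
  have := gfinite hwk
  let _ := Fintype.ofFinite (GQ (w^k))
  have hpos := w_norm_pos hw
  have hz : ∀ i j, k ≤ i + j → mkq (w^k) (w^i) * mkq (w^k) (w^j) = 0 := by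
    intro i j hij
    rw [← map_mul, ← pow_add, mkq_eq_zero]
    exact pow_dvd_pow w hij
  have hq := card_GQ w
  by_cases h2 : w ∣ 2
  · obtain ⟨hc, he⟩ := not_pow_dvd_two hw h2
    rw [Mw, if_pos h2]
    rw [hc] at hq
    have h4 : ‖(w:ℂ)‖ ≤ 2 := by push_cast at hq; nlinarith
    obtain ⟨l, hl⟩ : ∃ l, k = 2 * l ∨ k = 2 * l + 1 := ⟨k/2, by omega⟩
    rcases hl with hl | hl
    · have hb := stat1_bound hψ (mkq (w^k) m) (mkq (w^k) n) (mkq (w^k) (w^l)) (hz _ _ (by omega))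
      have hU := (countU hw (k := k) (l := l) (j := l) (by omega) (by omega) he hmn).1
      refine hb.trans ((Nat.cast_le.2 hU).trans ?_)
      rw [hc]
      push_cast
      rw [hl, pow_mul ‖(w:ℂ)‖, ← hq]
      push_cast
      rw [pow_add]
      have : (0:ℝ) < 2^l := by positivity
      linarith
    · have hb := stat1_bound hψ (mkq (w^k) m) (mkq (w^k) n) (mkq (w^k) (w^(l+1))) (hz _ _ (by omega))
      have hU := (countU hw (k := k) (l := l) (j := l+1) (by omega) (by omega) he hmn).1
      refine hb.trans ((Nat.cast_le.2 hU).trans ?_)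
      rw [hc]
      push_cast
      rw [hl, pow_succ ‖(w:ℂ)‖, pow_mul ‖(w:ℂ)‖, ← hq]
      push_cast
      rw [pow_add, pow_add]
      have h1 : (1:ℝ) ≤ ‖(w:ℂ)‖ := by push_cast at hq; nlinarith
      have : (0:ℝ) < 2^l := by positivity
      nlinarith
  · rw [Mw, if_neg h2]
    have he : ¬ w^(0+1) ∣ 2 := by simpa using h2
    obtain ⟨l, hl⟩ : ∃ l, k = 2 * l ∨ k = 2 * l + 1 := ⟨k/2, by omega⟩
    rcases hl with hl | hl
    · have hb := stat1_bound hψ (mkq (w^k) m) (mkq (w^k) n) (mkq (w^k) (w^l)) (hz _ _ (by omega))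
      have hU := (countU hw (k := k) (l := l) (j := l) (by omega) (by omega) he hmn).1
      refine hb.trans ((Nat.cast_le.2 hU).trans ?_)
      push_cast
      rw [hl, pow_mul ‖(w:ℂ)‖, ← hq, add_zero]
    · have hb := stat1_bound hψ (mkq (w^k) m) (mkq (w^k) n) (mkq (w^k) (w^(l+1))) (hz _ _ (by omega))
      obtain ⟨hU, hne⟩ := countU hw (k := k) (l := l) (j := l+1) (by omega) (by omega) he hmn
      by_cases hn : w ∣ n
      · rcases Finset.eq_empty_or_nonempty (Finset.univ.filter fun u : (GQ (w^k))ˣ => mkq (w^k) (w^(l+1)) * (u * mkq (w^k) m - (u⁻¹ : (GQ (w^k))ˣ) * mkq (w^k) n) = 0) with h0 | h0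
        · rw [h0] at hb
          simp only [Finset.card_empty, Nat.cast_zero] at hb
          exact hb.trans (by positivity)
        · exact absurd hn (hne h0).2
      have hb2 := stat2_bound hψ (mkq (w^k) m) (mkq (w^k) n) (mkq (w^k) (w^(l+1))) (mkq (w^k) (w^l)) (hz _ _ (by omega))
        (hz _ _ (by omega)) (by rw [← map_mul, ← pow_add]; exact hz _ _ (by omega)) 
        (by rw [isUnit_mkq, IsCoprime.pow_right_iff (by omega), prime_coprime hw]; exact hn)
        (by
          rw [show (2 : GQ (w^k)) = mkq (w^k) 2 from (map_ofNat (mkq (w^k)) 2).symm, isUnit_mkq, IsCoprime.pow_right_iff (by omega), prime_coprime hw]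
          exact h2)
        (by
          intro x hx
          obtain ⟨x, rfl⟩ := Ideal.Quotient.mk_surjective x
          rw [← map_mul, mkq_eq_zero, hl, show 2 * l + 1 = (l+1) + l by ring, pow_add _ (l+1)] at hx
          obtain ⟨r, rfl⟩ := (mul_dvd_mul_iff_left (pow_ne_zero _ hw.ne_zero)).1 hx
          exact ⟨mkq _ r, map_mul _ _ _⟩)
      have hT := card_coset_le (d := w) (e := w^(2*l)) hwk (by rw [hl, pow_succ']) 0
        (Finset.univ.filter fun t => mkq (w^k) (w^l) * mkq (w^k) (w^l) * t = 0) (by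
          intro x hx
          have hx := (Finset.mem_filter.1 hx).2
          obtain ⟨x, rfl⟩ := Ideal.Quotient.mk_surjective x
          rw [← map_mul, ← map_mul, mkq_eq_zero, ← pow_add, hl, show 2 * l + 1 = (l+l) + 1 by ring, pow_add _ (l+l)] at hx
          obtain ⟨r, rfl⟩ := (mul_dvd_mul_iff_left (pow_ne_zero _ hw.ne_zero)).1 hx
          exact ⟨mkq _ r, by rw [pow_one, map_mul, zero_add]⟩)
      rw [card_GQ_pow] at hT
      rw [← Nat.card_eq_fintype_card, card_GQ_pow] at hb2
      set Q := Nat.card (GQ w) with hQ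
      have hQ1 : 1 ≤ Q := q_pos hw
      have hs : Real.sqrt (((Q^k : ℕ) : ℝ) * (Finset.univ.filter fun t => mkq (w^k) (w^l) * mkq (w^k) (w^l) * t = 0).card) ≤ ‖(w:ℂ)‖^(4*l+1) := by
        apply Real.sqrt_le_iff.2
        refine ⟨by positivity, ?_⟩
        have : (‖(w:ℂ)‖^(4*l+1)) ^ 2 = ((Q^k : ℕ) : ℝ) * ((Q^(2*l) : ℕ) : ℝ) := by
          push_cast
          rw [hq, ← pow_mul, ← pow_mul, ← pow_mul, ← pow_add, hl]; congr 1; ring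
        rw [this]
        gcongr
      have hfin : ((Q^k : ℕ) : ℝ) * ‖Kl ψ (mkq (w^k) m) (mkq (w^k) n)‖ ≤ ((2 * Q^(l+1) : ℕ):ℝ) * ‖(w:ℂ)‖^(4*l+1) := by
        refine hb2.trans ?_
        gcongr
      have e1 : ((Q^k : ℕ) : ℝ) = ‖(w:ℂ)‖^(2*k) := by push_cast; rw [hq, ← pow_mul]
      have e2 : ((2 * Q^(l+1) : ℕ):ℝ) * ‖(w:ℂ)‖^(4*l+1) = ‖(w:ℂ)‖^(2*k) * (2 * ‖(w:ℂ)‖^k) := by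
        push_cast; rw [hq, ← pow_mul, hl]; ring
      rw [e1, e2] at hfin
      exact le_of_mul_le_mul_left hfin (by positivity)

end PP
end KW


namespace KW

/-- multiplication by `d` from residues mod `e` to residues mod `d e`. -/
noncomputable def mulMap {c d e : GaussianInt} (h : c = d * e) : GQ e →+ GQ c :=
  (Submodule.mapQ (Ideal.span {e}) (Ideal.span {c}) (LinearMap.mulLeft GaussianInt d) (by
    intro x hx
    rw [Ideal.mem_span_singleton] at hx
    show d * x ∈ Ideal.span {c}
    rw [Ideal.mem_span_singleton, h]
    exact mul_dvd_mul_left d hx)).toAddMonoidHom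

lemma mulMap_mk {c d e : GaussianInt} (h : c = d * e) (x : GaussianInt) : mulMap h (mkq e x) = mkq c (d * x) := rfl

lemma mulMap_prim {c d e : GaussianInt} (h : c = d * e) (hd : d ≠ 0) {ψ : AddChar (GQ c) ℂ} (hψ : ψ.IsPrimitive) :
    (ψ.compAddMonoidHom (mulMap h)).IsPrimitive := by
  intro a ha
  obtain ⟨α, rfl⟩ := Ideal.Quotient.mk_surjective a
  have h1 : mkq c (d * α) ≠ 0 := by
    intro h2
    rw [mkq_eq_zero, h, mul_dvd_mul_iff_left hd] at h2
    exact ha (mkq_eq_zero.2 h2)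
  have := hψ h1
  rw [AddChar.ne_one_iff] at this ⊢
  obtain ⟨x, hx⟩ := this
  obtain ⟨x, rfl⟩ := Ideal.Quotient.mk_surjective x
  refine ⟨mkq e x, ?_⟩
  rw [AddChar.mulShift_apply, AddChar.compAddMonoidHom_apply, ← map_mul, mulMap_mk, ← mul_assoc]
  rwa [AddChar.mulShift_apply, ← map_mul] at hx

lemma pp_step {w : GaussianInt} (hw : Prime w) {k : ℕ} (hk : 1 ≤ k) {c e : GaussianInt} (he : e = w^k) (hc : c = w * e)
    (ψ : AddChar (GQ c) ℂ) (m n : GaussianInt) :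
    ‖Kl ψ (mkq c (w * m)) (mkq c (w * n))‖ ≤ ‖(w:ℂ)‖^2 * ‖Kl (ψ.compAddMonoidHom (mulMap hc)) (mkq e m) (mkq e n)‖ := by
  classical
  have he0 : e ≠ 0 := by rw [he]; exact pow_ne_zero _ hw.ne_zero
  have hc0 : c ≠ 0 := by rw [hc]; exact mul_ne_zero hw.ne_zero he0
  have := gfinite he0
  have := gfinite hc0
  let _ := Fintype.ofFinite (GQ e)
  let _ := Fintype.ofFinite (GQ c)
  have hle : Ideal.span {c} ≤ Ideal.span {e} := by
    rw [Ideal.span_singleton_le_span_singleton]; exact ⟨w, by rw [hc, mul_comm]⟩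
  set f : GQ c →+* GQ e := Ideal.Quotient.factor hle with hf
  have hfm : ∀ x, f (mkq c x) = mkq e x := fun x => rfl
  have h1 := sum_units_map f (Ideal.Quotient.factor_surjective hle) (by
    intro x hx
    obtain ⟨x, rfl⟩ := Ideal.Quotient.mk_surjective x
    rw [hfm, isUnit_mkq, he, IsCoprime.pow_right_iff (by omega)] at hx
    rw [isUnit_mkq, hc, he, ← pow_succ', IsCoprime.pow_right_iff (by omega)]
    exact hx) (fun x y => (ψ.compAddMonoidHom (mulMap hc)) (x * mkq e m + y * mkq e n))
  rw [Kl_eq_sum, Kl_eq_sum]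
  have h2 : ∀ x y : GQ c, ψ (x * mkq c (w * m) + y * mkq c (w * n)) =
      (ψ.compAddMonoidHom (mulMap hc)) (f x * mkq e m + f y * mkq e n) := by
    intro x y
    obtain ⟨x, rfl⟩ := Ideal.Quotient.mk_surjective x
    obtain ⟨y, rfl⟩ := Ideal.Quotient.mk_surjective y
    rw [hfm, hfm, AddChar.compAddMonoidHom_apply, ← map_mul (mkq e), ← map_mul (mkq e), ← map_add (mkq e), mulMap_mk,
      ← map_mul (mkq c), ← map_mul (mkq c), ← map_add (mkq c)]
    congr 2; ring
  simp only [h2]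
  rw [h1, norm_mul]
  gcongr
  rw [Complex.norm_natCast, ← card_GQ]
  exact_mod_cast card_coset_le hc0 (hc.trans (mul_comm _ _)) 0 _ (by
    intro x hx
    have hx := (Finset.mem_filter.1 hx).2
    obtain ⟨x, rfl⟩ := Ideal.Quotient.mk_surjective x
    rw [hfm, mkq_eq_zero] at hx
    obtain ⟨r, rfl⟩ := hx
    exact ⟨mkq c r, by rw [map_mul, zero_add]⟩)

theorem pp {w : GaussianInt} (hw : Prime w) (k : ℕ) : ∀ c : GaussianInt, c = w^(k+1) → ∀ ψ : AddChar (GQ c) ℂ, ψ.IsPrimitive →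
    ∀ m n : GaussianInt, ∃ d, d ∣ c ∧ d ∣ m ∧ d ∣ n ∧ ‖Kl ψ (mkq c m) (mkq c n)‖ ≤ Mw w * ‖(d:ℂ)‖ * ‖(c:ℂ)‖ := by
  induction k with
  | zero =>
    intro c hc ψ hψ m n
    obtain rfl : c = w := by simpa using hc
    have hM := Mw_ge hw
    by_cases hmn : c ∣ m ∧ c ∣ n
    · refine ⟨c, dvd_rfl, hmn.1, hmn.2, ?_⟩
      have := gfinite hw.ne_zero
      let _ := Fintype.ofFinite (GQ c)
      refine (Kl_trivial _ _ _).trans ?_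
      rw [← Nat.card_eq_fintype_card, card_GQ]
      nlinarith [sq_nonneg ‖(c:ℂ)‖]
    · refine ⟨1, one_dvd _, one_dvd _, one_dvd _, (pp_one hw hψ hmn).trans ?_⟩
      simp only [map_one, norm_one, mul_one]
      gcongr
  | succ k ih =>
    intro c hc ψ hψ m n
    by_cases hmn : w ∣ m ∧ w ∣ n
    · obtain ⟨⟨m, rfl⟩, ⟨n, rfl⟩⟩ := hmn
      have hc' : c = w * w^(k+1) := by rw [hc, pow_succ']
      obtain ⟨d, h1, h2, h3, h4⟩ := ih _ rfl _ (mulMap_prim hc' hw.ne_zero hψ) m n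
      refine ⟨w * d, ?_, mul_dvd_mul_left _ h2, mul_dvd_mul_left _ h3, ?_⟩
      · rw [hc']; exact mul_dvd_mul_left _ h1
      · refine (pp_step hw (by omega) rfl hc' ψ m n).trans ?_
        calc _ ≤ ‖(w:ℂ)‖^2 * (Mw w * ‖(d:ℂ)‖ * ‖((w^(k+1) : GaussianInt):ℂ)‖) := by gcongr
          _ = _ := by rw [hc', map_mul, map_mul, norm_mul, norm_mul]; ring
    · subst hc
      refine ⟨1, one_dvd _, one_dvd _, one_dvd _, (pp_ge2 hw (by omega) hψ hmn).trans ?_⟩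
      simp

end KW


namespace KW

lemma tau_finite {c : GaussianInt} (hc : c ≠ 0) : Finite {I : Ideal GaussianInt // I ∣ Ideal.span {c}} := by
  have : Ideal.span {c} ≠ 0 := by rwa [Ne, Ideal.zero_eq_bot, Ideal.span_singleton_eq_bot]
  exact @Finite.of_fintype _ (UniqueFactorizationMonoid.fintypeSubtypeDvd _ this)

lemma tau_pos {c : GaussianInt} (hc : c ≠ 0) : 1 ≤ tauIdeals c := by
  have := tau_finite hc
  have : Nonempty {I : Ideal GaussianInt // I ∣ Ideal.span {c}} := ⟨⟨_, dvd_rfl⟩⟩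
  exact Nat.card_pos

lemma tau_two {c : GaussianInt} (hc : c ≠ 0) (hu : ¬ IsUnit c) : 2 ≤ tauIdeals c := by
  have := tau_finite hc
  apply Finite.one_lt_card_iff_nontrivial.2
  refine ⟨⟨1, one_dvd _⟩, ⟨_, dvd_rfl⟩, ?_⟩
  intro h
  have h := congrArg Subtype.val h
  simp only [Ideal.one_eq_top] at h
  exact hu (Ideal.span_singleton_eq_top.1 h.symm)

lemma tau_mul {x y : GaussianInt} (hx : x ≠ 0) (hy : y ≠ 0) (h : IsCoprime x y) : tauIdeals x * tauIdeals y ≤ tauIdeals (x * y) := by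
  have := tau_finite (mul_ne_zero hx hy)
  have hI : IsCoprime (Ideal.span {x}) (Ideal.span {y}) := (Ideal.isCoprime_span_singleton_iff x y).2 h
  unfold tauIdeals
  rw [← Nat.card_prod]
  refine Nat.card_le_card_of_injective (fun p : {I : Ideal GaussianInt // I ∣ Ideal.span {x}} × {I : Ideal GaussianInt // I ∣ Ideal.span {y}} =>
    (⟨p.1.1 * p.2.1, by rw [← Ideal.span_singleton_mul_span_singleton]; exact mul_dvd_mul p.1.2 p.2.2⟩ : {I : Ideal GaussianInt // I ∣ Ideal.span {x*y}})) ?_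
  rintro ⟨⟨I, hI1⟩, ⟨J, hJ1⟩⟩ ⟨⟨I', hI2⟩, ⟨J', hJ2⟩⟩ he
  have he : I * J = I' * J' := congrArg Subtype.val he
  have cop : ∀ {A B : Ideal GaussianInt}, A ∣ Ideal.span {x} → B ∣ Ideal.span {y} → IsCoprime A B := fun ha hb =>
    (hI.of_isCoprime_of_dvd_left ha).of_isCoprime_of_dvd_right hb
  have e1 : I = I' := dvd_antisymm ((cop hI1 hJ2).dvd_of_dvd_mul_right (he ▸ dvd_mul_right I J))
    ((cop hI2 hJ1).dvd_of_dvd_mul_right (he ▸ dvd_mul_right I' J'))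
  have e2 : J = J' := dvd_antisymm ((cop hI2 hJ1).symm.dvd_of_dvd_mul_left (he ▸ dvd_mul_left J I))
    ((cop hI1 hJ2).symm.dvd_of_dvd_mul_left (he ▸ dvd_mul_left J' I'))
  subst e1 e2
  rfl

lemma prim_inl {R S : Type*} [CommRing R] [CommRing S] {ψ : AddChar (R × S) ℂ} (h : ψ.IsPrimitive) :
    (ψ.compAddMonoidHom (AddMonoidHom.inl R S)).IsPrimitive := by
  intro a ha
  have := h (a := (a, 0)) (by simpa using ha)
  rw [AddChar.ne_one_iff] at this ⊢
  obtain ⟨x, hx⟩ := this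
  exact ⟨x.1, by simpa [AddChar.mulShift_apply, Prod.mul_def] using hx⟩

lemma prim_inr {R S : Type*} [CommRing R] [CommRing S] {ψ : AddChar (R × S) ℂ} (h : ψ.IsPrimitive) :
    (ψ.compAddMonoidHom (AddMonoidHom.inr R S)).IsPrimitive := by
  intro a ha
  have := h (a := (0, a)) (by simpa using ha)
  rw [AddChar.ne_one_iff] at this ⊢
  obtain ⟨x, hx⟩ := this
  exact ⟨x.2, by simpa [AddChar.mulShift_apply, Prod.mul_def] using hx⟩

lemma prim_equiv {R S : Type*} [CommRing R] [CommRing S] (e : R ≃+* S) {ψ : AddChar S ℂ} (h : ψ.IsPrimitive) :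
    (ψ.compAddMonoidHom e.toAddMonoidHom).IsPrimitive := by
  intro a ha
  have := h (a := e a) (by simpa using ha)
  rw [AddChar.ne_one_iff] at this ⊢
  obtain ⟨x, hx⟩ := this
  refine ⟨e.symm x, ?_⟩
  rw [AddChar.mulShift_apply] at hx ⊢
  have : e.toAddMonoidHom (a * e.symm x) = e a * x := by
    show e (a * e.symm x) = _
    simp
  rwa [AddChar.compAddMonoidHom_apply, this]

/-- chinese remainder equivalence -/
noncomputable def crt {x y : GaussianInt} (h : IsCoprime x y) : GQ (x * y) ≃+* GQ x × GQ y :=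
  (Ideal.quotEquivOfEq (Ideal.span_singleton_mul_span_singleton x y).symm).trans
    (Ideal.quotientMulEquivQuotientProd _ _ ((Ideal.isCoprime_span_singleton_iff x y).2 h))

lemma crt_mk {x y : GaussianInt} (h : IsCoprime x y) (m : GaussianInt) : crt h (mkq (x*y) m) = (mkq x m, mkq y m) := rfl

lemma Kl_crt {x y : GaussianInt} (hx : x ≠ 0) (hy : y ≠ 0) (h : IsCoprime x y) {ψ : AddChar (GQ (x*y)) ℂ} (hψ : ψ.IsPrimitive) :
    ∃ (ψ₁ : AddChar (GQ x) ℂ) (ψ₂ : AddChar (GQ y) ℂ), ψ₁.IsPrimitive ∧ ψ₂.IsPrimitive ∧ ∀ m n,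
      Kl ψ (mkq (x*y) m) (mkq (x*y) n) = Kl ψ₁ (mkq x m) (mkq x n) * Kl ψ₂ (mkq y m) (mkq y n) := by
  have := gfinite hx
  have := gfinite hy
  have := gfinite (mul_ne_zero hx hy)
  let _ := Fintype.ofFinite (GQ x)
  let _ := Fintype.ofFinite (GQ y)
  let _ := Fintype.ofFinite (GQ (x*y))
  have h1 := prim_equiv (crt h).symm hψ
  refine ⟨_, _, prim_inl h1, prim_inr h1, ?_⟩
  intro m n
  have h2 := Kl_prod (ψ.compAddMonoidHom (crt h).symm.toAddMonoidHom) (mkq x m, mkq y m) (mkq x n, mkq y n)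
  rw [← Kl_map, ← crt_mk h, ← crt_mk h, RingEquiv.symm_apply_apply, RingEquiv.symm_apply_apply] at h2
  exact h2

open Classical in
/-- local factor at the even prime -/
noncomputable def Kc (c : GaussianInt) : ℝ := if (⟨1, 1⟩ : GaussianInt) ∣ c then 8 else 1

lemma even_prime {w : GaussianInt} (hw : Prime w) (h : w ∣ 2) : (⟨1, 1⟩ : GaussianInt) ∣ w := by
  have h1 := card_GQ w
  rw [(not_pow_dvd_two hw h).1] at h1
  obtain ⟨a, b⟩ := w
  have h2 : (a:ℝ)^2 + (b:ℝ)^2 = 2 := by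
    rw [← Complex.normSq_eq_norm_sq, Complex.normSq_apply] at h1
    simp [GaussianInt.toComplex_def] at h1
    linarith
  have h3 : a^2 + b^2 = 2 := by exact_mod_cast h2
  have h4 : (a - b) % 2 = 0 := by
    have : (a^2+b^2) % 2 = 0 := by rw [h3]; rfl
    rcases Int.emod_two_eq_zero_or_one a with ha | ha <;> rcases Int.emod_two_eq_zero_or_one b with hb | hb <;>
      simp [pow_two, Int.add_emod, Int.mul_emod, Int.sub_emod, ha, hb] at this ⊢
  refine ⟨⟨(a+b)/2, (b-a)/2⟩, ?_⟩
  rw [Zsqrtd.ext_iff]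
  simp
  omega

lemma even_not_unit : ¬ IsUnit (⟨1, 1⟩ : GaussianInt) := by
  rw [← Zsqrtd.norm_eq_one_iff]
  simp [Zsqrtd.norm]

lemma Kc_mul {x y : GaussianInt} (h : IsCoprime x y) : Kc x * Kc y ≤ Kc (x * y) := by
  unfold Kc
  by_cases hx : (⟨1, 1⟩ : GaussianInt) ∣ x
  · have hy : ¬ (⟨1, 1⟩ : GaussianInt) ∣ y := fun hy => even_not_unit (h.isUnit_of_dvd' hx hy)
    rw [if_pos hx, if_neg hy, if_pos (hx.mul_right y), mul_one]
  · rw [if_neg hx, one_mul]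
    by_cases hy : (⟨1, 1⟩ : GaussianInt) ∣ y
    · rw [if_pos hy, if_pos (hy.mul_left x)]
    · rw [if_neg hy]; split_ifs <;> norm_num

lemma Kc_ge (c : GaussianInt) : 1 ≤ Kc c := by unfold Kc; split_ifs <;> norm_num
lemma Kc_le (c : GaussianInt) : Kc c ≤ 8 := by unfold Kc; split_ifs <;> norm_num

lemma unit_case {c : GaussianInt} (hc : IsUnit c) (ψ : AddChar (GQ c) ℂ) (m n : GaussianInt) :
    ‖Kl ψ (mkq c m) (mkq c n)‖ ≤ Kc c * tauIdeals c * ‖(c:ℂ)‖ := by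
  have hc0 := hc.ne_zero
  have := gfinite hc0
  let _ := Fintype.ofFinite (GQ c)
  have : Subsingleton (GQ c) := Ideal.Quotient.subsingleton_iff.2 (Ideal.span_singleton_eq_top.2 hc)
  have h1 := card_GQ c
  rw [Nat.card_unique] at h1
  have h2 : ‖(c:ℂ)‖ = 1 := by
    have := norm_nonneg (c:ℂ)
    push_cast at h1
    nlinarith
  refine (Kl_trivial _ _ _).trans ?_
  rw [h2, ← Nat.card_eq_fintype_card, Nat.card_unique, mul_one]
  have h3 : (1:ℝ) ≤ tauIdeals c := by exact_mod_cast tau_pos hc0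
  push_cast
  nlinarith [Kc_ge c]

theorem full (c : GaussianInt) : c ≠ 0 → ∀ ψ : AddChar (GQ c) ℂ, ψ.IsPrimitive →
    ∀ m n : GaussianInt, ∃ d, d ∣ c ∧ d ∣ m ∧ d ∣ n ∧ ‖Kl ψ (mkq c m) (mkq c n)‖ ≤ Kc c * tauIdeals c * ‖(d:ℂ)‖ * ‖(c:ℂ)‖ := by
  refine UniqueFactorizationMonoid.induction_on_coprime c (fun h => absurd rfl h) ?_ ?_ ?_
  · intro x hx _ ψ _ m n
    exact ⟨1, one_dvd _, one_dvd _, one_dvd _, by simpa using unit_case hx ψ m n⟩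
  · intro w i hw hc ψ hψ m n
    rcases i with _ | k
    · exact ⟨1, one_dvd _, one_dvd _, one_dvd _, by simpa using unit_case (by simp) ψ m n⟩
    · obtain ⟨d, h1, h2, h3, h4⟩ := pp hw k _ rfl ψ hψ m n
      refine ⟨d, h1, h2, h3, h4.trans ?_⟩
      have ht : (2:ℝ) ≤ tauIdeals (w^(k+1)) := by
        exact_mod_cast tau_two hc (fun hu => hw.not_unit (isUnit_of_dvd_unit (dvd_pow_self w (by omega)) hu))
      have hM : Mw w ≤ Kc (w^(k+1)) * 2 := by
        unfold Mw
        split_ifs with hw2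
        · rw [Kc, if_pos ((even_prime hw hw2).trans (dvd_pow_self w (by omega)))]; norm_num
        · linarith [Kc_ge (w^(k+1))]
      gcongr
      refine hM.trans ?_
      have := Kc_ge (w^(k+1))
      gcongr
  · intro x y hxy ihx ihy hc ψ hψ m n
    have hx := left_ne_zero_of_mul hc
    have hy := right_ne_zero_of_mul hc
    have hcop : IsCoprime x y := isRelPrime_iff_isCoprime.1 hxy
    obtain ⟨ψ₁, ψ₂, p1, p2, hK⟩ := Kl_crt hx hy hcop hψ
    obtain ⟨d, a1, a2, a3, a4⟩ := ihx hx ψ₁ p1 m n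
    obtain ⟨e, b1, b2, b3, b4⟩ := ihy hy ψ₂ p2 m n
    have hde : IsCoprime d e := (hcop.of_isCoprime_of_dvd_left a1).of_isCoprime_of_dvd_right b1
    refine ⟨d * e, mul_dvd_mul a1 b1, hde.mul_dvd a2 b2, hde.mul_dvd a3 b3, ?_⟩
    rw [hK, norm_mul]
    have k1 := Kc_ge x
    have k2 := Kc_ge y
    calc _ ≤ (Kc x * tauIdeals x * ‖(d:ℂ)‖ * ‖(x:ℂ)‖) * (Kc y * tauIdeals y * ‖(e:ℂ)‖ * ‖(y:ℂ)‖) := by gcongr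
      _ = (Kc x * Kc y) * ((tauIdeals x * tauIdeals y : ℕ) : ℝ) * ‖((d*e:GaussianInt):ℂ)‖ * ‖((x*y : GaussianInt):ℂ)‖ := by
        rw [map_mul, map_mul, norm_mul, norm_mul]; push_cast; ring
      _ ≤ _ := by
        have := Kc_mul hcop
        have := tau_mul hx hy hcop
        have := Kc_ge (x*y)
        gcongr

theorem kloosterman_bound {c : GaussianInt} (hc : c ≠ 0) (m n : GaussianInt) :
    ∃ d, d ∣ c ∧ d ∣ m ∧ d ∣ n ∧ ‖kloosterman m n c‖ ≤ 8 * tauIdeals c * ‖(d:ℂ)‖ * ‖(c:ℂ)‖ := by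
  obtain ⟨d, h1, h2, h3, h4⟩ := full c hc _ (ec_prim hc) m n
  refine ⟨d, h1, h2, h3, ?_⟩
  rw [kloosterman_eq hc]
  refine h4.trans ?_
  have := Kc_le c
  gcongr

end KW


namespace KW

lemma re_abs_le (q : GaussianInt) : |(q.re:ℝ)| ≤ ‖(q:ℂ)‖ := by
  have := Complex.abs_re_le_norm (q:ℂ)
  have e : (q:ℂ).re = q.re := GaussianInt.re_toComplex q.re q.im
  rwa [e] at this
lemma im_abs_le (q : GaussianInt) : |(q.im:ℝ)| ≤ ‖(q:ℂ)‖ := by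
  have := Complex.abs_im_le_norm (q:ℂ)
  have e : (q:ℂ).im = q.im := GaussianInt.im_toComplex q.re q.im
  rwa [e] at this

lemma one_le_norm {q : GaussianInt} (hq : q ≠ 0) : 1 ≤ ‖(q:ℂ)‖ := by
  have h := card_GQ q
  have := gfinite hq
  have h1 : (1:ℝ) ≤ Nat.card (GQ q) := by exact_mod_cast (Nat.card_pos (α := GQ q))
  rw [h] at h1
  nlinarith [norm_nonneg (q:ℂ)]

lemma mem_box {R : ℝ} {q : GaussianInt} (h : ‖(q:ℂ)‖ ≤ R) :
    (q.re, q.im) ∈ Finset.Icc (-⌊R⌋) ⌊R⌋ ×ˢ Finset.Icc (-⌊R⌋) ⌊R⌋ := by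
  have h1 := abs_le.1 ((re_abs_le q).trans h)
  have h2 := abs_le.1 ((im_abs_le q).trans h)
  simp only [Finset.mem_product, Finset.mem_Icc]
  refine ⟨⟨?_, Int.le_floor.2 h1.2⟩, ⟨?_, Int.le_floor.2 h2.2⟩⟩
  · rw [neg_le]; apply Int.le_floor.2; push_cast; linarith
  · rw [neg_le]; apply Int.le_floor.2; push_cast; linarith

lemma pair_inj : Function.Injective (fun q : GaussianInt => (q.re, q.im)) := by
  intro a b h
  simp only [Prod.mk.injEq] at h
  exact Zsqrtd.ext h.1 h.2

lemma count_ball {R : ℝ} (s : Finset GaussianInt) (hs : ∀ q ∈ s, q ≠ 0 ∧ ‖(q:ℂ)‖ ≤ R) : (s.card : ℝ) ≤ 9 * R^2 := by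
  rcases s.eq_empty_or_nonempty with rfl | ⟨q, hq⟩
  · simp; positivity
  have hR : 1 ≤ R := (one_le_norm (hs q hq).1).trans (hs q hq).2
  have hF : 1 ≤ ⌊R⌋ := Int.le_floor.2 (by simpa using hR)
  have h1 : s.card ≤ (Finset.Icc (-⌊R⌋) ⌊R⌋ ×ˢ Finset.Icc (-⌊R⌋) ⌊R⌋).card :=
    Finset.card_le_card_of_injOn (fun q => (q.re, q.im)) (fun q hq => mem_box (hs q hq).2) pair_inj.injOn
  rw [Finset.card_product, Int.card_Icc] at h1
  have h2 : (s.card : ℤ) ≤ (2*⌊R⌋+1)*(2*⌊R⌋+1) := by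
    have : ((⌊R⌋ + 1 - -⌊R⌋).toNat : ℤ) = 2 * ⌊R⌋ + 1 := by rw [Int.toNat_of_nonneg] <;> omega
    rw [← this]; exact_mod_cast h1
  have h3 : (s.card : ℤ) ≤ 9 * ⌊R⌋^2 := by nlinarith
  have h4 : (s.card : ℝ) ≤ 9 * (⌊R⌋:ℝ)^2 := by exact_mod_cast h3
  have h5 := Int.floor_le R
  have h6 : (0:ℝ) ≤ (⌊R⌋:ℝ) := by exact_mod_cast (by omega : (0:ℤ) ≤ ⌊R⌋)
  refine h4.trans ?_
  gcongr

lemma ann_finite (N : ℝ) : {n : GaussianInt | InAnn N n}.Finite := by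
  refine Set.Finite.subset (Set.Finite.preimage (pair_inj.injOn) (Finset.finite_toSet (Finset.Icc (-⌊√2*N⌋) ⌊√2*N⌋ ×ˢ Finset.Icc (-⌊√2*N⌋) ⌊√2*N⌋))) ?_
  intro n hn
  exact mem_box hn.2.2

/-- the annulus as a finset -/
noncomputable def ann (N : ℝ) : Finset GaussianInt := (ann_finite N).toFinset

lemma mem_ann {N : ℝ} {n : GaussianInt} : n ∈ ann N ↔ InAnn N n := by simp [ann]

lemma sqNorm_eq (b : GaussianInt → ℂ) (N : ℝ) : sqNorm b N = ∑ n ∈ ann N, ‖b n‖^2 := by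
  unfold sqNorm
  rw [finsum_mem_eq_finite_toFinset_sum _ (ann_finite N)]
  rfl

lemma Bform_eq (b : GaussianInt → ℂ) (θ : ℂ) (c : GaussianInt) (N : ℝ) : Bform b θ c N =
    ∑ m ∈ ann N, ∑ n ∈ ann N,  b m * conj (b n) * kloosterman m n c *
      Real.cos (4 * Real.pi * ((((m : ℂ) * (n : ℂ)) ^ ((1:ℂ)/2) * θ / (c : ℂ)).re)) := by
  unfold Bform
  rw [finsum_mem_eq_finite_toFinset_sum _ (ann_finite N)]
  refine Finset.sum_congr rfl fun m _ => ?_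
  rw [finsum_mem_eq_finite_toFinset_sum _ (ann_finite N)]
  rfl

/-- square root of the norm of an ideal -/
noncomputable def rtN (I : Ideal GaussianInt) : ℝ := √(Nat.card (GaussianInt ⧸ I))

lemma rtN_span (d : GaussianInt) : rtN (Ideal.span {d}) = ‖(d:ℂ)‖ := by
  rw [rtN, card_GQ, Real.sqrt_sq (norm_nonneg _)]

lemma rtN_nonneg (I : Ideal GaussianInt) : 0 ≤ rtN I := Real.sqrt_nonneg _

open Classical in
lemma count_mult {N : ℝ} {I : Ideal GaussianInt} (hI : I ≠ ⊥) :
    rtN I * ((ann N).filter fun n => n ∈ I).card ≤ 18 * N^2 := by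
  obtain ⟨d, hd⟩ : ∃ d, I = Ideal.span {d} := (IsPrincipalIdealRing.principal I).principal
  subst hd
  have hd0 : d ≠ 0 := by rintro rfl; simp at hI
  rw [rtN_span]
  have h1 := one_le_norm hd0
  have h2 : (((ann N).filter fun n => n ∈ Ideal.span {d}).card : ℝ) ≤ 9 * (√2 * N / ‖(d:ℂ)‖)^2 := by
    have hdv : ∀ n ∈ (ann N).filter fun n => n ∈ Ideal.span {d}, ∃ q, n = d * q := by
      intro n hn
      exact Ideal.mem_span_singleton.1 (Finset.mem_filter.1 hn).2
    choose! f hf using hdv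
    have hinj : Set.InjOn f ((ann N).filter fun n => n ∈ Ideal.span {d}) := by
      intro x hx y hy hxy
      rw [hf x hx, hf y hy, hxy]
    rw [← Finset.card_image_of_injOn hinj]
    apply count_ball
    intro q hq
    obtain ⟨n, hn, rfl⟩ := Finset.mem_image.1 hq
    have hA := mem_ann.1 (Finset.mem_filter.1 hn).1
    have hfn := hf n hn
    refine ⟨fun h => hA.1.1 (by rw [hfn, h, mul_zero]), ?_⟩
    rw [le_div_iff₀ (by linarith), mul_comm, ← norm_mul, ← map_mul, ← hfn]
    exact hA.2.2
  have h3 : ‖(d:ℂ)‖ * (9 * (√2 * N / ‖(d:ℂ)‖)^2) = 18 * N^2 / ‖(d:ℂ)‖ := by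
    have : (√2)^2 = 2 := Real.sq_sqrt (by norm_num)
    field_simp
    rw [this]; ring
  calc _ ≤ ‖(d:ℂ)‖ * (9 * (√2 * N / ‖(d:ℂ)‖)^2) := by gcongr
    _ = _ := h3
    _ ≤ _ := div_le_self (by positivity) h1

section fin
open Classical
variable {c : GaussianInt} [Fintype {I : Ideal GaussianInt // I ∣ Ideal.span {c}}]

/-- the gcd majorant -/
noncomputable def gg (c : GaussianInt) [Fintype {I : Ideal GaussianInt // I ∣ Ideal.span {c}}] (n : GaussianInt) : ℝ :=
  ∑ I : {I : Ideal GaussianInt // I ∣ Ideal.span {c}}, if n ∈ I.1 then rtN I.1 else 0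

lemma le_gg {d n : GaussianInt} (hd : d ∣ c) (hn : d ∣ n) : ‖(d:ℂ)‖ ≤ gg c n := by
  unfold gg
  have hm : n ∈ Ideal.span {d} := Ideal.mem_span_singleton.2 hn
  have := Finset.single_le_sum (f := fun I : {I : Ideal GaussianInt // I ∣ Ideal.span {c}} => if n ∈ I.1 then rtN I.1 else 0)
    (fun I _ => by split_ifs; exacts [rtN_nonneg _, le_rfl])
    (Finset.mem_univ ⟨Ideal.span {d}, by rw [Ideal.dvd_iff_le, Ideal.span_singleton_le_span_singleton]; exact hd⟩)
  simpa only [if_pos hm, rtN_span] using this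

lemma gg_nonneg (n : GaussianInt) : 0 ≤ gg c n :=
  Finset.sum_nonneg fun I _ => by split_ifs; exacts [rtN_nonneg _, le_rfl]

lemma sum_gg (hc : c ≠ 0) (N : ℝ) : ∑ n ∈ ann N, gg c n ≤ tauIdeals c * (18 * N^2) := by
  unfold gg
  rw [Finset.sum_comm, tauIdeals, Nat.card_eq_fintype_card, ← Finset.card_univ, ← nsmul_eq_mul]
  apply Finset.sum_le_card_nsmul
  rintro ⟨I, hI⟩ _
  have hI0 : I ≠ ⊥ := by
    rintro rfl
    have := zero_dvd_iff.1 hI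
    rw [Ideal.zero_eq_bot, Ideal.span_singleton_eq_bot] at this
    exact hc this
  rw [← Finset.sum_filter, Finset.sum_const, nsmul_eq_mul, mul_comm]
  exact count_mult hI0

lemma term_bound (b : GaussianInt → ℂ) (θ : ℂ) (hc : c ≠ 0) (m n : GaussianInt) :
    ‖b m * conj (b n) * kloosterman m n c *
      Real.cos (4 * Real.pi * ((((m : ℂ) * (n : ℂ)) ^ ((1:ℂ)/2) * θ / (c : ℂ)).re))‖ ≤
    (8 * tauIdeals c * ‖(c:ℂ)‖) * ((‖b m‖^2 * gg c n + ‖b n‖^2 * gg c m) / 2) := by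
  obtain ⟨d, h1, h2, h3, h4⟩ := kloosterman_bound hc m n
  have hm := le_gg h1 h2
  have hn := le_gg h1 h3
  rw [norm_mul, norm_mul, norm_mul, RCLike.norm_conj, Complex.norm_real, Real.norm_eq_abs]
  have hcos := Real.abs_cos_le_one (4 * Real.pi * ((((m : ℂ) * (n : ℂ)) ^ ((1:ℂ)/2) * θ / (c : ℂ)).re))
  calc _ ≤ ‖b m‖ * ‖b n‖ * (8 * tauIdeals c * ‖(d:ℂ)‖ * ‖(c:ℂ)‖) * 1 := by gcongr
    _ = (8 * tauIdeals c * ‖(c:ℂ)‖) * (‖b m‖ * ‖b n‖ * ‖(d:ℂ)‖) := by ring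
    _ ≤ (8 * tauIdeals c * ‖(c:ℂ)‖) * ((‖b m‖^2 * ‖(d:ℂ)‖ + ‖b n‖^2 * ‖(d:ℂ)‖) / 2) := by
      gcongr
      nlinarith [mul_nonneg (sq_nonneg (‖b m‖ - ‖b n‖)) (norm_nonneg (d:ℂ))]
    _ ≤ _ := by gcongr

lemma main_bound (b : GaussianInt → ℂ) (θ : ℂ) (hc : c ≠ 0) (N : ℝ) :
    ‖Bform b θ c N‖ ≤ 144 * (tauIdeals c : ℝ)^2 * ‖(c:ℂ)‖ * N^2 * sqNorm b N := by
  rw [Bform_eq, sqNorm_eq]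
  set X : ℝ := 8 * tauIdeals c * ‖(c:ℂ)‖ with hX
  calc _ ≤ ∑ m ∈ ann N, ∑ n ∈ ann N, X * ((‖b m‖^2 * gg c n + ‖b n‖^2 * gg c m) / 2) := by
        refine (norm_sum_le _ _).trans (Finset.sum_le_sum fun m _ => (norm_sum_le _ _).trans (Finset.sum_le_sum fun n _ => ?_))
        exact term_bound b θ hc m n
    _ = X * ((∑ n ∈ ann N, ‖b n‖^2) * ∑ n ∈ ann N, gg c n) := by
        simp only [← Finset.mul_sum, ← Finset.sum_div, Finset.sum_add_distrib, ← Finset.sum_mul]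
        ring
    _ ≤ X * ((∑ n ∈ ann N, ‖b n‖^2) * (tauIdeals c * (18 * N^2))) := by
        have := sum_gg hc N
        have : 0 ≤ ∑ n ∈ ann N, ‖b n‖^2 := Finset.sum_nonneg fun _ _ => sq_nonneg _
        gcongr
    _ = _ := by rw [hX]; ring

end fin
end KW

/-- Weil-bound estimate: `|B(θ,c,N)| ≤ C τ(c)² |c| N² ‖b_N‖₂²`. -/
theorem kloosterman_quadratic_form_weil_bound :
    ∃ C : ℝ, ∀ (b : GaussianInt → ℂ), (∀ m n : GaussianInt, Associated m n → b m = b n) →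
      ∀ θ : ℂ, θ ≠ 0 → ∀ c : GaussianInt, c ≠ 0 → ∀ N : ℝ, 0 < N →
        ‖Bform b θ c N‖ ≤
          C * (tauIdeals c : ℝ) ^ 2 * ‖(c : ℂ)‖ * N ^ 2 * sqNorm b N := by
  refine ⟨144, fun b _ θ _ c hc N _ => ?_⟩
  have := KW.tau_finite hc
  let _ := Fintype.ofFinite {I : Ideal GaussianInt // I ∣ Ideal.span {c}}
  exact KW.main_bound b θ hc N
end

section
/- There is an absolute constant C such that for every function b : O∖{0} → ℂ constant on associate classes, every θ ∈ ℂ∖{0}, every c ∈ O∖{0} and every N > 0, one has |B(θ,c,N)| ≤ C·(|c|² + N² + N·|c|·|θ|·log(2 + N·|θ|))·‖b_N‖₂². -/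
open scoped Real ComplexConjugate
open Complex

def BB {α β : Type*} (s : Finset α) (t : Finset β) (K : α → β → ℂ) (Q : ℝ) : Prop :=
  ∀ (f : α → ℂ) (g : β → ℂ), ‖∑ m ∈ s, ∑ n ∈ t, f m * g n * K m n‖ ≤
    Q * (Real.sqrt (∑ m ∈ s, ‖f m‖ ^ 2) * Real.sqrt (∑ n ∈ t, ‖g n‖ ^ 2))

lemma BB.congr {α β : Type*} {s : Finset α} {t : Finset β} {K K' : α → β → ℂ} {Q : ℝ}
    (h : BB s t K Q) (hK : ∀ m ∈ s, ∀ n ∈ t, K' m n = K m n) : BB s t K' Q := by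
  intro f g
  have : ∑ m ∈ s, ∑ n ∈ t, f m * g n * K' m n = ∑ m ∈ s, ∑ n ∈ t, f m * g n * K m n :=
    Finset.sum_congr rfl fun m hm => Finset.sum_congr rfl fun n hn => by rw [hK m hm n hn]
  rw [this]; exact h f g

lemma BB.unimod {α β : Type*} {s : Finset α} {t : Finset β} {K : α → β → ℂ} {Q : ℝ}
    (h : BB s t K Q) (p : α → ℂ) (q : β → ℂ) (hp : ∀ m, ‖p m‖ = 1) (hq : ∀ n, ‖q n‖ = 1) :
    BB s t (fun m n => p m * q n * K m n) Q := by
  intro f g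
  have := h (fun m => f m * p m) (fun n => g n * q n)
  simp only [norm_mul, hp, hq, mul_one] at this
  refine le_of_eq_of_le ?_ this
  congr 1
  exact Finset.sum_congr rfl fun m _ => Finset.sum_congr rfl fun n _ => by ring

lemma BB.half {α β : Type*} {s : Finset α} {t : Finset β} {K K' : α → β → ℂ} {Q : ℝ}
    (h : BB s t K Q) (h' : BB s t K' Q) : BB s t (fun m n => (K m n + K' m n) / 2) Q := by
  intro f g
  have e : ∑ m ∈ s, ∑ n ∈ t, f m * g n * ((K m n + K' m n) / 2) =
      (∑ m ∈ s, ∑ n ∈ t, f m * g n * K m n + ∑ m ∈ s, ∑ n ∈ t, f m * g n * K' m n) / 2 := by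
    rw [← Finset.sum_add_distrib, Finset.sum_div]
    refine Finset.sum_congr rfl fun m _ => ?_
    rw [← Finset.sum_add_distrib, Finset.sum_div]
    exact Finset.sum_congr rfl fun n _ => by ring
  rw [e, norm_div]
  have h1 := h f g
  have h2 := h' f g
  have h3 := norm_add_le (∑ m ∈ s, ∑ n ∈ t, f m * g n * K m n)
    (∑ m ∈ s, ∑ n ∈ t, f m * g n * K' m n)
  norm_num
  linarith

lemma BB.exp {α β : Type*} {s : Finset α} {t : Finset β} {K : α → β → ℂ} {Q : ℝ} (hQ : 0 ≤ Q)
    (h : BB s t K Q) (u : α → ℂ) (v : β → ℂ) (U V : ℝ) (hU : 0 ≤ U) (hV : 0 ≤ V)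
    (hu : ∀ m ∈ s, ‖u m‖ ≤ U) (hv : ∀ n ∈ t, ‖v n‖ ≤ V) :
    BB s t (fun m n => Complex.exp (u m * v n) * K m n) (Real.exp (U * V) * Q) := by
  intro f g
  set A := Real.sqrt (∑ m ∈ s, ‖f m‖ ^ 2)
  set B := Real.sqrt (∑ n ∈ t, ‖g n‖ ^ 2)
  have hs : HasSum (fun k : ℕ => ∑ m ∈ s, ∑ n ∈ t,
      f m * g n * ((u m * v n) ^ k / (k.factorial : ℂ) * K m n))
      (∑ m ∈ s, ∑ n ∈ t, f m * g n * (Complex.exp (u m * v n) * K m n)) := by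
    refine hasSum_sum fun m _ => hasSum_sum fun n _ => ?_
    refine HasSum.mul_left _ (HasSum.mul_right _ ?_)
    rw [Complex.exp_eq_exp_ℂ]
    exact NormedSpace.expSeries_div_hasSum_exp (u m * v n)
  have hr : HasSum (fun k : ℕ => (U * V) ^ k / (k.factorial : ℝ) * (Q * (A * B)))
      (Real.exp (U * V) * (Q * (A * B))) := by
    refine HasSum.mul_right _ ?_
    rw [Real.exp_eq_exp_ℝ]
    exact NormedSpace.expSeries_div_hasSum_exp (U * V)
  have hb : ∀ k : ℕ, ‖∑ m ∈ s, ∑ n ∈ t,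
      f m * g n * ((u m * v n) ^ k / (k.factorial : ℂ) * K m n)‖ ≤
      (U * V) ^ k / (k.factorial : ℝ) * (Q * (A * B)) := by
    intro k
    have e : ∑ m ∈ s, ∑ n ∈ t, f m * g n * ((u m * v n) ^ k / (k.factorial : ℂ) * K m n) =
        (∑ m ∈ s, ∑ n ∈ t, (f m * u m ^ k) * (g n * v n ^ k) * K m n) / (k.factorial : ℂ) := by
      rw [Finset.sum_div]
      refine Finset.sum_congr rfl fun m _ => ?_
      rw [Finset.sum_div]
      exact Finset.sum_congr rfl fun n _ => by ring
    rw [e, norm_div]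
    have h1 := h (fun m => f m * u m ^ k) (fun n => g n * v n ^ k)
    have hA : Real.sqrt (∑ m ∈ s, ‖f m * u m ^ k‖ ^ 2) ≤ U ^ k * A := by
      have : U ^ k * A = Real.sqrt ((U ^ k) ^ 2 * ∑ m ∈ s, ‖f m‖ ^ 2) := by
        rw [Real.sqrt_mul (by positivity), Real.sqrt_sq (by positivity)]
      rw [this]
      apply Real.sqrt_le_sqrt
      rw [Finset.mul_sum]
      refine Finset.sum_le_sum fun m hm => ?_
      rw [norm_mul, norm_pow, mul_pow, mul_comm]
      have := hu m hm
      gcongr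
    have hB : Real.sqrt (∑ n ∈ t, ‖g n * v n ^ k‖ ^ 2) ≤ V ^ k * B := by
      have : V ^ k * B = Real.sqrt ((V ^ k) ^ 2 * ∑ m ∈ t, ‖g m‖ ^ 2) := by
        rw [Real.sqrt_mul (by positivity), Real.sqrt_sq (by positivity)]
      rw [this]
      apply Real.sqrt_le_sqrt
      rw [Finset.mul_sum]
      refine Finset.sum_le_sum fun m hm => ?_
      rw [norm_mul, norm_pow, mul_pow, mul_comm]
      have := hv m hm
      gcongr
    have h2 : Q * (Real.sqrt (∑ m ∈ s, ‖f m * u m ^ k‖ ^ 2) *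
        Real.sqrt (∑ n ∈ t, ‖g n * v n ^ k‖ ^ 2)) ≤ Q * ((U ^ k * A) * (V ^ k * B)) := by
      gcongr
    have h3 := h1.trans h2
    rw [Complex.norm_natCast]
    calc _ ≤ Q * ((U ^ k * A) * (V ^ k * B)) / (k.factorial : ℝ) := by gcongr
      _ = _ := by rw [mul_pow]; ring
  rw [mul_assoc]
  exact hs.norm_le_of_bounded hr hb

lemma BB.cells {α ι : Type*} [DecidableEq ι] {s : Finset α} {K : α → α → ℂ} {Q : ℝ} (hQ : 0 ≤ Q)
    (φ : α → ι) (I : Finset ι) (hφ : ∀ m ∈ s, φ m ∈ I)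
    (h : ∀ i ∈ I, ∀ j ∈ I, BB (s.filter fun m => φ m = i) (s.filter fun m => φ m = j) K Q) :
    BB s s K (Q * I.card) := by
  intro f g
  have e : ∑ m ∈ s, ∑ n ∈ s, f m * g n * K m n = ∑ i ∈ I, ∑ j ∈ I,
      ∑ m ∈ s.filter (fun m => φ m = i), ∑ n ∈ s.filter (fun m => φ m = j),
        f m * g n * K m n := by
    rw [← Finset.sum_fiberwise_of_maps_to hφ (fun m => ∑ n ∈ s, f m * g n * K m n)]
    refine Finset.sum_congr rfl fun i _ => ?_
    exact Eq.trans (Finset.sum_congr rfl fun m _ =>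
      (Finset.sum_fiberwise_of_maps_to hφ (fun n => f m * g n * K m n)).symm) Finset.sum_comm
  have cs : ∀ f : α → ℂ, ∑ i ∈ I, Real.sqrt (∑ m ∈ s.filter (fun m => φ m = i), ‖f m‖ ^ 2) ≤
      Real.sqrt I.card * Real.sqrt (∑ m ∈ s, ‖f m‖ ^ 2) := by
    intro f
    rw [← Real.sqrt_mul (by positivity)]
    apply Real.le_sqrt_of_sq_le
    refine (sq_sum_le_card_mul_sum_sq).trans ?_
    rw [← Finset.sum_fiberwise_of_maps_to hφ (fun m => ‖f m‖ ^ 2)]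
    gcongr with i _
    rw [Real.sq_sqrt (by positivity)]
  rw [e]
  calc _ ≤ ∑ i ∈ I, ∑ j ∈ I, Q *
        (Real.sqrt (∑ m ∈ s.filter (fun m => φ m = i), ‖f m‖ ^ 2) *
        Real.sqrt (∑ m ∈ s.filter (fun m => φ m = j), ‖g m‖ ^ 2)) := by
        refine (norm_sum_le _ _).trans (Finset.sum_le_sum fun i hi => ?_)
        refine (norm_sum_le _ _).trans (Finset.sum_le_sum fun j hj => ?_)
        exact h i hi j hj f g
    _ = Q * ((∑ i ∈ I, Real.sqrt (∑ m ∈ s.filter (fun m => φ m = i), ‖f m‖ ^ 2)) *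
        (∑ i ∈ I, Real.sqrt (∑ m ∈ s.filter (fun m => φ m = i), ‖g m‖ ^ 2))) := by
        rw [Finset.sum_mul_sum, Finset.mul_sum]
        exact Finset.sum_congr rfl fun i _ => by rw [Finset.mul_sum]
    _ ≤ Q * ((Real.sqrt I.card * Real.sqrt (∑ m ∈ s, ‖f m‖ ^ 2)) *
        (Real.sqrt I.card * Real.sqrt (∑ m ∈ s, ‖g m‖ ^ 2))) := by
        gcongr
        · exact cs f
        · exact cs g
    _ = Q * (Real.sqrt I.card * Real.sqrt I.card) * (Real.sqrt (∑ m ∈ s, ‖f m‖ ^ 2) *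
        Real.sqrt (∑ m ∈ s, ‖g m‖ ^ 2)) := by ring
    _ = _ := by rw [Real.mul_self_sqrt (by positivity)]

lemma gauss_re_im (z : GaussianInt) : (z : ℂ).re = z.re ∧ (z : ℂ).im = z.im := by
  constructor <;> simp

lemma gauss_count (s : Finset GaussianInt) (T : ℝ) (hT : 0 ≤ T)
    (h : ∀ z ∈ s, ‖(z : ℂ)‖ ≤ T) : (s.card : ℝ) ≤ (2 * T + 1) ^ 2 := by
  classical
  set J := Finset.Icc (-⌊T⌋) ⌊T⌋
  have hJ : (J.card : ℝ) ≤ 2 * T + 1 := by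
    have h0 : 0 ≤ ⌊T⌋ := Int.floor_nonneg.2 hT
    have h1 : (J.card : ℤ) = 2 * ⌊T⌋ + 1 := by
      rw [Int.card_Icc, Int.toNat_of_nonneg (by omega)]; ring
    have h2 : (J.card : ℝ) = 2 * (⌊T⌋ : ℝ) + 1 := by exact_mod_cast h1
    rw [h2]
    linarith [Int.floor_le T]
  have hle : s.card ≤ (J ×ˢ J).card := by
    apply Finset.card_le_card_of_injOn (fun z => (z.re, z.im))
    · intro z hz
      have h1 := h z hz
      have h2 := (Complex.abs_re_le_norm (z : ℂ)).trans h1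
      have h3 := (Complex.abs_im_le_norm (z : ℂ)).trans h1
      rw [(gauss_re_im z).1, abs_le] at h2
      rw [(gauss_re_im z).2, abs_le] at h3
      simp only [J, Finset.coe_product, Set.mem_prod, Finset.coe_Icc, Set.mem_Icc]
      refine ⟨⟨?_, Int.le_floor.2 h2.2⟩, ⟨?_, Int.le_floor.2 h3.2⟩⟩
      · have : -z.re ≤ ⌊T⌋ := Int.le_floor.2 (by push_cast; linarith)
        omega
      · have : -z.im ≤ ⌊T⌋ := Int.le_floor.2 (by push_cast; linarith)
        omega
    · intro z _ w _ hzw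
      simp only [Prod.mk.injEq] at hzw
      exact Zsqrtd.ext hzw.1 hzw.2
  rw [Finset.card_product] at hle
  have : (s.card : ℝ) ≤ J.card * J.card := by exact_mod_cast hle
  calc _ ≤ _ := this
    _ ≤ (2 * T + 1) * (2 * T + 1) := by gcongr
    _ = _ := by ring

lemma gauss_finite (T : ℝ) : {z : GaussianInt | ‖(z : ℂ)‖ ≤ T}.Finite := by
  by_contra hinf
  have hinf : {z : GaussianInt | ‖(z : ℂ)‖ ≤ T}.Infinite := hinf
  obtain ⟨s, hs, hc⟩ := hinf.exists_subset_card_eq (⌊(2 * |T| + 1) ^ 2⌋₊ + 1)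
  have := gauss_count s |T| (abs_nonneg _) (fun z hz => (hs hz).trans (le_abs_self T))
  rw [hc] at this
  push_cast at this
  linarith [Nat.lt_floor_add_one ((2 * |T| + 1) ^ 2)]

abbrev RR (c : GaussianInt) := GaussianInt ⧸ Ideal.span {c}

lemma rep_exists (c : GaussianInt) (hc : c ≠ 0) (q : RR c) :
    ∃ z : GaussianInt, Ideal.Quotient.mk (Ideal.span {c}) z = q ∧ ‖(z : ℂ)‖ ≤ ‖(c : ℂ)‖ := by
  obtain ⟨a, rfl⟩ := Ideal.Quotient.mk_surjective q
  refine ⟨a % c, ?_, ?_⟩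
  · rw [Ideal.Quotient.eq, Ideal.mem_span_singleton]
    refine ⟨-(a / c), ?_⟩
    have := EuclideanDomain.mod_add_div a c
    linear_combination this
  · have h1 : (GaussianInt.toComplex (a % c)).normSq ≤ (GaussianInt.toComplex c).normSq := by
      have := GaussianInt.norm_mod_lt a hc
      rw [← GaussianInt.intCast_real_norm, ← GaussianInt.intCast_real_norm]
      exact_mod_cast this.le
    rw [Complex.normSq_eq_norm_sq, Complex.normSq_eq_norm_sq] at h1
    exact le_of_sq_le_sq h1 (norm_nonneg _)

lemma RR_finite (c : GaussianInt) (hc : c ≠ 0) : Finite (RR c) := by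
  choose r hr hn using rep_exists c hc
  have : Function.Injective r := fun a b hab => by rw [← hr a, ← hr b, hab]
  have hf := (gauss_finite ‖(c : ℂ)‖).to_subtype
  exact Finite.of_injective (fun q => (⟨r q, hn q⟩ : {z : GaussianInt | ‖(z : ℂ)‖ ≤ ‖(c : ℂ)‖}))
    (fun a b hab => this (congrArg Subtype.val hab))

lemma one_le_norm (c : GaussianInt) (hc : c ≠ 0) : 1 ≤ ‖(c : ℂ)‖ := by
  have h := GaussianInt.norm_pos.2 hc
  have h1 : (1 : ℝ) ≤ (GaussianInt.toComplex c).normSq := by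
    rw [← GaussianInt.intCast_real_norm]; exact_mod_cast h
  rw [Complex.normSq_eq_norm_sq] at h1
  nlinarith [norm_nonneg (c : ℂ)]

lemma RR_card (c : GaussianInt) (hc : c ≠ 0) [Fintype (RR c)] :
    (Fintype.card (RR c) : ℝ) ≤ 9 * ‖(c : ℂ)‖ ^ 2 := by
  classical
  choose r hr hn using rep_exists c hc
  have hinj : Function.Injective r := fun a b hab => by rw [← hr a, ← hr b, hab]
  have := gauss_count (Finset.univ.image r) ‖(c : ℂ)‖ (norm_nonneg _) (by
    intro z hz
    obtain ⟨q, _, rfl⟩ := Finset.mem_image.1 hz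
    exact hn q)
  rw [Finset.card_image_of_injective _ hinj, Finset.card_univ] at this
  have h1 := one_le_norm c hc
  nlinarith

lemma efn_add (z w : ℂ) : efn (z + w) = efn z * efn w := by
  simp only [efn, ← Complex.exp_add, Complex.add_re]
  push_cast; congr 1; ring

lemma efn_norm (z : ℂ) : ‖efn z‖ = 1 := by
  have : (2 * Real.pi * Complex.I * z.re : ℂ) = ((2 * Real.pi * z.re : ℝ) : ℂ) * Complex.I := by
    push_cast; ring
  rw [efn, this, Complex.norm_exp_ofReal_mul_I]

lemma efn_eq_one (z : ℂ) : efn z = 1 ↔ ∃ n : ℤ, z.re = n := by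
  rw [efn, Complex.exp_eq_one_iff]
  refine exists_congr fun n => ?_
  have hpi : (Real.pi : ℂ) ≠ 0 := by exact_mod_cast Real.pi_ne_zero
  constructor
  · intro h
    have h2 : (2 * Real.pi * Complex.I : ℂ) * z.re = (2 * Real.pi * Complex.I) * n := by
      rw [h]; ring
    have := mul_left_cancel₀ Complex.two_pi_I_ne_zero h2
    exact_mod_cast this
  · intro h
    rw [h]; push_cast; ring

lemma efn_gauss (z : GaussianInt) : efn z = 1 :=
  (efn_eq_one _).2 ⟨z.re, (gauss_re_im z).1⟩

/-- the additive character. -/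
noncomputable def EE (c : GaussianInt) (q : RR c) (m : GaussianInt) : ℂ :=
  efn (((Quotient.out q * m : GaussianInt) : ℂ) / (c : ℂ))

lemma EE_eq (c : GaussianInt) (hc : c ≠ 0) (q : RR c) (a m : GaussianInt)
    (h : Ideal.Quotient.mk (Ideal.span {c}) a = q) :
    EE c q m = efn (((a * m : GaussianInt) : ℂ) / (c : ℂ)) := by
  have h1 : Ideal.Quotient.mk (Ideal.span {c}) (Quotient.out q) = q := Quotient.out_eq q
  have h2 := h1.trans h.symm
  rw [Ideal.Quotient.eq, Ideal.mem_span_singleton] at h2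
  obtain ⟨k, hk⟩ := h2
  have hc' : (c : ℂ) ≠ 0 := by simpa using hc
  have : (((Quotient.out q * m : GaussianInt) : ℂ) / (c : ℂ)) =
      ((a * m : GaussianInt) : ℂ) / (c : ℂ) + ((k * m : GaussianInt) : ℂ) := by
    have e : Quotient.out q = a + c * k := by linear_combination hk
    rw [e]
    simp only [map_mul, map_add]
    field_simp
  rw [EE, this, efn_add, efn_gauss, mul_one]

lemma EE_add_left (c : GaussianInt) (hc : c ≠ 0) (q q' : RR c) (m : GaussianInt) :
    EE c (q + q') m = EE c q m * EE c q' m := by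
  obtain ⟨a, rfl⟩ := Ideal.Quotient.mk_surjective q
  obtain ⟨a', rfl⟩ := Ideal.Quotient.mk_surjective q'
  rw [EE_eq c hc _ a m rfl, EE_eq c hc _ a' m rfl, EE_eq c hc _ (a + a') m (map_add _ _ _),
    ← efn_add, add_mul]
  congr 1
  simp only [map_add]
  ring

lemma EE_conj (c : GaussianInt) (q : RR c) (m m' : GaussianInt) :
    EE c q m * conj (EE c q m') = EE c q (m - m') := by
  have h : EE c q (m - m') * EE c q m' = EE c q m := by
    rw [EE, EE, EE, ← efn_add]
    congr 1
    simp only [map_mul, map_sub]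
    ring
  rw [← h, mul_assoc, Complex.mul_conj, Complex.normSq_eq_norm_sq, EE, EE, efn_norm]
  simp

lemma EE_sum (c : GaussianInt) (hc : c ≠ 0) [Fintype (RR c)] (k : GaussianInt) (hk : ¬ c ∣ k) :
    ∑ q : RR c, EE c q k = 0 := by
  have hc' : (c : ℂ) ≠ 0 := by simpa using hc
  have key : ∃ q0 : RR c, EE c q0 k ≠ 1 := by
    by_contra! hall
    apply hk
    have h1 := hall (Ideal.Quotient.mk _ 1)
    have h2 := hall (Ideal.Quotient.mk _ ⟨0, 1⟩)
    rw [EE_eq c hc _ _ k rfl, efn_eq_one] at h1 h2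
    obtain ⟨x, hx⟩ := h1
    obtain ⟨y, hy⟩ := h2
    refine ⟨⟨x, -y⟩, ?_⟩
    apply GaussianInt.toComplex_injective
    have hI : GaussianInt.toComplex ⟨0, 1⟩ = Complex.I := by
      rw [GaussianInt.toComplex_def]; simp
    rw [one_mul] at hx
    rw [map_mul, hI, mul_div_assoc] at hy
    have : (k : ℂ) / c = GaussianInt.toComplex ⟨x, -y⟩ := by
      apply Complex.ext
      · rw [hx, (gauss_re_im _).1]
      · rw [(gauss_re_im _).2]
        simp only [Complex.mul_re, Complex.I_re, Complex.I_im] at hy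
        push_cast
        linarith
    rw [map_mul, ← this]
    field_simp
  obtain ⟨q0, h0⟩ := key
  have hS : ∑ q : RR c, EE c q k = EE c q0 k * ∑ q : RR c, EE c q k := by
    conv_lhs => rw [← Equiv.sum_comp (Equiv.addLeft q0)]
    rw [Finset.mul_sum]
    exact Finset.sum_congr rfl fun q _ => EE_add_left c hc q0 q k
  have h3 : (EE c q0 k - 1) * ∑ q : RR c, EE c q k = 0 := by linear_combination -hS
  exact (mul_eq_zero.1 h3).resolve_left (sub_ne_zero.2 h0)

lemma large_sieve (c : GaussianInt) (hc : c ≠ 0) [Fintype (RR c)] (s : Finset GaussianInt) (r : ℝ)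
    (hr : 0 ≤ r) (hs : ∀ m ∈ s, ∀ m' ∈ s, ‖(m : ℂ) - (m' : ℂ)‖ ≤ r) (f : GaussianInt → ℂ) :
    ∑ q : RR c, ‖∑ m ∈ s, f m * EE c q m‖ ^ 2 ≤
      9 * (2 * r + ‖(c : ℂ)‖) ^ 2 * ∑ m ∈ s, ‖f m‖ ^ 2 := by
  classical
  have hc' : (c : ℂ) ≠ 0 := by simpa using hc
  have hcp := one_le_norm c hc
  have hcpos : 0 < ‖(c : ℂ)‖ := by linarith
  have e1 : ((∑ q : RR c, ‖∑ m ∈ s, f m * EE c q m‖ ^ 2 : ℝ) : ℂ) =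
      ∑ m ∈ s, ∑ m' ∈ s, f m * conj (f m') * ∑ q : RR c, EE c q (m - m') := by
    push_cast
    have : ∀ q : RR c, ((‖∑ m ∈ s, f m * EE c q m‖ : ℂ)) ^ 2 =
        ∑ m ∈ s, ∑ m' ∈ s, f m * conj (f m') * EE c q (m - m') := by
      intro q
      rw [← Complex.mul_conj', map_sum, Finset.sum_mul_sum]
      refine Finset.sum_congr rfl fun m _ => Finset.sum_congr rfl fun m' _ => ?_
      rw [← EE_conj, map_mul]; ring
    rw [Finset.sum_congr rfl fun q _ => this q, Finset.sum_comm]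
    refine Finset.sum_congr rfl fun m _ => ?_
    rw [Finset.sum_comm]
    refine Finset.sum_congr rfl fun m' _ => ?_
    rw [Finset.mul_sum]
  set R : ℝ := (Fintype.card (RR c) : ℝ)
  have hR0 : 0 ≤ R := Nat.cast_nonneg _
  have hR : R ≤ 9 * ‖(c : ℂ)‖ ^ 2 := RR_card c hc
  have hterm : ∀ m m' : GaussianInt, ‖f m * conj (f m') * ∑ q : RR c, EE c q (m - m')‖ ≤
      if c ∣ m - m' then R * ((‖f m‖ ^ 2 + ‖f m'‖ ^ 2) / 2) else 0 := by
    intro m m'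
    split_ifs with hd
    · rw [norm_mul, norm_mul, RCLike.norm_conj]
      have h1 : ‖∑ q : RR c, EE c q (m - m')‖ ≤ R := by
        refine (norm_sum_le _ _).trans ?_
        simp [EE, efn_norm, R]
      have h2 : ‖f m‖ * ‖f m'‖ ≤ (‖f m‖ ^ 2 + ‖f m'‖ ^ 2) / 2 := by
        nlinarith [sq_nonneg (‖f m‖ - ‖f m'‖)]
      rw [mul_comm R]
      gcongr
    · rw [EE_sum c hc _ hd]; simp
  have hcount : ∀ m ∈ s, ((s.filter fun m' => c ∣ m - m').card : ℝ) ≤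
      (2 * (r / ‖(c : ℂ)‖) + 1) ^ 2 := by
    intro m hm
    set t := s.filter fun m' => c ∣ m - m'
    have hk : ∀ m' : GaussianInt, ∃ k : GaussianInt, m' ∈ t → m - m' = c * k := by
      intro m'
      by_cases h : m' ∈ t
      · obtain ⟨k, hk⟩ := (Finset.mem_filter.1 h).2
        exact ⟨k, fun _ => hk⟩
      · exact ⟨0, fun h' => absurd h' h⟩
    choose k hk using hk
    have hinj : Set.InjOn k t := by
      intro a ha b hb hab
      have h1 := hk a ha
      have h2 := hk b hb
      rw [hab] at h1
      linear_combination h2 - h1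
    rw [← Finset.card_image_of_injOn hinj]
    apply gauss_count _ _ (by positivity)
    intro z hz
    obtain ⟨m', hm', rfl⟩ := Finset.mem_image.1 hz
    rw [le_div_iff₀ hcpos, ← norm_mul, mul_comm, ← map_mul, ← hk m' hm', map_sub]
    exact hs m hm m' (Finset.mem_filter.1 hm').1
  have e2 : ∑ q : RR c, ‖∑ m ∈ s, f m * EE c q m‖ ^ 2 ≤
      ∑ m ∈ s, ∑ m' ∈ s, if c ∣ m - m' then R * ((‖f m‖ ^ 2 + ‖f m'‖ ^ 2) / 2) else 0 := by
    have h0 : ∑ q : RR c, ‖∑ m ∈ s, f m * EE c q m‖ ^ 2 =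
        ‖((∑ q : RR c, ‖∑ m ∈ s, f m * EE c q m‖ ^ 2 : ℝ) : ℂ)‖ := by
      rw [Complex.norm_real, Real.norm_of_nonneg (by positivity)]
    rw [h0, e1]
    refine (norm_sum_le _ _).trans (Finset.sum_le_sum fun m _ => ?_)
    exact (norm_sum_le _ _).trans (Finset.sum_le_sum fun m' _ => hterm m m')
  have e3 : ∑ m ∈ s, ∑ m' ∈ s,
      (if c ∣ m - m' then R * ((‖f m‖ ^ 2 + ‖f m'‖ ^ 2) / 2) else 0) =
      ∑ m ∈ s, ∑ m' ∈ s, (if c ∣ m - m' then R * ‖f m‖ ^ 2 else 0) := by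
    have a1 : ∑ m ∈ s, ∑ m' ∈ s, (if c ∣ m - m' then R * ‖f m'‖ ^ 2 else 0) =
      ∑ m ∈ s, ∑ m' ∈ s, (if c ∣ m - m' then R * ‖f m‖ ^ 2 else 0) := by
      rw [Finset.sum_comm]
      refine Finset.sum_congr rfl fun m _ => Finset.sum_congr rfl fun m' _ => ?_
      rw [dvd_sub_comm]
    have a2 : ∑ m ∈ s, ∑ m' ∈ s,
      (if c ∣ m - m' then R * ((‖f m‖ ^ 2 + ‖f m'‖ ^ 2) / 2) else 0) =
      (∑ m ∈ s, ∑ m' ∈ s, (if c ∣ m - m' then R * ‖f m‖ ^ 2 else 0) +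
      ∑ m ∈ s, ∑ m' ∈ s, (if c ∣ m - m' then R * ‖f m'‖ ^ 2 else 0)) / 2 := by
      rw [← Finset.sum_add_distrib, Finset.sum_div]
      refine Finset.sum_congr rfl fun m _ => ?_
      rw [← Finset.sum_add_distrib, Finset.sum_div]
      refine Finset.sum_congr rfl fun m' _ => ?_
      split_ifs <;> ring
    rw [a2, a1]; ring
  rw [e3] at e2
  refine e2.trans ?_
  rw [Finset.mul_sum]
  refine Finset.sum_le_sum fun m hm => ?_
  rw [← Finset.sum_filter, Finset.sum_const, nsmul_eq_mul]
  have h1 := hcount m hm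
  calc _ ≤ (2 * (r / ‖(c : ℂ)‖) + 1) ^ 2 * (9 * ‖(c : ℂ)‖ ^ 2 * ‖f m‖ ^ 2) := by gcongr
    _ = _ := by field_simp

lemma kloosterman_BB (c : GaussianInt) (hc : c ≠ 0) (s t : Finset GaussianInt) (r : ℝ)
    (hr : 0 ≤ r) (hs : ∀ m ∈ s, ∀ m' ∈ s, ‖(m : ℂ) - (m' : ℂ)‖ ≤ r)
    (ht : ∀ m ∈ t, ∀ m' ∈ t, ‖(m : ℂ) - (m' : ℂ)‖ ≤ r) :
    BB s t (fun m n => kloosterman m n c) (9 * (2 * r + ‖(c : ℂ)‖) ^ 2) := by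
  classical
  have := RR_finite c hc
  have := Fintype.ofFinite (RR c)
  intro f g
  have hK : ∀ m n, kloosterman m n c = ∑ u : (RR c)ˣ, EE c u m * EE c (u⁻¹ : (RR c)ˣ) n := by
    intro m n
    rw [kloosterman, finsum_eq_sum_of_fintype]
    refine Finset.sum_congr rfl fun u _ => ?_
    rw [EE, EE, ← efn_add]
    congr 1
    simp only [map_add, map_mul]
    ring
  have e : ∑ m ∈ s, ∑ n ∈ t, f m * g n * kloosterman m n c =
      ∑ u : (RR c)ˣ, (∑ m ∈ s, f m * EE c u m) * (∑ n ∈ t, g n * EE c (u⁻¹ : (RR c)ˣ) n) := by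
    simp_rw [hK, Finset.sum_mul_sum]
    rw [Finset.sum_comm]
    rw [Finset.sum_comm (s := Finset.univ)]
    rw [Finset.sum_comm]
    refine Finset.sum_congr rfl fun m _ => ?_
    rw [Finset.sum_comm (s := Finset.univ)]
    refine Finset.sum_congr rfl fun n _ => ?_
    rw [Finset.mul_sum]
    exact Finset.sum_congr rfl fun u _ => by ring
  have hunit : ∀ F : RR c → ℝ, (∀ q, 0 ≤ F q) → ∑ u : (RR c)ˣ, F u ≤ ∑ q : RR c, F q := by
    intro F hF
    rw [← Finset.sum_image (s := Finset.univ) (g := fun u : (RR c)ˣ => (u : RR c)) (f := F)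
      (fun a _ b _ h => Units.ext h)]
    exact Finset.sum_le_sum_of_subset_of_nonneg (Finset.subset_univ _) fun q _ _ => hF q
  have hF := (hunit (fun q => ‖∑ m ∈ s, f m * EE c q m‖ ^ 2) (fun _ => by positivity)).trans
    (large_sieve c hc s r hr hs f)
  have hG : ∑ u : (RR c)ˣ, ‖∑ n ∈ t, g n * EE c (u⁻¹ : (RR c)ˣ) n‖ ^ 2 ≤
      9 * (2 * r + ‖(c : ℂ)‖) ^ 2 * ∑ n ∈ t, ‖g n‖ ^ 2 := by
    refine (Equiv.sum_comp (Equiv.inv (RR c)ˣ)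
      (fun u => ‖∑ n ∈ t, g n * EE c u n‖ ^ 2)).trans_le ?_
    exact (hunit (fun q => ‖∑ n ∈ t, g n * EE c q n‖ ^ 2) (fun _ => by positivity)).trans
      (large_sieve c hc t r hr ht g)
  set Q := 9 * (2 * r + ‖(c : ℂ)‖) ^ 2
  have hQ : 0 ≤ Q := by positivity
  rw [e]
  calc _ ≤ ∑ u : (RR c)ˣ, ‖∑ m ∈ s, f m * EE c u m‖ *
        ‖∑ n ∈ t, g n * EE c (u⁻¹ : (RR c)ˣ) n‖ := by
        refine (norm_sum_le _ _).trans (Finset.sum_le_sum fun u _ => ?_)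
        rw [norm_mul]
    _ ≤ Real.sqrt (∑ u : (RR c)ˣ, ‖∑ m ∈ s, f m * EE c u m‖ ^ 2) *
        Real.sqrt (∑ u : (RR c)ˣ, ‖∑ n ∈ t, g n * EE c (u⁻¹ : (RR c)ˣ) n‖ ^ 2) :=
        Real.sum_mul_le_sqrt_mul_sqrt _ _ _
    _ ≤ Real.sqrt (Q * ∑ m ∈ s, ‖f m‖ ^ 2) * Real.sqrt (Q * ∑ n ∈ t, ‖g n‖ ^ 2) := by
        gcongr
    _ = (Real.sqrt Q * Real.sqrt Q) * (Real.sqrt (∑ m ∈ s, ‖f m‖ ^ 2) *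
        Real.sqrt (∑ n ∈ t, ‖g n‖ ^ 2)) := by
        rw [Real.sqrt_mul hQ, Real.sqrt_mul hQ]; ring
    _ = _ := by rw [Real.mul_self_sqrt hQ]

lemma cell_BB (c : GaussianInt) (hc : c ≠ 0) (θ : ℂ) (N X ρ : ℝ) (hN : 0 < N) (hX : 1 ≤ X)
    (hXθ : N * ‖θ‖ ≤ X * ‖(c : ℂ)‖) (hρ : 0 ≤ ρ) (hρX : ρ ^ 2 * X = N)
    (x : GaussianInt → ℂ) (s t : Finset GaussianInt) (x0 y0 : ℂ)
    (hx : ∀ m, x m * x m = m)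
    (hs : ∀ m ∈ s, ‖x m - x0‖ ≤ 2 * ρ) (ht : ∀ m ∈ t, ‖x m - y0‖ ≤ 2 * ρ)
    (hs' : ∀ m ∈ s, ‖x m‖ ≤ 2 * Real.sqrt N) (ht' : ∀ m ∈ t, ‖x m‖ ≤ 2 * Real.sqrt N)
    (σ : ℝ) (hσ : |σ| = 1) :
    BB s t (fun m n => Complex.exp (((4 * Real.pi * σ * (x m * x n * θ / (c : ℂ)).re : ℝ) : ℂ) *
      Complex.I) * kloosterman m n c)
      (Real.exp (8 * Real.pi) * (Real.exp (8 * Real.pi) *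
        (9 * (2 * (16 * ρ * Real.sqrt N) + ‖(c : ℂ)‖) ^ 2))) := by
  have hcp : 0 < ‖(c : ℂ)‖ := by linarith [one_le_norm c hc]
  have diam : ∀ (s : Finset GaussianInt) (x0 : ℂ), (∀ m ∈ s, ‖x m - x0‖ ≤ 2 * ρ) →
      (∀ m ∈ s, ‖x m‖ ≤ 2 * Real.sqrt N) →
      ∀ m ∈ s, ∀ m' ∈ s, ‖(m : ℂ) - (m' : ℂ)‖ ≤ 16 * ρ * Real.sqrt N := by
    intro s x0 h1 h2 m hm m' hm'
    have e : (m : ℂ) - (m' : ℂ) = (x m - x m') * (x m + x m') := by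
      rw [← hx m, ← hx m']; ring
    rw [e, norm_mul]
    have a1 : ‖x m - x m'‖ ≤ 4 * ρ := by
      have : x m - x m' = (x m - x0) - (x m' - x0) := by ring
      rw [this]
      linarith [norm_sub_le (x m - x0) (x m' - x0), h1 m hm, h1 m' hm']
    have a2 : ‖x m + x m'‖ ≤ 4 * Real.sqrt N := by
      linarith [norm_add_le (x m) (x m'), h2 m hm, h2 m' hm']
    calc _ ≤ (4 * ρ) * (4 * Real.sqrt N) := by gcongr
      _ = _ := by ring
  have h0 := kloosterman_BB c hc s t (16 * ρ * Real.sqrt N) (by positivity)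
    (diam s x0 hs hs') (diam t y0 ht ht')
  set Q := 9 * (2 * (16 * ρ * Real.sqrt N) + ‖(c : ℂ)‖) ^ 2
  have hQ : 0 ≤ Q := by positivity
  set V : ℝ := 2 * Real.pi * (2 * ρ) * (‖θ‖ / ‖(c : ℂ)‖)
  have hV : 0 ≤ V := by positivity
  have hUV : 2 * ρ * V ≤ 8 * Real.pi := by
    have h1 : ρ ^ 2 * (‖θ‖ / ‖(c : ℂ)‖) ≤ 1 := by
      rw [← mul_div_assoc, div_le_one hcp]
      have : X * (ρ ^ 2 * ‖θ‖) ≤ X * ‖(c : ℂ)‖ := by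
        calc _ = (ρ ^ 2 * X) * ‖θ‖ := by ring
          _ ≤ _ := by rw [hρX]; exact hXθ
      exact le_of_mul_le_mul_left this (by linarith)
    calc 2 * ρ * V = 8 * Real.pi * (ρ ^ 2 * (‖θ‖ / ‖(c : ℂ)‖)) := by simp only [V]; ring
      _ ≤ 8 * Real.pi * 1 := by gcongr
      _ = _ := by ring
  have hσn : ‖(σ : ℂ)‖ = 1 := by rw [Complex.norm_real]; exact hσ
  have hpin : ‖(Real.pi : ℂ)‖ = Real.pi := by
    rw [Complex.norm_real, Real.norm_of_nonneg Real.pi_pos.le]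
  have mono : ∀ {K : GaussianInt → GaussianInt → ℂ} {Q Q' : ℝ}, BB s t K Q → Q ≤ Q' →
      BB s t K Q' := by
    intro K Q Q' h hq f g
    refine (h f g).trans ?_
    gcongr
  set E := Real.exp (8 * Real.pi)
  have h1 : BB s t (fun m n => Complex.exp ((x m - x0) *
      (2 * Real.pi * σ * Complex.I * ((x n - y0) * (θ / (c : ℂ))))) * kloosterman m n c)
      (E * Q) := by
    refine mono (BB.exp hQ h0 (fun m => x m - x0)
      (fun n => 2 * Real.pi * σ * Complex.I * ((x n - y0) * (θ / (c : ℂ)))) (2 * ρ) V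
      (by positivity) hV hs ?_) (mul_le_mul_of_nonneg_right (Real.exp_le_exp.2 hUV) hQ)
    intro n hn
    simp only [norm_mul, hσn, hpin, norm_div, Complex.norm_I, Complex.norm_ofNat, mul_one, V]
    rw [mul_assoc (2 * Real.pi) (2 * ρ)]
    have := ht n hn
    gcongr
  have h2 := mono (BB.exp (by positivity) h1 (fun m => conj (x m - x0))
      (fun n => 2 * Real.pi * σ * Complex.I * conj ((x n - y0) * (θ / (c : ℂ)))) (2 * ρ) V
      (by positivity) hV (fun m hm => by rw [RCLike.norm_conj]; exact hs m hm) (by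
        intro n hn
        simp only [norm_mul, hσn, hpin, norm_div, Complex.norm_I, Complex.norm_ofNat, mul_one, V,
          RCLike.norm_conj]
        rw [mul_assoc (2 * Real.pi) (2 * ρ)]
        have := ht n hn
        gcongr)) (mul_le_mul_of_nonneg_right (Real.exp_le_exp.2 hUV) (by positivity))
  have h3 := BB.unimod h2
    (fun m => Complex.exp (((4 * Real.pi * σ * ((x m - x0) * y0 * θ / (c : ℂ)).re : ℝ) : ℂ) *
      Complex.I))
    (fun n => Complex.exp (((4 * Real.pi * σ * (x0 * x n * θ / (c : ℂ)).re : ℝ) : ℂ) *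
      Complex.I)) (fun m => Complex.norm_exp_ofReal_mul_I _)
      (fun m => Complex.norm_exp_ofReal_mul_I _)
  refine h3.congr fun m _ n _ => ?_
  rw [← mul_assoc, ← mul_assoc, ← Complex.exp_add, ← Complex.exp_add, ← Complex.exp_add]
  congr 2
  set w := (x m - x0) * ((x n - y0) * (θ / (c : ℂ))) with hw
  have e1 : (x m * x n * θ / (c : ℂ)).re = ((x m - x0) * y0 * θ / (c : ℂ)).re +
      (x0 * x n * θ / (c : ℂ)).re + w.re := by
    rw [← Complex.add_re, ← Complex.add_re, hw]
    congr 1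
    ring
  have e2 : (conj (x m - x0)) *
      (2 * Real.pi * σ * Complex.I * conj ((x n - y0) * (θ / (c : ℂ)))) +
      (x m - x0) * (2 * Real.pi * σ * Complex.I * ((x n - y0) * (θ / (c : ℂ)))) =
      ((4 * Real.pi * σ * w.re : ℝ) : ℂ) * Complex.I := by
    have e3 : w + conj w = ((2 * w.re : ℝ) : ℂ) := Complex.add_conj w
    have e4 : conj w = conj (x m - x0) * conj ((x n - y0) * (θ / (c : ℂ))) := by
      rw [hw, map_mul]
    rw [e4] at e3
    push_cast at e3 ⊢
    rw [hw] at e3 ⊢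
    linear_combination (2 * Real.pi * σ * Complex.I) * e3
  rw [add_assoc _ (_ * _) (_ * _), e2, e1]
  push_cast
  ring

lemma sq_cpow_half (z : ℂ) : z ^ ((1 : ℂ) / 2) * z ^ ((1 : ℂ) / 2) = z := by
  have := Complex.cpow_nat_inv_pow z (n := 2) (by norm_num)
  rw [← sq]
  simpa using this

/-- Large-sieve estimate:
`|B(θ,c,N)| ≤ C (|c|² + N² + N|c||θ| log(2 + N|θ|)) ‖b_N‖₂²`. -/
theorem kloosterman_quadratic_form_second_bound :
    ∃ C : ℝ, ∀ (b : GaussianInt → ℂ), (∀ m n : GaussianInt, Associated m n → b m = b n) →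
      ∀ θ : ℂ, θ ≠ 0 → ∀ c : GaussianInt, c ≠ 0 → ∀ N : ℝ, 0 < N →
        ‖Bform b θ c N‖ ≤
          C * (‖(c : ℂ)‖ ^ 2 + N ^ 2 +
              N * ‖(c : ℂ)‖ * ‖θ‖ * Real.log (2 + N * ‖θ‖)) *
            sqNorm b N := by
  classical
  set E := Real.exp (8 * Real.pi) with hE
  refine ⟨E * E * (36 * 18 * 1024), fun b _ θ _ c hc N hN => ?_⟩
  have hcp : 0 < ‖(c : ℂ)‖ := by linarith [one_le_norm c hc]
  set X : ℝ := 1 + N * ‖θ‖ / ‖(c : ℂ)‖ with hXdef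
  have hX : 1 ≤ X := by
    have : 0 ≤ N * ‖θ‖ / ‖(c : ℂ)‖ := by positivity
    linarith
  have hXpos : 0 < X := by linarith
  have hXc : X * ‖(c : ℂ)‖ = ‖(c : ℂ)‖ + N * ‖θ‖ := by rw [hXdef]; field_simp
  set ρ := Real.sqrt N / Real.sqrt X with hρdef
  have hsX : 1 ≤ Real.sqrt X := Real.one_le_sqrt.2 hX
  have hρ : 0 < ρ := by have := Real.sqrt_pos.2 hN; positivity
  have hρX : ρ ^ 2 * X = N := by
    rw [hρdef, div_pow, Real.sq_sqrt hN.le, Real.sq_sqrt hXpos.le]; field_simp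
  have hfin : {n : GaussianInt | InAnn N n}.Finite :=
    (gauss_finite (Real.sqrt 2 * N)).subset fun n hn => hn.2.2
  set S := hfin.toFinset with hS
  have hmem : ∀ m, m ∈ S ↔ InAnn N m := fun m => by simp [hS]
  have hnorm : sqNorm b N = ∑ n ∈ S, ‖b n‖ ^ 2 := by
    rw [sqNorm, finsum_mem_eq_finite_toFinset_sum _ hfin]
  set x : GaussianInt → ℂ := fun m => (m : ℂ) ^ ((1 : ℂ) / 2) with hxdef
  have hx : ∀ m, x m * x m = m := fun m => sq_cpow_half _
  have hB : Bform b θ c N = ∑ m ∈ S, ∑ n ∈ S, b m * conj (b n) *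
      ((Complex.exp (((4 * Real.pi * 1 * (x m * x n * θ / (c : ℂ)).re : ℝ) : ℂ) *
      Complex.I) * kloosterman m n c + Complex.exp
      (((4 * Real.pi * (-1) * (x m * x n * θ / (c : ℂ)).re : ℝ) : ℂ) *
      Complex.I) * kloosterman m n c) / 2) := by
    rw [Bform, finsum_mem_eq_finite_toFinset_sum _ hfin]
    refine Finset.sum_congr rfl fun m hm => ?_
    rw [finsum_mem_eq_finite_toFinset_sum _ hfin]
    refine Finset.sum_congr rfl fun n hn => ?_
    have hm' := (hmem m).1 hm
    have hn' := (hmem n).1 hn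
    have e : ((m : ℂ) * (n : ℂ)) ^ ((1 : ℂ) / 2) = x m * x n := by
      have hm0 : (m : ℂ) ≠ 0 := by simpa using hm'.1.1
      have hn0 : (n : ℂ) ≠ 0 := by simpa using hn'.1.1
      have hlog : Complex.log ((m : ℂ) * (n : ℂ)) = Complex.log m + Complex.log n := by
        apply Complex.log_mul hm0 hn0
        constructor <;>
        linarith [hm'.1.2.1, hm'.1.2.2, hn'.1.2.1, hn'.1.2.2, Real.pi_pos]
      simp only [hxdef]
      rw [Complex.cpow_def_of_ne_zero (mul_ne_zero hm0 hn0), Complex.cpow_def_of_ne_zero hm0,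
        Complex.cpow_def_of_ne_zero hn0, hlog, ← Complex.exp_add, add_mul]
    rw [e, Complex.ofReal_cos, Complex.cos]
    rw [show (((4 * Real.pi * (-1) * (x m * x n * θ / (c : ℂ)).re : ℝ) : ℂ) * Complex.I) =
      -((4 * Real.pi * ((x m * x n * θ / (c : ℂ)).re) : ℝ) : ℂ) * Complex.I by push_cast; ring]
    rw [mul_one]
    ring
  have hxn : ∀ m ∈ S, ‖x m‖ ≤ 2 * Real.sqrt N := by
    intro m hm
    have h1 := ((hmem m).1 hm).2.2
    rw [← hx m, norm_mul] at h1
    have h2 : Real.sqrt 2 ≤ 2 := by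
      rw [Real.sqrt_le_left (by norm_num)]; norm_num
    have h3 := Real.sq_sqrt hN.le
    apply le_of_sq_le_sq _ (by positivity)
    nlinarith
  set φ : GaussianInt → ℤ × ℤ := fun m => (⌊(x m).re / ρ⌋, ⌊(x m).im / ρ⌋) with hφdef
  set L : ℤ := ⌊2 * Real.sqrt X⌋ with hL
  set J := Finset.Icc (-L - 1) L with hJ
  have hL0 : 0 ≤ L := Int.floor_nonneg.2 (by positivity)
  have hrange : ∀ y : ℝ, |y| ≤ 2 * Real.sqrt N → ⌊y / ρ⌋ ∈ J := by
    intro y hy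
    have h1 : |y / ρ| ≤ 2 * Real.sqrt X := by
      rw [abs_div, abs_of_pos hρ, div_le_iff₀ hρ, hρdef]
      have : 2 * Real.sqrt X * (Real.sqrt N / Real.sqrt X) = 2 * Real.sqrt N := by field_simp
      rw [this]; exact hy
    rw [abs_le] at h1
    rw [hJ, Finset.mem_Icc]
    refine ⟨?_, Int.floor_le_floor h1.2⟩
    rw [Int.le_floor]
    push_cast
    linarith [Int.lt_floor_add_one (2 * Real.sqrt X)]
  have hφ : ∀ m ∈ S, φ m ∈ J ×ˢ J := by
    intro m hm
    rw [Finset.mem_product]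
    exact ⟨hrange _ ((Complex.abs_re_le_norm _).trans (hxn m hm)),
      hrange _ ((Complex.abs_im_le_norm _).trans (hxn m hm))⟩
  have hcard : ((J ×ˢ J).card : ℝ) ≤ 36 * X := by
    have h1 : (J.card : ℤ) = 2 * L + 2 := by
      rw [hJ, Int.card_Icc, Int.toNat_of_nonneg (by omega)]; ring
    have h2 : (J.card : ℝ) = 2 * (L : ℝ) + 2 := by exact_mod_cast h1
    have h3 : (J.card : ℝ) ≤ 6 * Real.sqrt X := by
      rw [h2]; linarith [Int.floor_le (2 * Real.sqrt X)]
    rw [Finset.card_product]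
    push_cast
    calc _ ≤ (6 * Real.sqrt X) * (6 * Real.sqrt X) := by gcongr
      _ = 36 * (Real.sqrt X * Real.sqrt X) := by ring
      _ = _ := by rw [Real.mul_self_sqrt hXpos.le]
  set ctr : ℤ × ℤ → ℂ := fun p => ⟨p.1 * ρ, p.2 * ρ⟩ with hctr
  have hclose : ∀ m, ‖x m - ctr (φ m)‖ ≤ 2 * ρ := by
    intro m
    have key : ∀ y : ℝ, |y - ⌊y / ρ⌋ * ρ| ≤ ρ := by
      intro y
      have h1 := Int.floor_le (y / ρ)
      have h2 := Int.lt_floor_add_one (y / ρ)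
      rw [le_div_iff₀ hρ] at h1
      rw [div_lt_iff₀ hρ] at h2
      rw [abs_le]; constructor <;> nlinarith
    refine (Complex.norm_le_abs_re_add_abs_im _).trans ?_
    have h1 := key (x m).re
    have h2 := key (x m).im
    simp only [hctr, hφdef, Complex.sub_re, Complex.sub_im]
    linarith
  set Q := E * (E * (9 * (2 * (16 * ρ * Real.sqrt N) + ‖(c : ℂ)‖) ^ 2)) with hQ
  have hQ0 : 0 ≤ Q := by positivity
  have hσ : ∀ σ : ℝ, |σ| = 1 → ∀ i j : ℤ × ℤ,
      BB (S.filter fun m => φ m = i) (S.filter fun m => φ m = j)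
      (fun m n => Complex.exp (((4 * Real.pi * σ * (x m * x n * θ / (c : ℂ)).re : ℝ) : ℂ) *
      Complex.I) * kloosterman m n c) Q := by
    intro σ h1 i j
    refine cell_BB c hc θ N X ρ hN hX (by rw [hXc]; linarith) hρ.le hρX x _ _ (ctr i) (ctr j) hx
      ?_ ?_ ?_ ?_ σ h1
    · intro m hm
      rw [← (Finset.mem_filter.1 hm).2]; exact hclose m
    · intro m hm
      rw [← (Finset.mem_filter.1 hm).2]; exact hclose m
    · exact fun m hm => hxn m (Finset.mem_filter.1 hm).1
    · exact fun m hm => hxn m (Finset.mem_filter.1 hm).1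
  have hfinal := BB.cells hQ0 φ (J ×ˢ J) hφ
    (fun i _ j _ => (hσ 1 (by norm_num) i j).half (hσ (-1) (by norm_num) i j)) b
    (fun n => conj (b n))
  simp only [RCLike.norm_conj] at hfinal
  rw [← hB, ← hnorm] at hfinal
  have hn0 : 0 ≤ sqNorm b N := by rw [hnorm]; positivity
  rw [Real.mul_self_sqrt hn0] at hfinal
  refine hfinal.trans ?_
  refine mul_le_mul_of_nonneg_right ?_ hn0
  have hlog : 1 / 2 ≤ Real.log (2 + N * ‖θ‖) := by
    have h1 := Real.log_two_gt_d9
    have h2 : Real.log 2 ≤ Real.log (2 + N * ‖θ‖) :=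
      Real.log_le_log (by norm_num) (by have : 0 ≤ N * ‖θ‖ := by positivity
                                        linarith)
    linarith
  have hρN : (ρ * Real.sqrt N) ^ 2 * X = N ^ 2 := by
    rw [mul_pow, Real.sq_sqrt hN.le, mul_right_comm, hρX]; ring
  have h4 : (2 * (16 * ρ * Real.sqrt N) + ‖(c : ℂ)‖) ^ 2 ≤
      2048 * (ρ * Real.sqrt N) ^ 2 + 2 * ‖(c : ℂ)‖ ^ 2 := by
    nlinarith [sq_nonneg (32 * (ρ * Real.sqrt N) - ‖(c : ℂ)‖)]
  have hP : 0 ≤ N * ‖(c : ℂ)‖ * ‖θ‖ := by positivity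
  have h5 : N * ‖(c : ℂ)‖ * ‖θ‖ * (1 / 2) ≤ N * ‖(c : ℂ)‖ * ‖θ‖ * Real.log (2 + N * ‖θ‖) :=
    mul_le_mul_of_nonneg_left hlog hP
  calc Q * ((J ×ˢ J).card : ℝ) ≤ Q * (36 * X) := by gcongr
    _ ≤ (E * (E * (9 * (2048 * (ρ * Real.sqrt N) ^ 2 + 2 * ‖(c : ℂ)‖ ^ 2)))) * (36 * X) := by
      rw [hQ]; gcongr
    _ = E * E * (36 * 18 * (1024 * ((ρ * Real.sqrt N) ^ 2 * X) +
        (X * ‖(c : ℂ)‖) * ‖(c : ℂ)‖)) := by ring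
    _ = E * E * (36 * 18 * (1024 * N ^ 2 + ‖(c : ℂ)‖ ^ 2 + N * ‖(c : ℂ)‖ * ‖θ‖)) := by
      rw [hρN, hXc]; ring
    _ ≤ E * E * (36 * 18 * (1024 * (‖(c : ℂ)‖ ^ 2 + N ^ 2 +
              N * ‖(c : ℂ)‖ * ‖θ‖ * Real.log (2 + N * ‖θ‖)))) := by
      have := sq_nonneg ‖(c : ℂ)‖
      gcongr
      linarith
    _ = _ := by ring
end
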